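/- For a graph property P, the following are equivalent: (a) P is testable; (b) for every ε > 0 there exist ε' > 0 and n' > 0 such that whenever G ∈ P and G' is any other graph with δ_□(G,G') < ε' and |V(G)|, |V(G')| ≥ n', then d₁(G',P) < ε; (c) for every ε > 0 there exist ε₀ > 0 and n₀ > 0 such that whenever G ∈ P and G' is an induced subgraph of G with δ_□(G,G') < ε₀ and |V(G')| ≥ n₀, then d₁(G',P) < ε. -/

import Mathlib

open MeasureTheory Filter Topology
open scoped ENNReal

noncomputable section

/-- The unit interval `[0,1]` as a subset of `ℝ`. -/
def I01 : Set ℝ := Set.Icc 0 1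

/-- `W₀`: symmetric measurable functions `[0,1]² → [0,1]`
(represented as functions `ℝ → ℝ → ℝ`, with the relevant values on `[0,1]²`). -/
def IsGraphon (W : ℝ → ℝ → ℝ) : Prop :=
  Measurable (Function.uncurry W) ∧ (∀ x y, W x y = W y x) ∧
    ∀ x y, W x y ∈ Set.Icc (0 : ℝ) 1

/-- The `L¹` norm of a kernel on `[0,1]²`. -/
def l1Norm (W : ℝ → ℝ → ℝ) : ℝ :=
  ∫ x in I01, ∫ y in I01, |W x y|

/-- The cut norm of a kernel on `[0,1]²`. -/
def cutNorm (W : ℝ → ℝ → ℝ) : ℝ :=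
  sSup { r : ℝ | ∃ S T : Set ℝ, MeasurableSet S ∧ MeasurableSet T ∧ S ⊆ I01 ∧ T ⊆ I01 ∧
    r = |∫ x in S, ∫ y in T, W x y| }

/-- An invertible measure preserving map of `[0,1]`. -/
structure InvMP where
  toFun : ℝ → ℝ
  invFun : ℝ → ℝ
  maps : ∀ x ∈ I01, toFun x ∈ I01
  mapsInv : ∀ x ∈ I01, invFun x ∈ I01
  measurePreserving :
    MeasurePreserving toFun (volume.restrict I01) (volume.restrict I01)
  measurePreservingInv :
    MeasurePreserving invFun (volume.restrict I01) (volume.restrict I01)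
  leftInv : ∀ x ∈ I01, invFun (toFun x) = x
  rightInv : ∀ x ∈ I01, toFun (invFun x) = x

/-- `δ_□`: the cut distance, infimum of the cut norm over invertible measure
preserving transformations of `[0,1]`. -/
def deltaCut (U W : ℝ → ℝ → ℝ) : ℝ :=
  ⨅ φ : InvMP, cutNorm (fun x y => U x y - W (φ.toFun x) (φ.toFun y))

/-- `δ₁`: the `L¹` distance minimized over invertible measure preserving
transformations of `[0,1]`. -/
def delta1 (U W : ℝ → ℝ → ℝ) : ℝ :=
  ⨅ φ : InvMP, l1Norm (fun x y => U x y - W (φ.toFun x) (φ.toFun y))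



/-- A graph property: for each `n`, a set of simple graphs on `Fin n`. -/
def GraphProp := ∀ n : ℕ, Set (SimpleGraph (Fin n))

/-- Invariance under isomorphism (isomorphic graphs necessarily have the same
number of vertices). -/
def IsGraphProperty (P : GraphProp) : Prop :=
  ∀ (n : ℕ) (G H : SimpleGraph (Fin n)), Nonempty (G ≃g H) → (G ∈ P n ↔ H ∈ P n)

/-- The normalized edit distance between graphs on a common vertex set. -/
def graphD1 {n : ℕ} (G H : SimpleGraph (Fin n)) : ℝ :=
  (symmDiff G.edgeSet H.edgeSet).ncard / (n ^ 2 : ℝ)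

/-- The edit distance from a graph to a graph property (∞ if the property
contains no graph on the same number of nodes). -/
def graphD1P {n : ℕ} (G : SimpleGraph (Fin n)) (P : GraphProp) : ℝ≥0∞ :=
  ⨅ (H : SimpleGraph (Fin n)) (_ : H ∈ P n), ENNReal.ofReal (graphD1 G H)

open Classical in
/-- The step function `W_G` associated with a graph `G` on `{1,…,n}`:
its value on `((i−1)/n, i/n] × ((j−1)/n, j/n]` is `1` iff `ij ∈ E(G)`. -/
def graphonOf {n : ℕ} (G : SimpleGraph (Fin n)) : ℝ → ℝ → ℝ := fun x y =>
  if ∃ i j : Fin n, G.Adj i j ∧ x ∈ Set.Ioc (((i : ℕ) : ℝ) / n) ((((i : ℕ) : ℝ) + 1) / n)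
      ∧ y ∈ Set.Ioc (((j : ℕ) : ℝ) / n) ((((j : ℕ) : ℝ) + 1) / n)
  then 1 else 0

/-- `H` is (isomorphic to) an induced subgraph of `G`. -/
def IsInducedSubgraph {n k : ℕ} (G : SimpleGraph (Fin n)) (H : SimpleGraph (Fin k)) : Prop :=
  ∃ f : Fin k ↪ Fin n, ∀ i j, H.Adj i j ↔ G.Adj (f i) (f j)

/-- The subgraph of `G` induced on the vertex subset `S` has property `P`
(as a graph on `k = |S|` nodes). -/
def inducedMem {n : ℕ} (G : SimpleGraph (Fin n)) (S : Finset (Fin n)) (k : ℕ)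
    (P : GraphProp) : Prop :=
  ∃ H : SimpleGraph (Fin k), H ∈ P k ∧
    ∃ f : Fin k ↪ Fin n, (∀ i, f i ∈ S) ∧ ∀ i j, H.Adj i j ↔ G.Adj (f i) (f j)

/-- The number of `k`-element vertex subsets of `G` inducing a subgraph with property `P`. -/
def goodCount {n : ℕ} (G : SimpleGraph (Fin n)) (k : ℕ) (P : GraphProp) : ℕ :=
  {S : Finset (Fin n) | S.card = k ∧ inducedMem G S k P}.ncard

/-- Testability of a graph property (Definition 1.1 of the paper). -/
def GraphTestable (P : GraphProp) : Prop :=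
  ∃ P' : GraphProp, IsGraphProperty P' ∧
    (∀ (n : ℕ) (G : SimpleGraph (Fin n)), G ∈ P n → ∀ k, 1 ≤ k → k ≤ n →
      2 * n.choose k ≤ 3 * goodCount G k P') ∧
    (∀ ε : ℝ, 0 < ε → ∃ kε : ℕ, 1 ≤ kε ∧
      ∀ (n : ℕ) (G : SimpleGraph (Fin n)) (k : ℕ), kε ≤ k → k ≤ n →
        ENNReal.ofReal ε ≤ graphD1P G P →
        3 * goodCount G k P' ≤ n.choose k)

def cube (k : ℕ) : Set (Fin k → ℝ) := Set.univ.pi fun _ => I01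

open Classical in
/-- The homomorphism density `t(F,W)`. -/
def homDensity {k : ℕ} (F : SimpleGraph (Fin k)) (W : ℝ → ℝ → ℝ) : ℝ :=
  ∫ x in cube k, ∏ i : Fin k, ∏ j : Fin k,
    if i < j ∧ F.Adj i j then W (x i) (x j) else 1

open Classical in
/-- The induced density `t_ind(F,W)`. -/
def indDensity {k : ℕ} (F : SimpleGraph (Fin k)) (W : ℝ → ℝ → ℝ) : ℝ :=
  ∫ x in cube k, ∏ i : Fin k, ∏ j : Fin k,
    if i < j then (if F.Adj i j then W (x i) (x j) else 1 - W (x i) (x j)) else 1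

/-- Isomorphism of functions in `W₀`: equality of all homomorphism densities. -/
def GraphonIso (U W : ℝ → ℝ → ℝ) : Prop :=
  ∀ (k : ℕ) (F : SimpleGraph (Fin k)), homDensity F U = homDensity F W

open Classical in
/-- `P(G(k,W) ∈ R')`, the probability that the `W`-random graph on `k` nodes
has property `R'`. -/
def probIn (k : ℕ) (W : ℝ → ℝ → ℝ) (R' : GraphProp) : ℝ :=
  ∑ F : SimpleGraph (Fin k), if F ∈ R' k then indDensity F W else 0

/-- The `L¹` distance from `W` to a set `R` of kernels, with value `∞` for `R = ∅`. -/
def d1SetE (W : ℝ → ℝ → ℝ) (R : Set (ℝ → ℝ → ℝ)) : ℝ≥0∞ :=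
  ⨅ (U : ℝ → ℝ → ℝ) (_ : U ∈ R), ENNReal.ofReal (l1Norm fun x y => W x y - U x y)

/-- The cut-norm distance from `W` to a set `R` of kernels, with value `∞` for `R = ∅`. -/
def dCutSetE (W : ℝ → ℝ → ℝ) (R : Set (ℝ → ℝ → ℝ)) : ℝ≥0∞ :=
  ⨅ (U : ℝ → ℝ → ℝ) (_ : U ∈ R), ENNReal.ofReal (cutNorm fun x y => W x y - U x y)

/-- The open ball `B₁(R,c)` (within `W₀`). -/
def ball1 (R : Set (ℝ → ℝ → ℝ)) (c : ℝ) : Set (ℝ → ℝ → ℝ) :=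
  {W | IsGraphon W ∧ d1SetE W R < ENNReal.ofReal c}

/-- The open ball `B_□(R,c)` (within `W₀`). -/
def ballCut (R : Set (ℝ → ℝ → ℝ)) (c : ℝ) : Set (ℝ → ℝ → ℝ) :=
  {W | IsGraphon W ∧ dCutSetE W R < ENNReal.ofReal c}

/-- A graphon property: a set of graphons invariant under isomorphism. -/
def IsGraphonProperty (R : Set (ℝ → ℝ → ℝ)) : Prop :=
  (∀ W ∈ R, IsGraphon W) ∧
    ∀ U W, IsGraphon U → IsGraphon W → GraphonIso U W → (U ∈ R ↔ W ∈ R)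

/-- A set of graphons is closed if it is closed in the cut norm. -/
def CutClosed (R : Set (ℝ → ℝ → ℝ)) : Prop :=
  ∀ W, IsGraphon W →
    (∀ ε : ℝ, 0 < ε → ∃ U ∈ R, cutNorm (fun x y => W x y - U x y) < ε) → W ∈ R

/-- Testability of a graphon property. -/
def GraphonTestable (R : Set (ℝ → ℝ → ℝ)) : Prop :=
  ∃ R' : GraphProp, IsGraphProperty R' ∧
    (∀ W ∈ R, ∀ k : ℕ, 1 ≤ k → (2 : ℝ) / 3 ≤ probIn k W R') ∧
    (∀ ε : ℝ, 0 < ε → ∃ kε : ℕ, 1 ≤ kε ∧ ∀ k, kε ≤ k → ∀ W, IsGraphon W →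
      ENNReal.ofReal ε ≤ d1SetE W R → probIn k W R' ≤ 1 / 3)

/-- The closure `P̄` of a graph property: limits of convergent sequences
of graphs in `P` with sizes tending to infinity. -/
def closureP (P : GraphProp) : Set (ℝ → ℝ → ℝ) :=
  {W | IsGraphon W ∧ ∃ (n : ℕ → ℕ) (G : ∀ m, SimpleGraph (Fin (n m))),
    (∀ m, G m ∈ P (n m)) ∧ Tendsto n atTop atTop ∧
    Tendsto (fun m => deltaCut (graphonOf (G m)) W) atTop (nhds 0)}

/-- A graph property is robust if graphs whose `W_G` is `d₁`-close to `P̄`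
are themselves close to `P` in edit distance. -/
def Robust (P : GraphProp) : Prop :=
  ∀ ε : ℝ, 0 < ε → ∃ (N : ℕ) (ε' : ℝ), 1 ≤ N ∧ 0 < ε' ∧
    ∀ (n : ℕ), N ≤ n → ∀ G : SimpleGraph (Fin n),
      d1SetE (graphonOf G) (closureP P) ≤ ENNReal.ofReal ε' →
      graphD1P G P ≤ ENNReal.ofReal ε

/-- A hereditary graph property: closed under induced subgraphs. -/
def Hereditary (P : GraphProp) : Prop :=
  ∀ (n : ℕ) (G : SimpleGraph (Fin n)), G ∈ P n →
    ∀ (k : ℕ) (H : SimpleGraph (Fin k)), IsInducedSubgraph G H → H ∈ P k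

/-- `U` is a flexing of `W`: `U ∈ W₀` agrees with `W` wherever `W` takes value `0` or `1`. -/
def Flexing (U W : ℝ → ℝ → ℝ) : Prop :=
  IsGraphon U ∧ ∀ x y, (W x y = 0 ∨ W x y = 1) → U x y = W x y

/-- A function property is flexible if it is preserved under flexing. -/
def FlexibleFamily (R : Set (ℝ → ℝ → ℝ)) : Prop :=
  ∀ W ∈ R, ∀ U, Flexing U W → U ∈ R

/-- `U' ≤ W'` almost everywhere on `[0,1]²`. -/
def aeLE (U W : ℝ → ℝ → ℝ) : Prop :=
  ∀ᵐ p ∂(volume.restrict (I01 ×ˢ I01)), U p.1 p.2 ≤ W p.1 p.2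

/-- `U ⪯ W`: up to isomorphism, `U ≤ W` almost everywhere. -/
def graphonLE (U W : ℝ → ℝ → ℝ) : Prop :=
  ∃ U' W', IsGraphon U' ∧ IsGraphon W' ∧ GraphonIso U U' ∧ GraphonIso W W' ∧ aeLE U' W'

/-- The upward closure of a graph property: graphs having a spanning subgraph in `P`. -/
def upP (P : GraphProp) : GraphProp :=
  fun n => {G | ∃ H : SimpleGraph (Fin n), H ∈ P n ∧ H ≤ G}

/-- The upward closure of a function property. -/
def upR (R : Set (ℝ → ℝ → ℝ)) : Set (ℝ → ℝ → ℝ) :=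
  {W | IsGraphon W ∧ ∃ U ∈ R, graphonLE U W}

/-- A stepfunction: constant on the products of a finite measurable partition of `[0,1]`. -/
def IsStepfunction (W : ℝ → ℝ → ℝ) : Prop :=
  ∃ (m : ℕ) (S : Fin m → Set ℝ), (∀ i, MeasurableSet (S i)) ∧
    (⋃ i, S i) = I01 ∧ (∀ i j, i ≠ j → Disjoint (S i) (S j)) ∧
    ∀ i j : Fin m, ∀ x ∈ S i, ∀ x' ∈ S i, ∀ y ∈ S j, ∀ y' ∈ S j, W x y = W x' y'

open Classical in
/-- A testable graphon functional: its value can be estimated from `W`-random graphs. -/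
def TestableFunctional (f : (ℝ → ℝ → ℝ) → ℝ) : Prop :=
  ∃ g : ∀ n : ℕ, SimpleGraph (Fin n) → ℝ,
    (∀ (n : ℕ) (G H : SimpleGraph (Fin n)), Nonempty (G ≃g H) → g n G = g n H) ∧
    ∀ ε : ℝ, 0 < ε → ∃ kε : ℕ, 1 ≤ kε ∧ ∀ k, kε ≤ k → ∀ W, IsGraphon W →
      (∑ F : SimpleGraph (Fin k), if ε < |f W - g k F| then indDensity F W else 0) < 1 / 3



/-! ## Basic measure theory of the unit interval and the cut bound -/

/-- Lebesgue measure on the unit interval. -/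
def mu : Measure ℝ := volume.restrict I01

instance mu_prob : IsProbabilityMeasure mu := by
  constructor
  simp [mu, I01]

/-- `D` has cut norm at most `r` with respect to the pair of measures `α, β`. -/
def CutBd (α β : Measure ℝ) (D : ℝ × ℝ → ℝ) (r : ℝ) : Prop :=
  ∀ S T : Set ℝ, MeasurableSet S → MeasurableSet T →
    |∫ z in S ×ˢ T, D z ∂(α.prod β)| ≤ r

/-- A bounded measurable kernel with values in `[-1,1]`. -/
def BKer (D : ℝ × ℝ → ℝ) : Prop := Measurable D ∧ ∀ z, |D z| ≤ 1

/-- A bounded measurable kernel with values in `[0,1]`. -/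
def PKer (D : ℝ × ℝ → ℝ) : Prop := Measurable D ∧ ∀ z, D z ∈ Set.Icc (0 : ℝ) 1

theorem PKer.sub {U V : ℝ × ℝ → ℝ} (hU : PKer U) (hV : PKer V) :
    BKer (fun z => U z - V z) := by
  refine ⟨hU.1.sub hV.1, fun z => ?_⟩
  have h1 := hU.2 z
  have h2 := hV.2 z
  rw [abs_le]
  constructor <;> linarith [h1.1, h1.2, h2.1, h2.2]

theorem PKer.bker {U : ℝ × ℝ → ℝ} (hU : PKer U) : BKer U := by
  refine ⟨hU.1, fun z => ?_⟩
  have h1 := hU.2 z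
  rw [abs_le]
  constructor <;> linarith [h1.1, h1.2]

theorem BKer.integrable {D : ℝ × ℝ → ℝ} (hD : BKer D) (ν : Measure (ℝ × ℝ)) [IsFiniteMeasure ν] :
    Integrable D ν :=
  Integrable.of_bound hD.1.aestronglyMeasurable 1 (Eventually.of_forall fun z => by
    simpa using hD.2 z)

theorem CutBd.nonneg {α β : Measure ℝ} {D : ℝ × ℝ → ℝ} {r : ℝ} (h : CutBd α β D r) : 0 ≤ r :=
  (abs_nonneg _).trans (h ∅ ∅ MeasurableSet.empty MeasurableSet.empty)

theorem CutBd.mono {α β : Measure ℝ} {D : ℝ × ℝ → ℝ} {r s : ℝ} (h : CutBd α β D r) (hrs : r ≤ s) :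
    CutBd α β D s := fun S T hS hT => (h S T hS hT).trans hrs

theorem CutBd.add {D E : ℝ × ℝ → ℝ} {r s : ℝ} (hD : BKer D) (hE : BKer E)
    (h : CutBd mu mu D r) (h' : CutBd mu mu E s) :
    CutBd mu mu (fun z => D z + E z) (r + s) := by
  intro S T hS hT
  rw [integral_add (hD.integrable _) (hE.integrable _)]
  exact (abs_add_le _ _).trans (add_le_add (h S T hS hT) (h' S T hS hT))

theorem CutBd.neg {α β : Measure ℝ} {D : ℝ × ℝ → ℝ} {r : ℝ}
    (h : CutBd α β D r) : CutBd α β (fun z => - D z) r := by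
  intro S T hS hT
  rw [integral_neg, abs_neg]
  exact h S T hS hT

theorem CutBd.trans {U V W : ℝ × ℝ → ℝ} {r s : ℝ} (hU : PKer U) (hV : PKer V) (hW : PKer W)
    (h : CutBd mu mu (fun z => U z - V z) r) (h' : CutBd mu mu (fun z => V z - W z) s) :
    CutBd mu mu (fun z => U z - W z) (r + s) := by
  have := CutBd.add (hU.sub hV) (hV.sub hW) h h'
  simpa using this

theorem CutBd.symm {U V : ℝ × ℝ → ℝ} {r : ℝ}
    (h : CutBd mu mu (fun z => U z - V z) r) :
    CutBd mu mu (fun z => V z - U z) r := by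
  have := h.neg
  simpa using this

theorem CutBd.of_l1 {D : ℝ × ℝ → ℝ} {r : ℝ} (hD : BKer D)
    (h : ∫ z, |D z| ∂(mu.prod mu) ≤ r) : CutBd mu mu D r := by
  intro S T hS hT
  refine (abs_integral_le_integral_abs).trans (le_trans ?_ h)
  exact setIntegral_le_integral (hD.integrable _).abs (Eventually.of_forall fun z => abs_nonneg _)

theorem CutBd.one {D : ℝ × ℝ → ℝ} (hD : BKer D) : CutBd mu mu D 1 := by
  refine CutBd.of_l1 hD ?_
  calc ∫ z, |D z| ∂(mu.prod mu) ≤ ∫ z, (1 : ℝ) ∂(mu.prod mu) :=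
        integral_mono (hD.integrable _).abs (integrable_const _) hD.2
    _ = 1 := by simp

/-! ### Composition with measure preserving maps -/

def twist (φ : InvMP) (U : ℝ × ℝ → ℝ) : ℝ × ℝ → ℝ := fun z => U (φ.toFun z.1, φ.toFun z.2)

theorem PKer.twist {U : ℝ × ℝ → ℝ} (hU : PKer U) (φ : InvMP) : PKer (twist φ U) := by
  refine ⟨?_, fun z => hU.2 _⟩
  have h1 := φ.measurePreserving.measurable
  exact hU.1.comp ((h1.comp measurable_fst).prodMk (h1.comp measurable_snd))

theorem BKer.twist {U : ℝ × ℝ → ℝ} (hU : BKer U) (φ : InvMP) : BKer (twist φ U) := by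
  refine ⟨?_, fun z => hU.2 _⟩
  have h1 := φ.measurePreserving.measurable
  exact hU.1.comp ((h1.comp measurable_fst).prodMk (h1.comp measurable_snd))

def InvMP.id : InvMP where
  toFun := fun x => x
  invFun := fun x => x
  maps := fun _ h => h
  mapsInv := fun _ h => h
  measurePreserving := MeasurePreserving.id _
  measurePreservingInv := MeasurePreserving.id _
  leftInv := fun _ _ => rfl
  rightInv := fun _ _ => rfl

def InvMP.symm (φ : InvMP) : InvMP where
  toFun := φ.invFun
  invFun := φ.toFun
  maps := φ.mapsInv
  mapsInv := φ.maps
  measurePreserving := φ.measurePreservingInv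
  measurePreservingInv := φ.measurePreserving
  leftInv := φ.rightInv
  rightInv := φ.leftInv

/-- `φ ∘ ψ`. -/
def InvMP.comp (φ ψ : InvMP) : InvMP where
  toFun := fun x => φ.toFun (ψ.toFun x)
  invFun := fun x => ψ.invFun (φ.invFun x)
  maps := fun _ h => φ.maps _ (ψ.maps _ h)
  mapsInv := fun _ h => ψ.mapsInv _ (φ.mapsInv _ h)
  measurePreserving := φ.measurePreserving.comp ψ.measurePreserving
  measurePreservingInv := ψ.measurePreservingInv.comp φ.measurePreservingInv
  leftInv := fun x h => by rw [φ.leftInv _ (ψ.maps _ h), ψ.leftInv _ h]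
  rightInv := fun x h => by rw [ψ.rightInv _ (φ.mapsInv _ h), φ.rightInv _ h]

theorem twist_id (U : ℝ × ℝ → ℝ) : twist InvMP.id U = U := rfl

theorem twist_comp (φ ψ : InvMP) (U : ℝ × ℝ → ℝ) :
    twist (φ.comp ψ) U = twist ψ (twist φ U) := rfl

theorem ae_mem_I01 : ∀ᵐ x ∂mu, x ∈ I01 :=
  ae_restrict_mem measurableSet_Icc

theorem ae_mem_I01_prod : ∀ᵐ z ∂(mu.prod mu), z.1 ∈ I01 ∧ z.2 ∈ I01 := by
  have h1 : ∀ᵐ z ∂(mu.prod mu), z.1 ∈ I01 :=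
    Measure.quasiMeasurePreserving_fst.ae ae_mem_I01
  have h2 : ∀ᵐ z ∂(mu.prod mu), z.2 ∈ I01 :=
    Measure.quasiMeasurePreserving_snd.ae ae_mem_I01
  filter_upwards [h1, h2] with z h1 h2 using ⟨h1, h2⟩

theorem integral_twist (φ : InvMP) {D : ℝ × ℝ → ℝ} (hD : Measurable D) :
    ∫ z, twist φ D z ∂(mu.prod mu) = ∫ z, D z ∂(mu.prod mu) := by
  have hmp : MeasurePreserving (Prod.map φ.toFun φ.toFun) (mu.prod mu) (mu.prod mu) :=
    MeasurePreserving.prod φ.measurePreserving φ.measurePreserving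
  conv_rhs => rw [← hmp.map_eq]
  rw [integral_map hmp.measurable.aemeasurable hD.aestronglyMeasurable]
  rfl

theorem CutBd.twist {D : ℝ × ℝ → ℝ} {r : ℝ} (hD : BKer D) (h : CutBd mu mu D r) (φ : InvMP) :
    CutBd mu mu (twist φ D) r := by
  intro S T hS hT
  have hm := φ.measurePreservingInv.measurable
  have hS' := hm hS
  have hT' := hm hT
  have key := h _ _ hS' hT'
  rw [← integral_indicator (hS'.prod hT')] at key
  rw [← integral_twist φ (hD.1.indicator (hS'.prod hT'))] at key
  rw [← integral_indicator (hS.prod hT)]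
  convert key using 2
  apply integral_congr_ae
  filter_upwards [ae_mem_I01_prod] with z hz
  have hiff : (φ.toFun z.1, φ.toFun z.2) ∈ (φ.invFun ⁻¹' S) ×ˢ (φ.invFun ⁻¹' T) ↔ z ∈ S ×ˢ T := by
    rw [Set.mem_prod, Set.mem_prod, Set.mem_preimage, Set.mem_preimage]
    show φ.invFun (φ.toFun z.1) ∈ S ∧ φ.invFun (φ.toFun z.2) ∈ T ↔ _
    rw [φ.leftInv _ hz.1, φ.leftInv _ hz.2]
  by_cases hzz : z ∈ S ×ˢ T
  · rw [Set.indicator_of_mem hzz]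
    show _ = Set.indicator _ _ _
    rw [Set.indicator_of_mem (hiff.2 hzz)]
    rfl
  · rw [Set.indicator_of_notMem hzz]
    show _ = Set.indicator _ _ _
    rw [Set.indicator_of_notMem (fun hh => hzz (hiff.1 hh))]

/-! ### The relation between `cutNorm` and `CutBd` -/

theorem cut_integral_eq {D : ℝ → ℝ → ℝ} (hD : BKer (Function.uncurry D)) {S T : Set ℝ}
    (hS : S ⊆ I01) (hT : T ⊆ I01) :
    ∫ x in S, ∫ y in T, D x y = ∫ z in S ×ˢ T, Function.uncurry D z ∂(mu.prod mu) := by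
  rw [setIntegral_prod]
  · have h1 : mu.restrict S = volume.restrict S := by
      rw [mu, Measure.restrict_restrict_of_subset hS]
    have h2 : mu.restrict T = volume.restrict T := by
      rw [mu, Measure.restrict_restrict_of_subset hT]
    rw [h1, h2]
    rfl
  · exact (hD.integrable _).integrableOn

theorem cutNorm_bddAbove {D : ℝ → ℝ → ℝ} (hD : BKer (Function.uncurry D)) :
    BddAbove { r : ℝ | ∃ S T : Set ℝ, MeasurableSet S ∧ MeasurableSet T ∧ S ⊆ I01 ∧ T ⊆ I01 ∧
    r = |∫ x in S, ∫ y in T, D x y| } := by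
  refine ⟨1, ?_⟩
  rintro r ⟨S, T, hS, hT, hS', hT', rfl⟩
  rw [cut_integral_eq hD hS' hT']
  exact CutBd.one hD S T hS hT

theorem CutBd.of_cutNorm {D : ℝ → ℝ → ℝ} (hD : BKer (Function.uncurry D)) {r : ℝ}
    (h : cutNorm D ≤ r) : CutBd mu mu (Function.uncurry D) r := by
  intro S T hS hT
  have hI : MeasurableSet I01 := measurableSet_Icc
  have h1 : |∫ x in S ∩ I01, ∫ y in T ∩ I01, D x y| ≤ cutNorm D :=
    le_csSup (cutNorm_bddAbove hD) ⟨S ∩ I01, T ∩ I01, hS.inter hI, hT.inter hI,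
      Set.inter_subset_right, Set.inter_subset_right, rfl⟩
  rw [cut_integral_eq hD Set.inter_subset_right Set.inter_subset_right] at h1
  refine le_trans (le_of_eq ?_) (h1.trans h)
  congr 1
  apply setIntegral_congr_set
  filter_upwards [ae_mem_I01_prod] with z hz
  apply propext
  show z ∈ S ×ˢ T ↔ z ∈ (S ∩ I01) ×ˢ (T ∩ I01)
  simp [Set.mem_prod, hz.1, hz.2]

theorem cutNorm_le_of_CutBd {D : ℝ → ℝ → ℝ} (hD : BKer (Function.uncurry D)) {r : ℝ}
    (h : CutBd mu mu (Function.uncurry D) r) : cutNorm D ≤ r := by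
  apply csSup_le
  · exact ⟨_, ∅, ∅, MeasurableSet.empty, MeasurableSet.empty, Set.empty_subset _,
      Set.empty_subset _, rfl⟩
  · rintro r ⟨S, T, hS, hT, hS', hT', rfl⟩
    rw [cut_integral_eq hD hS' hT']
    exact h S T hS hT

theorem cutNorm_nonneg (D : ℝ → ℝ → ℝ) : 0 ≤ cutNorm D := by
  apply Real.sSup_nonneg
  rintro r ⟨S, T, hS, hT, hS', hT', rfl⟩
  exact abs_nonneg _

/-- Closeness in cut distance. -/
def Cl (r : ℝ) (U V : ℝ × ℝ → ℝ) : Prop :=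
  ∃ φ : InvMP, CutBd mu mu (fun z => U z - twist φ V z) r

theorem Cl.mono {U V : ℝ × ℝ → ℝ} {r s : ℝ} (h : Cl r U V) (hrs : r ≤ s) : Cl s U V := by
  obtain ⟨φ, h⟩ := h
  exact ⟨φ, h.mono hrs⟩

theorem twist_symm_ae (φ : InvMP) (V : ℝ × ℝ → ℝ) :
    twist φ.symm (twist φ V) =ᵐ[mu.prod mu] V := by
  filter_upwards [ae_mem_I01_prod] with z hz
  simp only [twist, InvMP.symm, φ.rightInv _ hz.1, φ.rightInv _ hz.2]

theorem CutBd.congr {D E : ℝ × ℝ → ℝ} {r : ℝ} (h : CutBd mu mu D r)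
    (hDE : D =ᵐ[mu.prod mu] E) : CutBd mu mu E r := by
  intro S T hS hT
  rw [← setIntegral_congr_ae (hS.prod hT) (hDE.mono fun z hz _ => hz)]
  exact h S T hS hT

theorem Cl.symm {U V : ℝ × ℝ → ℝ} {r : ℝ} (hU : PKer U) (hV : PKer V) (h : Cl r U V) :
    Cl r V U := by
  obtain ⟨φ, h⟩ := h
  refine ⟨φ.symm, ?_⟩
  have h2 := CutBd.twist (hU.sub (hV.twist φ)) h φ.symm
  refine CutBd.symm (h2.congr ?_)
  filter_upwards [twist_symm_ae φ V] with z hz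
  have : twist φ.symm (fun z => U z - twist φ V z) z =
    twist φ.symm U z - twist φ.symm (twist φ V) z := rfl
  rw [this, hz]

theorem Cl.trans {U V W : ℝ × ℝ → ℝ} {r s : ℝ} (hU : PKer U) (hV : PKer V) (hW : PKer W)
    (h : Cl r U V) (h' : Cl s V W) : Cl (r + s) U W := by
  obtain ⟨φ, h⟩ := h
  obtain ⟨ψ, h'⟩ := h'
  refine ⟨ψ.comp φ, ?_⟩
  rw [twist_comp]
  exact CutBd.trans hU (hV.twist φ) ((hW.twist ψ).twist φ) h
    (CutBd.twist (hV.sub (hW.twist ψ)) h' φ)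

theorem Cl.of_deltaCut {U V : ℝ → ℝ → ℝ} {r : ℝ} (hU : PKer (Function.uncurry U))
    (hV : PKer (Function.uncurry V)) (h : deltaCut U V < r) :
    Cl r (Function.uncurry U) (Function.uncurry V) := by
  have : Nonempty InvMP := ⟨InvMP.id⟩
  obtain ⟨φ, hφ⟩ := exists_lt_of_ciInf_lt h
  exact ⟨φ, CutBd.of_cutNorm (D := fun x y => U x y - V (φ.toFun x) (φ.toFun y)) (hU.sub (hV.twist φ)) hφ.le⟩

theorem deltaCut_le_of_Cl {U V : ℝ → ℝ → ℝ} {r : ℝ} (hU : PKer (Function.uncurry U))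
    (hV : PKer (Function.uncurry V)) (h : Cl r (Function.uncurry U) (Function.uncurry V)) :
    deltaCut U V ≤ r := by
  obtain ⟨φ, hφ⟩ := h
  refine (ciInf_le ⟨0, ?_⟩ φ).trans (cutNorm_le_of_CutBd
    (D := fun x y => U x y - V (φ.toFun x) (φ.toFun y)) (hU.sub (hV.twist φ)) hφ)
  rintro _ ⟨ψ, rfl⟩
  exact cutNorm_nonneg _


/-! ## The functional form of the cut norm and the counting lemma -/

theorem abs_integral_mul_le {X : Type*} [MeasurableSpace X] (ν : Measure X)
    (h f : X → ℝ) (hm : Measurable h) (hi : Integrable h ν) (hfm : Measurable f)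
    (hf : ∀ x, f x ∈ Set.Icc (0 : ℝ) 1) {r : ℝ}
    (hr : ∀ S, MeasurableSet S → |∫ x in S, h x ∂ν| ≤ r) :
    |∫ x, f x * h x ∂ν| ≤ r := by
  have hfi : Integrable (fun x => f x * h x) ν := by
    refine hi.bdd_mul (c := 1) hfm.aestronglyMeasurable (Eventually.of_forall fun x => ?_)
    rw [Real.norm_eq_abs, abs_of_nonneg (hf x).1]
    exact (hf x).2
  have hS1 : MeasurableSet {x | 0 ≤ h x} := measurableSet_le measurable_const hm
  have hS2 : MeasurableSet {x | h x ≤ 0} := measurableSet_le hm measurable_const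
  have h1 := (abs_le.1 (hr _ hS1)).2
  have h2 := (abs_le.1 (hr _ hS2)).1
  rw [← integral_indicator hS1] at h1
  rw [← integral_indicator hS2] at h2
  rw [abs_le]
  constructor
  · refine h2.trans (integral_mono (hi.indicator hS2) hfi fun x => ?_)
    by_cases hx : h x ≤ 0
    · rw [Set.indicator_of_mem (by exact hx)]
      nlinarith [(hf x).1, (hf x).2]
    · rw [Set.indicator_of_notMem (by exact hx)]
      exact mul_nonneg (hf x).1 (not_le.1 hx).le
  · refine (integral_mono hfi (hi.indicator hS1) fun x => ?_).trans h1
    by_cases hx : 0 ≤ h x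
    · rw [Set.indicator_of_mem (by exact hx)]
      show f x * h x ≤ h x
      nlinarith [(hf x).1, (hf x).2]
    · rw [Set.indicator_of_notMem (by exact hx)]
      exact mul_nonpos_of_nonneg_of_nonpos (hf x).1 (not_le.1 hx).le

theorem fcut {α β : Measure ℝ} [IsProbabilityMeasure α] [IsProbabilityMeasure β]
    {D : ℝ × ℝ → ℝ} {r : ℝ} (hD : BKer D) (h : CutBd α β D r) (f g : ℝ → ℝ)
    (hfm : Measurable f) (hgm : Measurable g)
    (hf : ∀ x, f x ∈ Set.Icc (0 : ℝ) 1) (hg : ∀ x, g x ∈ Set.Icc (0 : ℝ) 1) :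
    |∫ z, D z * (f z.1 * g z.2) ∂(α.prod β)| ≤ r := by
  have step1 : ∀ S, MeasurableSet S → |∫ z in S ×ˢ Set.univ, D z * g z.2 ∂(α.prod β)| ≤ r := by
    intro S hS
    have hgD : BKer (fun z => g z.2 * D z) := by
      refine ⟨(hgm.comp measurable_snd).mul hD.1, fun z => ?_⟩
      rw [abs_mul, abs_of_nonneg (hg _).1]
      exact mul_le_one₀ (hg _).2 (abs_nonneg _) (hD.2 z)
    have e1 : ∫ z in S ×ˢ Set.univ, D z * g z.2 ∂(α.prod β) =
        ∫ y, g y * ∫ x in S, D (x, y) ∂α ∂β := by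
      have : (α.prod β).restrict (S ×ˢ Set.univ) = (α.restrict S).prod β := by
        rw [← Measure.prod_restrict, Measure.restrict_univ]
      rw [this, integral_prod_symm]
      · congr 1
        ext y
        rw [← integral_const_mul]
        congr 1
        ext x
        exact mul_comm _ _
      · have := hgD.integrable ((α.restrict S).prod β)
        simpa [mul_comm] using this
    rw [e1]
    have hmeas : StronglyMeasurable (fun y => ∫ x in S, D (x, y) ∂α) :=
      StronglyMeasurable.integral_prod_left' (f := D) hD.1.stronglyMeasurable
    have hIntg : Integrable (fun y => ∫ x in S, D (x, y) ∂α) β :=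
      (hD.integrable ((α.restrict S).prod β)).integral_prod_right
    apply abs_integral_mul_le β _ g hmeas.measurable hIntg hgm hg
    intro T hT
    have e2 : ∫ y in T, ∫ x in S, D (x, y) ∂α ∂β = ∫ z in S ×ˢ T, D z ∂(α.prod β) := by
      rw [← Measure.prod_restrict, integral_prod_symm]
      exact hD.integrable _
    rw [e2]
    exact h S T hS hT
  have hgD : BKer (fun z => D z * g z.2) := by
    refine ⟨hD.1.mul (hgm.comp measurable_snd), fun z => ?_⟩
    rw [abs_mul, abs_of_nonneg (hg _).1]
    exact mul_le_one₀ (hD.2 z) (hg _).1 (hg _).2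
  have := abs_integral_mul_le (α.prod β) (fun z => D z * g z.2)
    (fun z => f z.1) hgD.1 (hgD.integrable _) (hfm.comp measurable_fst) (fun z => hf _)
    (r := r)
  have e3 : ∫ z, D z * (f z.1 * g z.2) ∂(α.prod β) =
      ∫ x, f x * ∫ y, D (x, y) * g y ∂β ∂α := by
    rw [integral_prod]
    · congr 1
      ext x
      rw [← integral_const_mul]
      congr 1
      ext y
      ring
    · have hk : BKer (fun z => D z * (f z.1 * g z.2)) := by
        refine ⟨hD.1.mul ((hfm.comp measurable_fst).mul (hgm.comp measurable_snd)), fun z => ?_⟩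
        rw [abs_mul, abs_mul, abs_of_nonneg (hg _).1, abs_of_nonneg (hf _).1]
        exact mul_le_one₀ (hD.2 z) (mul_nonneg (hf _).1 (hg _).1)
          (mul_le_one₀ (hf _).2 (hg _).1 (hg _).2)
      exact hk.integrable _
  rw [e3]
  have hmeas : StronglyMeasurable (fun x => ∫ y, D (x, y) * g y ∂β) :=
    StronglyMeasurable.integral_prod_right' (f := fun z => D z * g z.2) hgD.1.stronglyMeasurable
  have hIntg : Integrable (fun x => ∫ y, D (x, y) * g y ∂β) α :=
    (hgD.integrable (α.prod β)).integral_prod_left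
  apply abs_integral_mul_le α _ f hmeas.measurable hIntg hfm hf
  intro S hS
  have e4 : ∫ x in S, ∫ y, D (x, y) * g y ∂β ∂α =
      ∫ z in S ×ˢ Set.univ, D z * g z.2 ∂(α.prod β) := by
    have : (α.prod β).restrict (S ×ˢ Set.univ) = (α.restrict S).prod β := by
      rw [← Measure.prod_restrict, Measure.restrict_univ]
    rw [this, integral_prod]
    exact hgD.integrable _
  rw [e4]
  exact step1 S hS

/-! ### Resampling two coordinates -/

section resample

variable {ι : Type} [Fintype ι] [DecidableEq ι] (ν : ι → Measure ℝ)
  [∀ i, IsProbabilityMeasure (ν i)]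

theorem measurePreserving_update (a : ι) :
    MeasurePreserving (fun p : (ι → ℝ) × ℝ => Function.update p.1 a p.2)
      ((Measure.pi ν).prod (ν a)) (Measure.pi ν) := by
  have hm : Measurable (fun p : (ι → ℝ) × ℝ => Function.update p.1 a p.2) := by
    rw [measurable_pi_iff]
    intro i
    by_cases hi : i = a
    · subst hi
      simpa using measurable_snd
    · simp only [Function.update_of_ne hi]
      exact (measurable_pi_apply i).comp measurable_fst
  refine ⟨hm, (Measure.pi_eq fun s hs => ?_).symm⟩
  rw [Measure.map_apply hm (MeasurableSet.univ_pi hs)]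
  have hpre : (fun p : (ι → ℝ) × ℝ => Function.update p.1 a p.2) ⁻¹' (Set.univ.pi s) =
      (Set.univ.pi (Function.update s a Set.univ)) ×ˢ s a := by
    ext p
    simp only [Set.mem_preimage, Set.mem_pi, Set.mem_univ, true_implies, Set.mem_prod]
    constructor
    · intro h
      refine ⟨fun i => ?_, by simpa using h a⟩
      by_cases hi : i = a
      · subst hi; simp
      · have := h i
        rw [Function.update_of_ne hi] at this
        rw [Function.update_of_ne hi]
        exact this
    · rintro ⟨h1, h2⟩ i
      by_cases hi : i = a
      · subst hi; simpa using h2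
      · have := h1 i
        rw [Function.update_of_ne hi] at this
        rw [Function.update_of_ne hi]
        exact this
  rw [hpre, Measure.prod_prod, Measure.pi_pi]
  rw [← Finset.mul_prod_erase _ _ (Finset.mem_univ a),
    ← Finset.mul_prod_erase Finset.univ (fun i => ν i (s i)) (Finset.mem_univ a)]
  simp only [Function.update_self, measure_univ, one_mul]
  rw [mul_comm]
  congr 1
  apply Finset.prod_congr rfl
  intro i hi
  rw [Function.update_of_ne (Finset.ne_of_mem_erase hi)]

theorem measurePreserving_update2 (a b : ι) :
    MeasurePreserving (fun p : (ι → ℝ) × (ℝ × ℝ) =>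
      Function.update (Function.update p.1 a p.2.1) b p.2.2)
      ((Measure.pi ν).prod ((ν a).prod (ν b))) (Measure.pi ν) := by
  have h1 := (measurePreserving_prodAssoc (Measure.pi ν) (ν a) (ν b)).symm
  have h2 := (measurePreserving_update ν a).prod (MeasurePreserving.id (ν b))
  have h3 := measurePreserving_update ν b
  exact h3.comp (h2.comp h1)

theorem integral_resample (a b : ι) {Q : (ι → ℝ) → ℝ} (hQ : Measurable Q) {c : ℝ}
    (hb : ∀ x, |Q x| ≤ c) :
    ∫ x, Q x ∂(Measure.pi ν) = ∫ x, ∫ z, Q (Function.update (Function.update x a z.1) b z.2)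
      ∂((ν a).prod (ν b)) ∂(Measure.pi ν) := by
  have hmp := measurePreserving_update2 ν a b
  conv_lhs => rw [← hmp.map_eq]
  rw [integral_map hmp.measurable.aemeasurable hQ.aestronglyMeasurable, integral_prod]
  refine Integrable.of_bound (hQ.comp hmp.measurable).aestronglyMeasurable c
    (Eventually.of_forall fun x => ?_)
  exact hb _

end resample

/-! ### The counting lemma -/

theorem prod_kernel_measurable {ι : Type} (E : Finset (ι × ι)) (M : ι × ι → ℝ × ℝ → ℝ)
    (hM : ∀ e, PKer (M e)) :
    Measurable (fun x : ι → ℝ => ∏ e ∈ E, M e (x e.1, x e.2)) := by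
  apply Finset.measurable_fun_prod
  intro e _
  exact (hM e).1.comp ((measurable_pi_apply _).prodMk (measurable_pi_apply _))

theorem prod_kernel_mem {ι : Type} (E : Finset (ι × ι)) (M : ι × ι → ℝ × ℝ → ℝ)
    (hM : ∀ e, PKer (M e)) (x : ι → ℝ) :
    ∏ e ∈ E, M e (x e.1, x e.2) ∈ Set.Icc (0 : ℝ) 1 :=
  ⟨Finset.prod_nonneg fun e _ => ((hM e).2 _).1,
    Finset.prod_le_one (fun e _ => ((hM e).2 _).1) (fun e _ => ((hM e).2 _).2)⟩

section counting

variable {ι : Type} [Fintype ι] [DecidableEq ι] [LinearOrder ι] (ν : ι → Measure ℝ)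
  [∀ i, IsProbabilityMeasure (ν i)]

theorem counting_swap (E : Finset (ι × ι)) (hE : ∀ e ∈ E, e.1 < e.2) (M : ι × ι → ℝ × ℝ → ℝ)
    (hM : ∀ e, PKer (M e)) (e₀ : ι × ι) (h₀ : e₀.1 < e₀.2) (h₀E : e₀ ∉ E) {D : ℝ × ℝ → ℝ}
    (hD : BKer D) {r : ℝ} (hr : CutBd (ν e₀.1) (ν e₀.2) D r) :
    |∫ x, D (x e₀.1, x e₀.2) * ∏ e ∈ E, M e (x e.1, x e.2) ∂(Measure.pi ν)| ≤ r := by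
  obtain ⟨a, b⟩ := e₀
  simp only at h₀ hr ⊢
  have hQm : Measurable (fun x : ι → ℝ => D (x a, x b) * ∏ e ∈ E, M e (x e.1, x e.2)) :=
    (hD.1.comp ((measurable_pi_apply _).prodMk (measurable_pi_apply _))).mul
      (prod_kernel_measurable E M hM)
  rw [integral_resample ν a b hQm (c := 1)]
  · have hb : ∀ x : ι → ℝ, ‖∫ z, (fun x : ι → ℝ => D (x a, x b) * ∏ e ∈ E, M e (x e.1, x e.2))
        (Function.update (Function.update x a z.1) b z.2) ∂((ν a).prod (ν b))‖ ≤ r := by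
      intro x
      let f : ℝ → ℝ := fun s => ∏ e ∈ E with ¬ (e.1 = b ∨ e.2 = b),
        M e (Function.update x a s e.1, Function.update x a s e.2)
      let g : ℝ → ℝ := fun t => ∏ e ∈ E with (e.1 = b ∨ e.2 = b),
        M e (Function.update x b t e.1, Function.update x b t e.2)
      have hfm : Measurable f :=
        (prod_kernel_measurable _ M hM).comp (measurable_update x)
      have hgm : Measurable g :=
        (prod_kernel_measurable _ M hM).comp (measurable_update x)
      have hf : ∀ s, f s ∈ Set.Icc (0 : ℝ) 1 := fun s => prod_kernel_mem _ M hM _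
      have hg : ∀ s, g s ∈ Set.Icc (0 : ℝ) 1 := fun s => prod_kernel_mem _ M hM _
      have key := fcut hD hr f g hfm hgm hf hg
      rw [Real.norm_eq_abs]
      refine le_trans (le_of_eq ?_) key
      congr 1
      congr 1
      ext z
      have hab : a ≠ b := h₀.ne
      simp only [Function.update_self, Function.update_of_ne hab]
      congr 1
      rw [← Finset.prod_filter_mul_prod_filter_not E (fun e => e.1 = b ∨ e.2 = b), mul_comm]
      congr 1
      · apply Finset.prod_congr rfl
        intro e he
        rw [Finset.mem_filter, not_or] at he
        rw [Function.update_of_ne he.2.1, Function.update_of_ne he.2.2]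
      · apply Finset.prod_congr rfl
        intro e he
        rw [Finset.mem_filter] at he
        have hlt := hE e he.1
        have hne : e ≠ (a, b) := fun h => h₀E (h ▸ he.1)
        have ha1 : e.1 ≠ a := by
          intro h1
          rcases he.2 with h2 | h2
          · exact hab (h1 ▸ h2)
          · exact hne (Prod.ext h1 h2)
        have ha2 : e.2 ≠ a := by
          intro h1
          rcases he.2 with h2 | h2
          · rw [h1, h2] at hlt
            exact lt_asymm hlt h₀
          · exact hab (h1 ▸ h2)
        have hcomm : Function.update (Function.update x a z.1) b z.2 =
            Function.update (Function.update x b z.2) a z.1 :=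
          Function.update_comm hab _ _ _
        rw [hcomm, Function.update_of_ne ha1, Function.update_of_ne ha2]
    have := norm_integral_le_of_norm_le_const (μ := Measure.pi ν) (Eventually.of_forall hb)
    simpa using this
  · intro x
    have := prod_kernel_mem E M hM x
    rw [abs_mul, abs_of_nonneg this.1]
    exact mul_le_one₀ (hD.2 _) this.1 this.2

theorem counting (E : Finset (ι × ι)) (hE : ∀ e ∈ E, e.1 < e.2) (M N : ι × ι → ℝ × ℝ → ℝ)
    (hM : ∀ e, PKer (M e)) (hN : ∀ e, PKer (N e)) {r : ℝ}
    (hr : ∀ e ∈ E, CutBd (ν e.1) (ν e.2) (fun z => M e z - N e z) r) :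
    |∫ x, ∏ e ∈ E, M e (x e.1, x e.2) ∂(Measure.pi ν) -
      ∫ x, ∏ e ∈ E, N e (x e.1, x e.2) ∂(Measure.pi ν)| ≤ E.card * r := by
  have hIntg : ∀ (F : Finset (ι × ι)) (L : ι × ι → ℝ × ℝ → ℝ), (∀ e, PKer (L e)) →
      Integrable (fun x : ι → ℝ => ∏ e ∈ F, L e (x e.1, x e.2)) (Measure.pi ν) := by
    intro F L hL
    refine Integrable.of_bound (prod_kernel_measurable F L hL).aestronglyMeasurable 1
      (Eventually.of_forall fun x => ?_)
    have := prod_kernel_mem F L hL x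
    rw [Real.norm_eq_abs, abs_of_nonneg this.1]
    exact this.2
  -- hybrid argument
  have main : ∀ s : Finset (ι × ι), s ⊆ E →
      |∫ x, ∏ e ∈ E, (if e ∈ s then M e else N e) (x e.1, x e.2) ∂(Measure.pi ν) -
      ∫ x, ∏ e ∈ E, N e (x e.1, x e.2) ∂(Measure.pi ν)| ≤ s.card * r := by
    intro s
    induction s using Finset.induction_on with
    | empty => intro _; simp
    | insert e₀ s he₀ ih =>
      intro hs
      have he₀E : e₀ ∈ E := hs (Finset.mem_insert_self _ _)
      have ih' := ih (fun x hx => hs (Finset.mem_insert_of_mem hx))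
      have hH : ∀ t : Finset (ι × ι), ∀ e, PKer (if e ∈ t then M e else N e) := by
        intro t e
        split_ifs
        exacts [hM e, hN e]
      have hsw := counting_swap ν (E.erase e₀) (fun e he => hE e (Finset.mem_of_mem_erase he))
        (fun e => if e ∈ s then M e else N e) (hH s) e₀ (hE _ he₀E) (Finset.notMem_erase _ _)
        ((hM e₀).sub (hN e₀)) (hr e₀ he₀E)
      have heq : ∫ x, ∏ e ∈ E, (if e ∈ insert e₀ s then M e else N e) (x e.1, x e.2)
            ∂(Measure.pi ν) -
          ∫ x, ∏ e ∈ E, (if e ∈ s then M e else N e) (x e.1, x e.2) ∂(Measure.pi ν) =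
          ∫ x, (M e₀ (x e₀.1, x e₀.2) - N e₀ (x e₀.1, x e₀.2)) *
            ∏ e ∈ E.erase e₀, (if e ∈ s then M e else N e) (x e.1, x e.2) ∂(Measure.pi ν) := by
        rw [← integral_sub (hIntg E _ (hH _)) (hIntg E _ (hH _))]
        congr 1
        ext x
        rw [← Finset.mul_prod_erase E _ he₀E, ← Finset.mul_prod_erase E
          (fun e => (if e ∈ s then M e else N e) (x e.1, x e.2)) he₀E]
        have : ∏ e ∈ E.erase e₀, (if e ∈ insert e₀ s then M e else N e) (x e.1, x e.2) =
            ∏ e ∈ E.erase e₀, (if e ∈ s then M e else N e) (x e.1, x e.2) := by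
          apply Finset.prod_congr rfl
          intro e he
          have hne := Finset.ne_of_mem_erase he
          simp [Finset.mem_insert, hne]
        rw [this]
        simp only [Finset.mem_insert_self, if_true, he₀, if_false]
        ring
      rw [← heq] at hsw
      rw [Finset.card_insert_of_notMem he₀]
      push_cast
      calc _ ≤ _ := abs_sub_le _
            (∫ x, ∏ e ∈ E, (if e ∈ s then M e else N e) (x e.1, x e.2) ∂(Measure.pi ν)) _
        _ ≤ r + s.card * r := add_le_add hsw ih'
        _ = _ := by ring
  have := main E (Finset.Subset.refl _)
  have e : ∀ x : ι → ℝ, ∏ e ∈ E, (if e ∈ E then M e else N e) (x e.1, x e.2) =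
      ∏ e ∈ E, M e (x e.1, x e.2) := by
    intro x
    apply Finset.prod_congr rfl
    intro e he
    simp [he]
  simpa only [e] using this

end counting


/-! ## Weak limits of kernels -/

theorem weak_limit (V : ℕ → ℝ × ℝ → ℝ) (hV : ∀ i, PKer (V i)) :
    ∃ W : ℝ × ℝ → ℝ, PKer W ∧ ∀ E, MeasurableSet E →
      Tendsto (fun i => ∫ z in E, V i z ∂(mu.prod mu)) (hyperfilter ℕ : Filter ℕ)
        (𝓝 (∫ z in E, W z ∂(mu.prod mu))) := by
  set m : Measure (ℝ × ℝ) := mu.prod mu with hm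
  have hmem : ∀ i, MemLp (V i) 2 m := fun i =>
    MemLp.of_bound (hV i).1.aestronglyMeasurable 1 (Eventually.of_forall fun z => by
      simpa using (hV i).bker.2 z)
  let v : ℕ → Lp ℝ 2 m := fun i => (hmem i).toLp (V i)
  have hnorm : ∀ i, ‖v i‖ ≤ 1 := by
    intro i
    have := Lp.norm_le_of_ae_bound (f := v i) (C := 1) zero_le_one (by
      filter_upwards [(hmem i).coeFn_toLp] with z hz
      rw [hz]
      simpa using (hV i).bker.2 z)
    have hu : (measureUnivNNReal m : ℝ) = 1 := by
      simp [measureUnivNNReal, hm]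
    simpa [hu] using this
  let d : ℕ → WeakDual ℝ (Lp ℝ 2 m) := fun i =>
    StrongDual.toWeakDual (InnerProductSpace.toDual ℝ _ (v i))
  have hK := WeakDual.isCompact_closedBall (𝕜 := ℝ) (E := Lp ℝ 2 m) 0 1
  have hd : ∀ i, d i ∈ WeakDual.toStrongDual ⁻¹' Metric.closedBall (0 : StrongDual ℝ (Lp ℝ 2 m)) 1 := by
    intro i
    show (InnerProductSpace.toDual ℝ _ (v i)) ∈ Metric.closedBall _ _
    rw [mem_closedBall_zero_iff, LinearIsometryEquiv.norm_map]
    exact hnorm i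
  obtain ⟨ℓ, -, hℓ⟩ := isCompact_iff_ultrafilter_le_nhds.1 hK ((hyperfilter ℕ).map d) (by
    rw [le_principal_iff]
    exact Ultrafilter.mem_map.2 (Filter.univ_mem' hd))
  have hlim : Tendsto d (hyperfilter ℕ : Filter ℕ) (𝓝 ℓ) := hℓ
  have heval : ∀ y : Lp ℝ 2 m, Tendsto (fun i => inner ℝ (v i) y) (hyperfilter ℕ : Filter ℕ)
      (𝓝 (ℓ y)) := fun y => ((WeakDual.eval_continuous y).tendsto ℓ).comp hlim
  let w : Lp ℝ 2 m := (InnerProductSpace.toDual ℝ _).symm (WeakDual.toStrongDual ℓ)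
  have hw : ∀ y : Lp ℝ 2 m, ℓ y = inner ℝ w y := by
    intro y
    rw [InnerProductSpace.toDual_symm_apply]
    rfl
  have hset : ∀ E, MeasurableSet E → Tendsto (fun i => ∫ z in E, V i z ∂m)
      (hyperfilter ℕ : Filter ℕ) (𝓝 (∫ z in E, w z ∂m)) := by
    intro E hE
    have h1 := heval (indicatorConstLp 2 hE (measure_ne_top m E) (1 : ℝ))
    rw [hw] at h1
    have e1 : ∀ f : Lp ℝ 2 m, inner ℝ f (indicatorConstLp 2 hE (measure_ne_top m E) (1 : ℝ)) =
        ∫ z in E, f z ∂m := by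
      intro f
      rw [real_inner_comm, L2.inner_indicatorConstLp_one]
    simp only [e1] at h1
    refine h1.congr fun i => ?_
    apply setIntegral_congr_ae hE
    filter_upwards [(hmem i).coeFn_toLp] with z hz _
    exact hz
  have hwi : Integrable (fun z => w z) m := (Lp.memLp w).integrable one_le_two
  have hw0 : 0 ≤ᵐ[m] fun z => w z := by
    apply ae_nonneg_of_forall_setIntegral_nonneg hwi
    intro E hE _
    refine ge_of_tendsto' (hset E hE) fun i => ?_
    exact integral_nonneg fun z => ((hV i).2 z).1
  have hw1 : (fun z => w z) ≤ᵐ[m] fun _ => (1 : ℝ) := by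
    apply ae_le_of_forall_setIntegral_le hwi (integrable_const _)
    intro E hE _
    refine le_of_tendsto' (hset E hE) fun i => ?_
    exact integral_mono ((hV i).bker.integrable _) (integrable_const _) fun z => ((hV i).2 z).2
  have hwm : AEMeasurable (fun z => w z) m := hwi.aestronglyMeasurable.aemeasurable
  let W : ℝ × ℝ → ℝ := fun z => max 0 (min 1 (hwm.mk _ z))
  have hWw : W =ᵐ[m] fun z => w z := by
    filter_upwards [hw0, hw1, hwm.ae_eq_mk] with z h0 h1 h2
    show max 0 (min 1 (hwm.mk _ z)) = w z
    have h0' : (0 : ℝ) ≤ w z := h0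
    rw [← h2, min_eq_right h1, max_eq_right h0']
  refine ⟨W, ⟨?_, fun z => ⟨le_max_left _ _, max_le zero_le_one (min_le_left _ _)⟩⟩, ?_⟩
  · exact measurable_const.max (measurable_const.min hwm.measurable_mk)
  · intro E hE
    have : ∫ z in E, W z ∂m = ∫ z in E, w z ∂m :=
      setIntegral_congr_ae hE (hWw.mono fun z hz _ => hz)
    rw [this]
    exact hset E hE

/-- A sequence of kernels which is Cauchy in the cut norm converges, both in the cut norm
and weakly along an ultrafilter. -/
theorem cauchy_limit (V : ℕ → ℝ × ℝ → ℝ) (hV : ∀ i, PKer (V i)) (r : ℕ → ℝ)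
    (hr : ∀ i j, i ≤ j → CutBd mu mu (fun z => V i z - V j z) (r i)) :
    ∃ W : ℝ × ℝ → ℝ, PKer W ∧ (∀ i, CutBd mu mu (fun z => V i z - W z) (r i)) ∧
      ∀ E, MeasurableSet E →
      Tendsto (fun i => ∫ z in E, V i z ∂(mu.prod mu)) (hyperfilter ℕ : Filter ℕ)
        (𝓝 (∫ z in E, W z ∂(mu.prod mu))) := by
  obtain ⟨W, hW, hlim⟩ := weak_limit V hV
  refine ⟨W, hW, fun i S T hS hT => ?_, hlim⟩
  have h1 := hlim _ (hS.prod hT)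
  rw [integral_sub ((hV i).bker.integrable _) (hW.bker.integrable _)]
  have h2 := (h1.const_sub (∫ z in S ×ˢ T, V i z ∂(mu.prod mu))).abs
  refine le_of_tendsto h2 ?_
  have : ∀ᶠ j in (hyperfilter ℕ : Filter ℕ), i ≤ j :=
    Nat.hyperfilter_le_atTop (eventually_ge_atTop i)
  filter_upwards [this] with j hj
  rw [← integral_sub ((hV i).bker.integrable _) ((hV j).bker.integrable _)]
  exact hr i j hj S T hS hT


/-! ## Cells, step kernels, interval permutations -/

def cell (n : ℕ) (a : Fin n) : Set ℝ :=
  Set.Ioc (((a : ℕ) : ℝ) / n) ((((a : ℕ) : ℝ) + 1) / n)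

theorem cell_measurable (n : ℕ) (a : Fin n) : MeasurableSet (cell n a) := measurableSet_Ioc

theorem cell_npos {n : ℕ} (a : Fin n) : (0 : ℝ) < n := by
  have : 0 < n := a.pos
  exact_mod_cast this

theorem mem_cell {n : ℕ} {a : Fin n} {x : ℝ} :
    x ∈ cell n a ↔ ((a : ℕ) : ℝ) < x * n ∧ x * n ≤ ((a : ℕ) : ℝ) + 1 := by
  have hn := cell_npos a
  unfold cell
  rw [Set.mem_Ioc, div_lt_iff₀ hn, le_div_iff₀ hn]

theorem cell_unique {n : ℕ} {a b : Fin n} {x : ℝ} (ha : x ∈ cell n a) (hb : x ∈ cell n b) :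
    a = b := by
  rw [mem_cell] at ha hb
  have h1 : ((a : ℕ) : ℝ) < (b : ℕ) + 1 := by linarith
  have h2 : ((b : ℕ) : ℝ) < (a : ℕ) + 1 := by linarith
  have h1' : (a : ℕ) < (b : ℕ) + 1 := by exact_mod_cast h1
  have h2' : (b : ℕ) < (a : ℕ) + 1 := by exact_mod_cast h2
  apply Fin.ext
  omega

theorem cell_subset {n : ℕ} (a : Fin n) : cell n a ⊆ I01 := by
  intro x hx
  rw [mem_cell] at hx
  have hn := cell_npos a
  have h1 : ((a : ℕ) : ℝ) + 1 ≤ n := by exact_mod_cast a.2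
  have h0 : (0 : ℝ) ≤ (a : ℕ) := Nat.cast_nonneg _
  constructor
  · by_contra h
    push Not at h
    nlinarith
  · by_contra h
    push Not at h
    nlinarith

theorem exists_cell {n : ℕ} (hn : 0 < n) {x : ℝ} (h0 : 0 < x) (h1 : x ≤ 1) :
    ∃ a : Fin n, x ∈ cell n a := by
  have hn' : (0 : ℝ) < n := by exact_mod_cast hn
  have hp : 0 < x * n := by positivity
  have hc : 0 < ⌈x * n⌉₊ := Nat.ceil_pos.2 hp
  have hle : ⌈x * n⌉₊ ≤ n := Nat.ceil_le.2 (by nlinarith)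
  refine ⟨⟨⌈x * n⌉₊ - 1, by omega⟩, ?_⟩
  rw [mem_cell]
  simp only
  rw [Nat.cast_sub hc]
  have h3 := Nat.le_ceil (x * n)
  have h4 := Nat.ceil_lt_add_one hp.le
  push_cast
  constructor <;> linarith

theorem volume_cell {n : ℕ} (a : Fin n) : volume (cell n a) = ENNReal.ofReal (1 / n) := by
  unfold cell
  rw [Real.volume_Ioc]
  congr 1
  ring

theorem mu_cell {n : ℕ} (a : Fin n) : mu.real (cell n a) = 1 / n := by
  unfold mu
  rw [Measure.real, Measure.restrict_apply (cell_measurable n a),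
    Set.inter_eq_left.2 (cell_subset a), volume_cell, ENNReal.toReal_ofReal (by positivity)]

def cind (n : ℕ) (a : Fin n) : ℝ → ℝ := (cell n a).indicator 1

theorem cind_measurable (n : ℕ) (a : Fin n) : Measurable (cind n a) :=
  measurable_one.indicator (cell_measurable n a)

theorem cind_mem {n : ℕ} {a : Fin n} {x : ℝ} (h : x ∈ cell n a) : cind n a x = 1 := by
  simp [cind, h]

theorem cind_not_mem {n : ℕ} {a : Fin n} {x : ℝ} (h : x ∉ cell n a) : cind n a x = 0 := by
  simp [cind, h]

theorem sum_cind_of_mem {n : ℕ} {a : Fin n} {x : ℝ} (h : x ∈ cell n a) (f : Fin n → ℝ) :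
    ∑ b, f b * cind n b x = f a := by
  rw [Finset.sum_eq_single a]
  · rw [cind_mem h, mul_one]
  · intro b _ hb
    rw [cind_not_mem, mul_zero]
    intro h'
    exact hb (cell_unique h' h)
  · simp

theorem sum_cind_of_not_mem {n : ℕ} {x : ℝ} (h : ∀ a, x ∉ cell n a) (f : Fin n → ℝ) :
    ∑ b, f b * cind n b x = 0 := by
  apply Finset.sum_eq_zero
  intro b _
  rw [cind_not_mem (h b), mul_zero]

def stepK (n : ℕ) (M : Fin n → Fin n → ℝ) (z : ℝ × ℝ) : ℝ :=
  ∑ a, (∑ b, M a b * cind n b z.2) * cind n a z.1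

theorem stepK_mem {n : ℕ} {M : Fin n → Fin n → ℝ} {a b : Fin n} {x y : ℝ}
    (hx : x ∈ cell n a) (hy : y ∈ cell n b) : stepK n M (x, y) = M a b := by
  unfold stepK
  rw [sum_cind_of_mem hx, sum_cind_of_mem hy]

theorem stepK_not_mem_left {n : ℕ} {M : Fin n → Fin n → ℝ} {x y : ℝ}
    (hx : ∀ a, x ∉ cell n a) : stepK n M (x, y) = 0 := by
  unfold stepK
  rw [sum_cind_of_not_mem hx]

theorem stepK_not_mem_right {n : ℕ} {M : Fin n → Fin n → ℝ} {x y : ℝ}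
    (hy : ∀ a, y ∉ cell n a) : stepK n M (x, y) = 0 := by
  unfold stepK
  apply Finset.sum_eq_zero
  intro a _
  rw [sum_cind_of_not_mem hy, zero_mul]

theorem stepK_measurable (n : ℕ) (M : Fin n → Fin n → ℝ) : Measurable (stepK n M) := by
  unfold stepK
  refine Finset.measurable_sum _ fun a _ => Measurable.mul ?_ ((cind_measurable n a).comp measurable_fst)
  exact Finset.measurable_sum _ fun b _ => ((cind_measurable n b).comp measurable_snd).const_mul _

theorem stepK_cases {n : ℕ} (M : Fin n → Fin n → ℝ) (z : ℝ × ℝ) :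
    stepK n M z = 0 ∨ ∃ a b, z.1 ∈ cell n a ∧ z.2 ∈ cell n b ∧ stepK n M z = M a b := by
  by_cases h1 : ∃ a, z.1 ∈ cell n a
  · by_cases h2 : ∃ b, z.2 ∈ cell n b
    · obtain ⟨a, ha⟩ := h1
      obtain ⟨b, hb⟩ := h2
      exact Or.inr ⟨a, b, ha, hb, stepK_mem ha hb⟩
    · push Not at h2
      exact Or.inl (stepK_not_mem_right h2)
  · push Not at h1
    exact Or.inl (stepK_not_mem_left h1)

theorem stepK_pker {n : ℕ} {M : Fin n → Fin n → ℝ} (hM : ∀ a b, M a b ∈ Set.Icc (0 : ℝ) 1) :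
    PKer (stepK n M) := by
  refine ⟨stepK_measurable n M, fun z => ?_⟩
  rcases stepK_cases M z with h | ⟨a, b, _, _, h⟩
  · rw [h]; simp
  · rw [h]; exact hM a b

theorem stepK_sub {n : ℕ} (M N : Fin n → Fin n → ℝ) (z : ℝ × ℝ) :
    stepK n M z - stepK n N z = stepK n (fun a b => M a b - N a b) z := by
  unfold stepK
  rw [← Finset.sum_sub_distrib]
  refine Finset.sum_congr rfl fun a _ => ?_
  rw [← sub_mul, ← Finset.sum_sub_distrib]
  simp only [sub_mul]

open Classical in
def adjR {n : ℕ} (G : SimpleGraph (Fin n)) (a b : Fin n) : ℝ := if G.Adj a b then 1 else 0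

theorem adjR_mem {n : ℕ} (G : SimpleGraph (Fin n)) (a b : Fin n) :
    adjR G a b ∈ Set.Icc (0 : ℝ) 1 := by
  unfold adjR
  split_ifs <;> simp

theorem graphonOf_eq {n : ℕ} (G : SimpleGraph (Fin n)) :
    Function.uncurry (graphonOf G) = stepK n (adjR G) := by
  funext z
  obtain ⟨x, y⟩ := z
  show graphonOf G x y = _
  unfold graphonOf
  rcases stepK_cases (adjR G) (x, y) with h | ⟨a, b, ha, hb, h⟩
  · rw [h, if_neg]
    rintro ⟨i, j, hij, hx, hy⟩
    have := stepK_mem (M := adjR G) (a := i) (b := j) hx hy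
    rw [h] at this
    simp [adjR, hij] at this
  · rw [h]
    unfold adjR
    classical
    refine if_congr ?_ rfl rfl
    constructor
    · rintro ⟨i, j, hij, hx, hy⟩
      have e1 : a = i := cell_unique ha hx
      have e2 : b = j := cell_unique hb hy
      subst e1
      subst e2
      exact hij
    · intro hab
      exact ⟨a, b, hab, ha, hb⟩

theorem graphonOf_pker {n : ℕ} (G : SimpleGraph (Fin n)) :
    PKer (Function.uncurry (graphonOf G)) := by
  rw [graphonOf_eq]
  exact stepK_pker (adjR_mem G)

/-! interval permutations -/

def iperm {n : ℕ} (σ : Equiv.Perm (Fin n)) (x : ℝ) : ℝ :=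
  x + ∑ a, ((((σ a : Fin n) : ℕ) : ℝ) - ((a : ℕ) : ℝ)) / n * cind n a x

theorem iperm_mem {n : ℕ} (σ : Equiv.Perm (Fin n)) {x : ℝ} {a : Fin n} (h : x ∈ cell n a) :
    iperm σ x = x + ((((σ a : Fin n) : ℕ) : ℝ) - ((a : ℕ) : ℝ)) / n := by
  unfold iperm
  rw [sum_cind_of_mem h]

theorem iperm_not_mem {n : ℕ} (σ : Equiv.Perm (Fin n)) {x : ℝ} (h : ∀ a, x ∉ cell n a) :
    iperm σ x = x := by
  unfold iperm
  rw [sum_cind_of_not_mem h, add_zero]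

theorem iperm_mem_cell {n : ℕ} (σ : Equiv.Perm (Fin n)) {x : ℝ} {a : Fin n} (h : x ∈ cell n a) :
    iperm σ x ∈ cell n (σ a) := by
  have hn := cell_npos a
  rw [iperm_mem σ h]
  rw [mem_cell] at h ⊢
  rw [add_mul, div_mul_cancel₀ _ hn.ne']
  constructor <;> linarith [h.1, h.2]

theorem iperm_inv {n : ℕ} (σ : Equiv.Perm (Fin n)) (x : ℝ) : iperm σ⁻¹ (iperm σ x) = x := by
  by_cases h : ∃ a, x ∈ cell n a
  · obtain ⟨a, ha⟩ := h
    rw [iperm_mem σ⁻¹ (iperm_mem_cell σ ha), iperm_mem σ ha, show σ⁻¹ (σ a) = a by simp]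
    ring
  · push Not at h
    rw [iperm_not_mem σ h, iperm_not_mem σ⁻¹ h]

theorem iperm_inv' {n : ℕ} (σ : Equiv.Perm (Fin n)) (x : ℝ) : iperm σ (iperm σ⁻¹ x) = x := by
  have := iperm_inv σ⁻¹ x
  rwa [inv_inv] at this

theorem iperm_mem_cell_iff {n : ℕ} (σ : Equiv.Perm (Fin n)) {x : ℝ} {a : Fin n} :
    iperm σ x ∈ cell n (σ a) ↔ x ∈ cell n a := by
  refine ⟨fun h => ?_, iperm_mem_cell σ⟩
  have := iperm_mem_cell σ⁻¹ h
  rwa [iperm_inv, show σ⁻¹ (σ a) = a by simp] at this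

theorem iperm_measurable {n : ℕ} (σ : Equiv.Perm (Fin n)) : Measurable (iperm σ) := by
  unfold iperm
  exact measurable_id.add (Finset.measurable_sum _ fun b _ => (cind_measurable n b).const_mul _)

theorem iperm_maps {n : ℕ} (σ : Equiv.Perm (Fin n)) {x : ℝ} (hx : x ∈ I01) :
    iperm σ x ∈ I01 := by
  by_cases h : ∃ a, x ∈ cell n a
  · obtain ⟨a, ha⟩ := h
    exact cell_subset _ (iperm_mem_cell σ ha)
  · push Not at h
    rwa [iperm_not_mem σ h]

theorem measure_split_cells (n : ℕ) (S : Set ℝ) (hS : MeasurableSet S) :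
    volume S = ∑ a : Fin n, volume (S ∩ cell n a) + volume (S \ ⋃ a : Fin n, cell n a) := by
  rw [← measure_inter_add_sdiff S (MeasurableSet.iUnion (fun a : Fin n => cell_measurable n a)),
    Set.inter_iUnion, measure_iUnion]
  · rw [tsum_fintype]
  · intro a b hab
    refine Set.disjoint_left.2 fun x hx hx' => hab (cell_unique hx.2 hx'.2)
  · intro a
    exact hS.inter (cell_measurable n a)

theorem iperm_volume {n : ℕ} (σ : Equiv.Perm (Fin n)) : MeasurePreserving (iperm σ) volume volume := by
  refine ⟨iperm_measurable σ, ?_⟩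
  ext S hS
  rw [Measure.map_apply (iperm_measurable σ) hS, measure_split_cells n S hS,
    measure_split_cells n _ (iperm_measurable σ hS)]
  congr 1
  · rw [← Equiv.sum_comp σ (fun a => volume (S ∩ cell n a))]
    refine Finset.sum_congr rfl fun a _ => ?_
    have : iperm σ ⁻¹' S ∩ cell n a =
        (fun x => x + ((((σ a : Fin n) : ℕ) : ℝ) - ((a : ℕ) : ℝ)) / n) ⁻¹' (S ∩ cell n (σ a)) := by
      ext x
      simp only [Set.mem_inter_iff, Set.mem_preimage]
      constructor
      · rintro ⟨h1, h2⟩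
        rw [← iperm_mem σ h2]
        exact ⟨h1, iperm_mem_cell σ h2⟩
      · rintro ⟨h1, h2⟩
        have h3 : x ∈ cell n a := by
          have hn := cell_npos a
          rw [mem_cell] at h2 ⊢
          rw [add_mul, div_mul_cancel₀ _ hn.ne'] at h2
          constructor <;> linarith [h2.1, h2.2]
        rw [iperm_mem σ h3]
        exact ⟨h1, h3⟩
    rw [this, measure_preimage_add_right]
  · congr 1
    ext x
    simp only [Set.mem_sdiff, Set.mem_preimage, Set.mem_iUnion, not_exists]
    constructor
    · rintro ⟨h1, h2⟩
      rw [iperm_not_mem σ h2] at h1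
      exact ⟨h1, h2⟩
    · rintro ⟨h1, h2⟩
      rw [iperm_not_mem σ h2]
      exact ⟨h1, h2⟩

theorem iperm_mp {n : ℕ} (σ : Equiv.Perm (Fin n)) :
    MeasurePreserving (iperm σ) (volume.restrict I01) (volume.restrict I01) := by
  have h := (iperm_volume σ).restrict_preimage (s := I01) measurableSet_Icc
  have e : iperm σ ⁻¹' I01 = I01 := by
    ext x
    refine ⟨fun hx => ?_, iperm_maps σ⟩
    have := iperm_maps σ⁻¹ (show iperm σ x ∈ I01 from hx)
    rwa [iperm_inv] at this
  rwa [e] at h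

def ipermMP {n : ℕ} (σ : Equiv.Perm (Fin n)) : InvMP where
  toFun := iperm σ
  invFun := iperm σ⁻¹
  maps := fun _ => iperm_maps σ
  mapsInv := fun _ => iperm_maps σ⁻¹
  measurePreserving := iperm_mp σ
  measurePreservingInv := iperm_mp σ⁻¹
  leftInv := fun x _ => iperm_inv σ x
  rightInv := fun x _ => iperm_inv' σ x

theorem twist_iperm {n : ℕ} (σ : Equiv.Perm (Fin n)) (M : Fin n → Fin n → ℝ) :
    twist (ipermMP σ) (stepK n M) = stepK n (fun a b => M (σ a) (σ b)) := by
  funext z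
  obtain ⟨x, y⟩ := z
  show stepK n M (iperm σ x, iperm σ y) = _
  by_cases h1 : ∃ a, x ∈ cell n a
  · by_cases h2 : ∃ b, y ∈ cell n b
    · obtain ⟨a, ha⟩ := h1
      obtain ⟨b, hb⟩ := h2
      rw [stepK_mem ha hb, stepK_mem (iperm_mem_cell σ ha) (iperm_mem_cell σ hb)]
    · push Not at h2
      rw [iperm_not_mem σ h2, stepK_not_mem_right h2, stepK_not_mem_right h2]
  · push Not at h1
    rw [iperm_not_mem σ h1, stepK_not_mem_left h1, stepK_not_mem_left h1]

theorem Cl_perm {n : ℕ} (σ : Equiv.Perm (Fin n)) (M : Fin n → Fin n → ℝ) :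
    Cl 0 (stepK n (fun a b => M (σ a) (σ b))) (stepK n M) := by
  refine ⟨ipermMP σ, ?_⟩
  rw [twist_iperm]
  intro S T _ _
  simp

theorem Cl_iso {n : ℕ} {G H : SimpleGraph (Fin n)} (e : G ≃g H) :
    Cl 0 (Function.uncurry (graphonOf G)) (Function.uncurry (graphonOf H)) := by
  rw [graphonOf_eq, graphonOf_eq]
  have h := Cl_perm e.toEquiv (adjR H)
  have : (fun a b => adjR H (e.toEquiv a) (e.toEquiv b)) = adjR G := by
    funext a b
    unfold adjR
    classical
    refine if_congr ?_ rfl rfl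
    exact e.map_rel_iff
  rwa [this] at h

/-! integrals of step kernels -/

theorem integral_stepK {n : ℕ} (M : Fin n → Fin n → ℝ) (S T : Set ℝ) :
    ∫ z in S ×ˢ T, stepK n M z ∂(mu.prod mu) =
      ∑ a, ∑ b, M a b * (mu.real (S ∩ cell n a) * mu.real (T ∩ cell n b)) := by
  have e : ∀ z : ℝ × ℝ, stepK n M z =
      ∑ a, ∑ b, M a b * ((cell n a ×ˢ cell n b).indicator 1 z : ℝ) := by
    intro z
    unfold stepK
    refine Finset.sum_congr rfl fun a _ => ?_
    rw [Finset.sum_mul]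
    refine Finset.sum_congr rfl fun b _ => ?_
    rw [mul_assoc]
    congr 1
    unfold cind
    by_cases h1 : z.1 ∈ cell n a <;> by_cases h2 : z.2 ∈ cell n b <;>
      simp [h1, h2, Set.indicator, Set.mem_prod]
  have hIntg : ∀ a b, Integrable (fun z : ℝ × ℝ => ((cell n a ×ˢ cell n b).indicator 1 z : ℝ))
      ((mu.prod mu).restrict (S ×ˢ T)) := fun a b =>
    (integrable_const (1 : ℝ)).indicator ((cell_measurable n a).prod (cell_measurable n b))
  simp_rw [e]
  rw [integral_finsetSum]
  · refine Finset.sum_congr rfl fun a _ => ?_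
    rw [integral_finsetSum]
    · refine Finset.sum_congr rfl fun b _ => ?_
      rw [integral_const_mul]
      congr 1
      rw [integral_indicator_one ((cell_measurable n a).prod (cell_measurable n b))]
      rw [measureReal_restrict_apply ((cell_measurable n a).prod (cell_measurable n b)),
        Set.inter_comm, Set.prod_inter_prod, measureReal_prod_prod]
    · intro b _
      exact (hIntg a b).const_mul _
  · intro a _
    exact integrable_finsetSum _ fun b _ => (hIntg a b).const_mul _


/-! ## Discrete cut norm -/

theorem frac1 {ι : Type*} [Fintype ι] (f s : ι → ℝ) (c : ℝ)
    (h : ∀ A : Finset ι, |∑ a ∈ A, f a| ≤ c) (hs : ∀ a, s a ∈ Set.Icc (0 : ℝ) 1) :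
    |∑ a, f a * s a| ≤ c := by
  classical
  rw [abs_le]
  constructor
  · have h1 := (abs_le.1 (h (Finset.univ.filter fun a => f a < 0))).1
    refine h1.trans ?_
    rw [Finset.sum_filter]
    refine Finset.sum_le_sum fun a _ => ?_
    split_ifs with h2
    · nlinarith [(hs a).2]
    · push Not at h2
      exact mul_nonneg h2 (hs a).1
  · have h1 := (abs_le.1 (h (Finset.univ.filter fun a => 0 < f a))).2
    refine le_trans ?_ h1
    rw [Finset.sum_filter]
    refine Finset.sum_le_sum fun a _ => ?_
    split_ifs with h2
    · nlinarith [(hs a).2]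
    · push Not at h2
      exact mul_nonpos_of_nonpos_of_nonneg h2 (hs a).1

def DCut {k : ℕ} (M : Fin k → Fin k → ℝ) (c : ℝ) : Prop :=
  ∀ A B : Finset (Fin k), |∑ a ∈ A, ∑ b ∈ B, M a b| ≤ c

theorem DCut.frac {k : ℕ} {M : Fin k → Fin k → ℝ} {c : ℝ} (h : DCut M c) (s t : Fin k → ℝ)
    (hs : ∀ a, s a ∈ Set.Icc (0 : ℝ) 1) (ht : ∀ a, t a ∈ Set.Icc (0 : ℝ) 1) :
    |∑ a, ∑ b, M a b * (s a * t b)| ≤ c := by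
  have h1 := frac1 (fun a => ∑ b, M a b * t b) s c (by
    intro A
    have h2 := frac1 (fun b => ∑ a ∈ A, M a b) t c (by
      intro B
      rw [Finset.sum_comm]
      exact h A B) ht
    convert h2 using 2
    rw [Finset.sum_comm]
    simp only [Finset.sum_mul]) hs
  convert h1 using 2
  refine Finset.sum_congr rfl fun a _ => ?_
  rw [Finset.sum_mul]
  exact Finset.sum_congr rfl fun b _ => by ring

theorem DCut.frac4 {k : ℕ} {M : Fin k → Fin k → ℝ} {c : ℝ} (h : DCut M c) (s t : Fin k → ℝ)
    (hs : ∀ a, |s a| ≤ 1) (ht : ∀ a, |t a| ≤ 1) :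
    |∑ a, ∑ b, M a b * (s a * t b)| ≤ 4 * c := by
  have hp : ∀ x : ℝ, |x| ≤ 1 → max x 0 ∈ Set.Icc (0 : ℝ) 1 := fun x hx =>
    ⟨le_max_right _ _, max_le (abs_le.1 hx).2 zero_le_one⟩
  have hq : ∀ x : ℝ, |x| ≤ 1 → max (-x) 0 ∈ Set.Icc (0 : ℝ) 1 := fun x hx =>
    hp (-x) (by rwa [abs_neg])
  have hx : ∀ x : ℝ, x = max x 0 - max (-x) 0 := by
    intro x
    rcases le_total x 0 with h | h
    · rw [max_eq_right h, max_eq_left (by linarith)]; ring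
    · rw [max_eq_left h, max_eq_right (by linarith)]; ring
  have h1 := h.frac _ _ (fun a => hp _ (hs a)) (fun a => hp _ (ht a))
  have h2 := h.frac _ _ (fun a => hp _ (hs a)) (fun a => hq _ (ht a))
  have h3 := h.frac _ _ (fun a => hq _ (hs a)) (fun a => hp _ (ht a))
  have h4 := h.frac _ _ (fun a => hq _ (hs a)) (fun a => hq _ (ht a))
  have e : ∑ a, ∑ b, M a b * (s a * t b) =
      (∑ a, ∑ b, M a b * (max (s a) 0 * max (t b) 0)) -
      (∑ a, ∑ b, M a b * (max (s a) 0 * max (-t b) 0)) -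
      (∑ a, ∑ b, M a b * (max (-s a) 0 * max (t b) 0)) +
      (∑ a, ∑ b, M a b * (max (-s a) 0 * max (-t b) 0)) := by
    simp only [← Finset.sum_sub_distrib, ← Finset.sum_add_distrib]
    refine Finset.sum_congr rfl fun a _ => Finset.sum_congr rfl fun b _ => ?_
    conv_lhs => rw [hx (s a), hx (t b)]
    ring
  rw [e]
  rw [abs_le] at *
  constructor <;> linarith [h1.1, h1.2, h2.1, h2.2, h3.1, h3.2, h4.1, h4.2]

theorem CutBd.of_dcut {k : ℕ} {M : Fin k → Fin k → ℝ} {ε : ℝ} (hε : 0 ≤ ε)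
    (h : DCut M (ε * k ^ 2)) : CutBd mu mu (stepK k M) ε := by
  intro S T hS hT
  rw [integral_stepK]
  rcases Nat.eq_zero_or_pos k with rfl | hk
  · simpa using hε
  have hk' : (0 : ℝ) < k := by exact_mod_cast hk
  have hb : ∀ (S : Set ℝ) (a : Fin k), k * mu.real (S ∩ cell k a) ∈ Set.Icc (0 : ℝ) 1 := by
    intro S a
    refine ⟨by positivity, ?_⟩
    have : mu.real (S ∩ cell k a) ≤ mu.real (cell k a) := measureReal_mono Set.inter_subset_right
    rw [mu_cell, le_div_iff₀ hk'] at this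
    linarith
  have h1 := h.frac _ _ (hb S) (hb T)
  have e : ∑ a, ∑ b, M a b * (k * mu.real (S ∩ cell k a) * (k * mu.real (T ∩ cell k b))) =
      (∑ a, ∑ b, M a b * (mu.real (S ∩ cell k a) * mu.real (T ∩ cell k b))) * k ^ 2 := by
    simp only [Finset.sum_mul]
    exact Finset.sum_congr rfl fun a _ => Finset.sum_congr rfl fun b _ => by ring
  rw [e, abs_mul, abs_of_pos (by positivity : (0 : ℝ) < k ^ 2)] at h1
  exact le_of_mul_le_mul_right h1 (by positivity)

/-! ## Comparison with small step functions -/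

theorem step_compare_mono {k K : ℕ} (hk : 0 < k) (hK : 0 < K) (p : Fin k → Fin K)
    (hp : Monotone p) (d : Fin K → Fin K → ℝ) (hd : ∀ i j, d i j ∈ Set.Icc (0 : ℝ) 1) {η : ℝ}
    (hη : 0 ≤ η)
    (hsz : ∀ i, |(∑ a, if p a = i then (1 : ℝ) else 0) - k / K| ≤ η * k) :
    CutBd mu mu (fun z => stepK k (fun a b => d (p a) (p b)) z - stepK K d z) (4 * K ^ 2 * η) := by
  have hk' : (0 : ℝ) < k := by exact_mod_cast hk
  have hK' : (0 : ℝ) < K := by exact_mod_cast hK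
  -- counting function
  let N : ℕ → ℝ := fun i => ∑ a, if (p a : ℕ) < i then (1 : ℝ) else 0
  have hN : ∀ i : ℕ, i ≤ K → |N i - i * (k / K)| ≤ i * (η * k) := by
    intro i
    induction i with
    | zero => intro _; simp [N]
    | succ i ih =>
      intro hi
      have h1 := ih (by omega)
      have h2 := hsz ⟨i, by omega⟩
      have e : N (i + 1) = N i + ∑ a, if p a = ⟨i, by omega⟩ then (1 : ℝ) else 0 := by
        simp only [N, ← Finset.sum_add_distrib]
        refine Finset.sum_congr rfl fun a _ => ?_
        simp only [Fin.ext_iff]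
        split_ifs <;> first | omega | norm_num
      rw [e]
      push_cast
      rw [abs_le] at *
      constructor <;> nlinarith [h1.1, h1.2, h2.1, h2.2]
  have hN' : ∀ i : ℕ, i ≤ K → |N i / k - i / K| ≤ K * η := by
    intro i hi
    have h1 := hN i hi
    have e : N i / k - i / K = (N i - i * (k / K)) / k := by field_simp
    rw [e, abs_div, abs_of_pos hk', div_le_iff₀ hk']
    have hi' : (i : ℝ) ≤ K := by exact_mod_cast hi
    have : 0 ≤ η * k := by positivity
    nlinarith
  have hNge : ∀ (a : Fin k) (i : ℕ), i ≤ (p a : ℕ) → N i ≤ (a : ℕ) := by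
    intro a i hi
    simp only [N]
    rw [← Finset.sum_filter, Finset.sum_const, nsmul_eq_mul, mul_one]
    have : (Finset.univ.filter fun b : Fin k => (p b : ℕ) < i) ⊆ Finset.Iio a := by
      intro b hb
      simp only [Finset.mem_filter, Finset.mem_univ, true_and] at hb
      rw [Finset.mem_Iio]
      by_contra hab
      push Not at hab
      have := hp hab
      have : (p a : ℕ) ≤ p b := this
      omega
    have := Finset.card_le_card this
    rw [Fin.card_Iio] at this
    exact_mod_cast this
  have hNlt : ∀ (a : Fin k) (i : ℕ), (p a : ℕ) < i → ((a : ℕ) : ℝ) + 1 ≤ N i := by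
    intro a i hi
    simp only [N]
    rw [← Finset.sum_filter, Finset.sum_const, nsmul_eq_mul, mul_one]
    have : Finset.Iic a ⊆ (Finset.univ.filter fun b : Fin k => (p b : ℕ) < i) := by
      intro b hb
      rw [Finset.mem_Iic] at hb
      simp only [Finset.mem_filter, Finset.mem_univ, true_and]
      have : (p b : ℕ) ≤ p a := hp hb
      omega
    have := Finset.card_le_card this
    rw [Fin.card_Iic] at this
    exact_mod_cast this
  -- the bad set
  let B : Set ℝ := ⋃ i : Fin K, (Set.Icc (((i : ℕ) : ℝ) / K) (((i : ℕ) : ℝ) / K + K * η) ∪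
    Set.Icc ((((i : ℕ) : ℝ) + 1) / K - K * η) ((((i : ℕ) : ℝ) + 1) / K))
  have hBm : MeasurableSet B := MeasurableSet.iUnion fun i => measurableSet_Icc.union measurableSet_Icc
  have hBmu : mu.real B ≤ 2 * K ^ 2 * η := by
    have h1 : mu B ≤ volume B := Measure.restrict_apply_le _ _
    have h2 : volume B ≤ ∑ i : Fin K, (ENNReal.ofReal (K * η) + ENNReal.ofReal (K * η)) := by
      refine (measure_iUnion_fintype_le _ _).trans (Finset.sum_le_sum fun i _ => ?_)
      refine (measure_union_le _ _).trans ?_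
      rw [Real.volume_Icc, Real.volume_Icc]
      gcongr <;> linarith
    have h3 : mu B ≤ ENNReal.ofReal (2 * K ^ 2 * η) := by
      refine (h1.trans h2).trans (le_of_eq ?_)
      rw [← ENNReal.ofReal_add (by positivity) (by positivity), Finset.sum_const, Finset.card_univ,
        Fintype.card_fin, nsmul_eq_mul, ← ENNReal.ofReal_natCast, ← ENNReal.ofReal_mul (by positivity)]
      congr 1
      ring
    exact ENNReal.toReal_le_of_le_ofReal (by positivity) h3
  have hB : ∀ (x : ℝ) (a : Fin k) (i : Fin K), x ∈ cell k a → x ∈ cell K i → x ∉ B → p a = i := by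
    intro x a i ha hi hx
    by_contra hne
    apply hx
    refine Set.mem_iUnion.2 ⟨i, ?_⟩
    rcases lt_or_gt_of_ne hne with h | h
    · left
      have h1 := hNlt a i h
      have h2 := (abs_le.1 (hN' i i.2.le)).2
      refine ⟨hi.1.le, ?_⟩
      have h3 : (((a : ℕ) : ℝ) + 1) / k ≤ N i / k := by gcongr
      linarith [ha.2]
    · right
      have h1 := hNge a (i + 1) h
      have h2 := (abs_le.1 (hN' (i + 1) (by omega))).1
      refine ⟨?_, hi.2⟩
      have h3 : N (i + 1) / k ≤ ((a : ℕ) : ℝ) / k := by gcongr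
      push_cast at h2
      linarith [ha.1]
  have hU : PKer (stepK k (fun a b => d (p a) (p b))) := stepK_pker fun a b => hd _ _
  have hV : PKer (stepK K d) := stepK_pker hd
  have hD := hU.sub hV
  refine CutBd.of_l1 hD ?_
  have hIntg1 : Integrable (fun z : ℝ × ℝ => B.indicator (1 : ℝ → ℝ) z.1) (mu.prod mu) :=
    ((integrable_const (1 : ℝ)).indicator hBm).comp_fst mu
  have hIntg2 : Integrable (fun z : ℝ × ℝ => B.indicator (1 : ℝ → ℝ) z.2) (mu.prod mu) :=
    ((integrable_const (1 : ℝ)).indicator hBm).comp_snd mu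
  have hle : ∫ z, |stepK k (fun a b => d (p a) (p b)) z - stepK K d z| ∂(mu.prod mu) ≤
      ∫ z, (B.indicator (1 : ℝ → ℝ) z.1 + B.indicator (1 : ℝ → ℝ) z.2) ∂(mu.prod mu) := by
    refine integral_mono_ae (hD.integrable _).abs (hIntg1.add hIntg2) ?_
    have h0 : ∀ᵐ z ∂(mu.prod mu), z.1 ≠ 0 ∧ z.2 ≠ 0 := by
      have hne : ∀ᵐ x ∂mu, x ≠ 0 := by
        have : ∀ᵐ x : ℝ, x ≠ 0 := by simp [ae_iff]
        exact ae_restrict_of_ae this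
      have h1 := (Measure.quasiMeasurePreserving_fst (μ := mu) (ν := mu)).ae hne
      have h2 := (Measure.quasiMeasurePreserving_snd (μ := mu) (ν := mu)).ae hne
      filter_upwards [h1, h2] with z a b
      exact ⟨a, b⟩
    filter_upwards [h0, ae_mem_I01_prod] with z hz0 hz
    obtain ⟨x, y⟩ := z
    obtain ⟨⟨hx0, hx1⟩, ⟨hy0, hy1⟩⟩ := hz
    have hx0' : 0 < x := lt_of_le_of_ne hx0 (Ne.symm hz0.1)
    have hy0' : 0 < y := lt_of_le_of_ne hy0 (Ne.symm hz0.2)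
    have hb := hD.2 (x, y)
    by_cases hxB : x ∈ B
    · have : (0 : ℝ) ≤ B.indicator (1 : ℝ → ℝ) y := Set.indicator_nonneg (by simp) _
      simp only [Set.indicator_of_mem hxB, Pi.one_apply]
      linarith
    by_cases hyB : y ∈ B
    · have : (0 : ℝ) ≤ B.indicator (1 : ℝ → ℝ) x := Set.indicator_nonneg (by simp) _
      simp only [Set.indicator_of_mem hyB, Pi.one_apply]
      linarith
    obtain ⟨a, ha⟩ := exists_cell hk hx0' hx1
    obtain ⟨b, hb'⟩ := exists_cell hk hy0' hy1
    obtain ⟨i, hi⟩ := exists_cell hK hx0' hx1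
    obtain ⟨j, hj⟩ := exists_cell hK hy0' hy1
    rw [stepK_mem ha hb', stepK_mem hi hj, hB x a i ha hi hxB, hB y b j hb' hj hyB]
    simp [hxB, hyB]
  refine hle.trans ?_
  rw [integral_add hIntg1 hIntg2]
  have e1 : ∫ z, B.indicator (1 : ℝ → ℝ) z.1 ∂(mu.prod mu) = mu.real B := by
    rw [integral_fun_fst (fun x => B.indicator (1 : ℝ → ℝ) x), integral_indicator_one hBm]
    simp
  have e2 : ∫ z, B.indicator (1 : ℝ → ℝ) z.2 ∂(mu.prod mu) = mu.real B := by
    rw [integral_fun_snd (fun x => B.indicator (1 : ℝ → ℝ) x), integral_indicator_one hBm]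
    simp
  rw [e1, e2]
  linarith

theorem close_to_step {k K : ℕ} (hk : 0 < k) (hK : 0 < K) {M : Fin k → Fin k → ℝ}
    (hM : ∀ a b, M a b ∈ Set.Icc (0 : ℝ) 1) (p : Fin k → Fin K)
    (d : Fin K → Fin K → ℝ) (hd : ∀ i j, d i j ∈ Set.Icc (0 : ℝ) 1) {ε η : ℝ}
    (hε : 0 ≤ ε) (hη : 0 ≤ η)
    (hcut : DCut (fun a b => M a b - d (p a) (p b)) (ε * k ^ 2))
    (hsz : ∀ i, |(∑ a, if p a = i then (1 : ℝ) else 0) - k / K| ≤ η * k) :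
    Cl (ε + 4 * K ^ 2 * η) (stepK k M) (stepK K d) := by
  have hP : ∀ q : Fin k → Fin K, PKer (stepK k (fun a b => d (q a) (q b))) := fun q =>
    stepK_pker fun a b => hd _ _
  have h1 : Cl ε (stepK k M) (stepK k (fun a b => d (p a) (p b))) := by
    refine ⟨InvMP.id, ?_⟩
    have := CutBd.of_dcut hε hcut
    simp only [twist_id, stepK_sub]
    exact this
  let σ := Tuple.sort p
  have h2 : Cl 0 (stepK k (fun a b => d (p (σ a)) (p (σ b)))) (stepK k (fun a b => d (p a) (p b))) :=
    Cl_perm σ (fun a b => d (p a) (p b))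
  have h3 : Cl (4 * K ^ 2 * η) (stepK k (fun a b => d (p (σ a)) (p (σ b)))) (stepK K d) := by
    refine ⟨InvMP.id, ?_⟩
    simp only [twist_id]
    refine step_compare_mono hk hK (fun a => p (σ a)) (Tuple.monotone_sort p) d hd hη ?_
    intro i
    rw [Equiv.sum_comp σ (fun a => if p a = i then (1 : ℝ) else 0)]
    exact hsz i
  have h4 := Cl.trans (stepK_pker hM) (hP p) (hP _) h1 (Cl.symm (hP _) (hP p) h2)
  have h5 := Cl.trans (stepK_pker hM) (hP _) (stepK_pker hd) h4 h3
  rwa [add_zero] at h5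


/-! ## Weak regularity -/

theorem sum_adjR {n : ℕ} (G : SimpleGraph (Fin n)) [DecidableRel G.Adj] (A B : Finset (Fin n)) :
    ∑ a ∈ A, ∑ b ∈ B, adjR G a b = (G.edgeDensity A B : ℝ) * (A.card * B.card) := by
  have h1 : ∑ a ∈ A, ∑ b ∈ B, adjR G a b = ((G.interedges A B).card : ℝ) := by
    rw [SimpleGraph.interedges_def, Finset.card_filter, Finset.sum_product]
    push_cast
    refine Finset.sum_congr rfl fun a _ => Finset.sum_congr rfl fun b _ => ?_
    unfold adjR
    split_ifs <;> simp
  rw [h1]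
  rcases A.eq_empty_or_nonempty with rfl | hA
  · simp [SimpleGraph.interedges_def]
  rcases B.eq_empty_or_nonempty with rfl | hB
  · simp [SimpleGraph.interedges_def]
  have hA' : (A.card : ℝ) ≠ 0 := by exact_mod_cast hA.card_pos.ne'
  have hB' : (B.card : ℝ) ≠ 0 := by exact_mod_cast hB.card_pos.ne'
  rw [SimpleGraph.edgeDensity_def]
  push_cast
  field_simp

theorem edgeDensity_mem {n : ℕ} (G : SimpleGraph (Fin n)) [DecidableRel G.Adj]
    (A B : Finset (Fin n)) : (G.edgeDensity A B : ℝ) ∈ Set.Icc (0 : ℝ) 1 := by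
  constructor
  · exact_mod_cast G.edgeDensity_nonneg A B
  · exact_mod_cast G.edgeDensity_le_one A B

theorem pair_trivial {n : ℕ} (G : SimpleGraph (Fin n)) {s t A B : Finset (Fin n)}
    (hA : A ⊆ s) (hB : B ⊆ t) {d : ℝ} (hd : d ∈ Set.Icc (0 : ℝ) 1) :
    |∑ a ∈ A, ∑ b ∈ B, (adjR G a b - d)| ≤ s.card * t.card := by
  have h1 : |∑ a ∈ A, ∑ b ∈ B, (adjR G a b - d)| ≤ ∑ a ∈ A, ∑ b ∈ B, (1 : ℝ) := by
    refine (Finset.abs_sum_le_sum_abs _ _).trans (Finset.sum_le_sum fun a _ => ?_)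
    refine (Finset.abs_sum_le_sum_abs _ _).trans (Finset.sum_le_sum fun b _ => ?_)
    have := adjR_mem G a b
    rw [abs_le]
    constructor <;> linarith [this.1, this.2, hd.1, hd.2]
  refine h1.trans ?_
  simp only [Finset.sum_const, nsmul_eq_mul, mul_one]
  have h2 : (A.card : ℝ) ≤ s.card := by exact_mod_cast Finset.card_le_card hA
  have h3 : (B.card : ℝ) ≤ t.card := by exact_mod_cast Finset.card_le_card hB
  gcongr

theorem pair_trivial_sharp {n : ℕ} (G : SimpleGraph (Fin n)) (A B : Finset (Fin n))
    {d : ℝ} (hd : d ∈ Set.Icc (0 : ℝ) 1) :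
    |∑ a ∈ A, ∑ b ∈ B, (adjR G a b - d)| ≤ A.card * B.card :=
  pair_trivial G subset_rfl subset_rfl hd

theorem pair_uniform {n : ℕ} (G : SimpleGraph (Fin n)) [DecidableRel G.Adj]
    {s t A B : Finset (Fin n)} {ε : ℝ} (hε : 0 < ε) (hu : G.IsUniform ε s t)
    (hA : A ⊆ s) (hB : B ⊆ t) :
    |∑ a ∈ A, ∑ b ∈ B, (adjR G a b - (G.edgeDensity s t : ℝ))| ≤ ε * (s.card * t.card) := by
  have h2 : (A.card : ℝ) ≤ s.card := by exact_mod_cast Finset.card_le_card hA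
  have h3 : (B.card : ℝ) ≤ t.card := by exact_mod_cast Finset.card_le_card hB
  have hA0 : (0 : ℝ) ≤ A.card := Nat.cast_nonneg _
  have hB0 : (0 : ℝ) ≤ B.card := Nat.cast_nonneg _
  by_cases h : (s.card : ℝ) * ε ≤ A.card ∧ (t.card : ℝ) * ε ≤ B.card
  · have h1 := hu hA hB h.1 h.2
    have e : ∑ a ∈ A, ∑ b ∈ B, (adjR G a b - (G.edgeDensity s t : ℝ)) =
        ((G.edgeDensity A B : ℝ) - (G.edgeDensity s t : ℝ)) * (A.card * B.card) := by
      simp only [Finset.sum_sub_distrib]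
      rw [sum_adjR]
      simp only [Finset.sum_const, nsmul_eq_mul]
      ring
    rw [e, abs_mul, abs_of_nonneg (by positivity : (0 : ℝ) ≤ A.card * B.card)]
    gcongr
  · refine (pair_trivial_sharp G A B (edgeDensity_mem G s t)).trans ?_
    rw [not_and_or] at h
    push Not at h
    rcases h with h | h
    · calc (A.card : ℝ) * B.card ≤ (s.card * ε) * t.card := by gcongr
        _ = _ := by ring
    · calc (A.card : ℝ) * B.card ≤ s.card * (t.card * ε) := by gcongr
        _ = _ := by ring

theorem sum_fiber2 {n K : ℕ} (p : Fin n → Fin K) (f : Fin n → Fin n → ℝ) (A B : Finset (Fin n)) :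
    ∑ a ∈ A, ∑ b ∈ B, f a b = ∑ i, ∑ j, ∑ a ∈ A.filter (fun a => p a = i),
      ∑ b ∈ B.filter (fun b => p b = j), f a b := by
  rw [← Finset.sum_fiberwise A p (fun a => ∑ b ∈ B, f a b)]
  refine Finset.sum_congr rfl fun i _ => ?_
  conv_rhs => rw [Finset.sum_comm]
  refine Finset.sum_congr rfl fun a _ => ?_
  exact (Finset.sum_fiberwise B p (fun b => f a b)).symm

theorem weak_reg (ε : ℝ) (hε : 0 < ε) : ∃ K0 q N : ℕ, 0 < q ∧ 0 < N ∧
    ∀ n, N ≤ n → ∀ G : SimpleGraph (Fin n), ∃ K, 0 < K ∧ K ≤ K0 ∧ ∃ (p : Fin n → Fin K)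
      (d : Fin K → Fin K → Fin (q + 1)),
      DCut (fun a b => adjR G a b - ((d (p a) (p b) : ℕ) : ℝ) / q) (ε * n ^ 2) ∧
      ∀ i, |(∑ a, if p a = i then (1 : ℝ) else 0) - n / K| ≤ 1 := by
  classical
  obtain ⟨q, hq⟩ := exists_nat_gt (20 / ε)
  have hqpos : (0 : ℝ) < q := lt_trans (by positivity) hq
  have hq0 : 0 < q := by exact_mod_cast hqpos
  have hqi : 1 / (q : ℝ) ≤ ε / 20 := by
    rw [div_le_iff₀ hqpos]
    rw [div_lt_iff₀ hε] at hq
    linarith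
  set ε' := ε / 20 with hε'
  have hε'0 : 0 < ε' := by positivity
  refine ⟨SzemerediRegularity.bound ε' q, q, max q (SzemerediRegularity.bound ε' q), hq0,
    lt_of_lt_of_le hq0 (le_max_left _ _), ?_⟩
  intro n hn G
  have hn1 : q ≤ Fintype.card (Fin n) := by rw [Fintype.card_fin]; exact (le_max_left _ _).trans hn
  have hn2 : SzemerediRegularity.bound ε' q ≤ n := (le_max_right _ _).trans hn
  obtain ⟨P, heq, hl, hb, hunif⟩ := szemeredi_regularity G hε'0 hn1
  set K := P.parts.card with hK
  have hKpos : 0 < K := lt_of_lt_of_le hq0 hl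
  have hKn : K ≤ n := hb.trans hn2
  have hnpos : 0 < n := lt_of_lt_of_le hKpos hKn
  have hK' : (0 : ℝ) < K := by exact_mod_cast hKpos
  have hKn' : (K : ℝ) ≤ n := by exact_mod_cast hKn
  let e : P.parts ≃ Fin K := P.parts.equivFin
  let V : Fin K → Finset (Fin n) := fun i => (e.symm i).1
  have hV : ∀ i, V i ∈ P.parts := fun i => (e.symm i).2
  let p : Fin n → Fin K := fun a => e ⟨P.part a, P.part_mem.2 (Finset.mem_univ a)⟩
  have hp : ∀ a i, p a = i ↔ a ∈ V i := by
    intro a i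
    rw [← P.part_eq_iff_mem (hV i)]
    simp only [p, V]
    rw [← Equiv.eq_symm_apply, Subtype.ext_iff]
  have hfil : ∀ i, Finset.univ.filter (fun a => p a = i) = V i := by
    intro i
    ext a
    simp [hp]
  have hcount : ∀ i, (∑ a, if p a = i then (1 : ℝ) else 0) = (V i).card := by
    intro i
    rw [← Finset.sum_filter, hfil, Finset.sum_const, nsmul_eq_mul, mul_one]
  have hsz : ∀ i, |((V i).card : ℝ) - n / K| ≤ 1 := by
    intro i
    have h1 := heq.average_le_card_part (hV i)
    have h2 := heq.card_part_le_average_add_one (hV i)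
    rw [Finset.card_univ, Fintype.card_fin] at h1 h2
    have h3 : ((n / K : ℕ) : ℝ) ≤ n / K := Nat.cast_div_le
    have h4 : (n : ℝ) / K < (n / K : ℕ) + 1 := by
      rw [div_lt_iff₀ hK']
      have := Nat.lt_div_mul_add (a := n) hKpos
      have h5 : (n : ℝ) < (n / K : ℕ) * K + K := by exact_mod_cast this
      linarith
    have h1' : ((n / K : ℕ) : ℝ) ≤ (V i).card := by exact_mod_cast h1
    have h2' : ((V i).card : ℝ) ≤ (n / K : ℕ) + 1 := by exact_mod_cast h2
    rw [abs_le]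
    constructor <;> linarith
  have hVle : ∀ i, ((V i).card : ℝ) ≤ 2 * n / K := by
    intro i
    have h1 := (abs_le.1 (hsz i)).2
    have h2 : (1 : ℝ) ≤ n / K := by rw [le_div_iff₀ hK']; linarith
    have : 2 * (n : ℝ) / K = n / K + n / K := by ring
    linarith
  have hsumV : ∑ i, ((V i).card : ℝ) = n := by
    simp_rw [← hcount]
    rw [Finset.sum_comm]
    simp
  have hsumP : ∀ f : Finset (Fin n) → ℝ, ∑ i, f (V i) = ∑ u ∈ P.parts, f u := by
    intro f
    rw [Equiv.sum_comp e.symm (fun u : P.parts => f u.1), Finset.sum_coe_sort P.parts f]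
  -- quantized densities
  let D : Fin K → Fin K → ℝ := fun i j => (G.edgeDensity (V i) (V j) : ℝ)
  have hD : ∀ i j, D i j ∈ Set.Icc (0 : ℝ) 1 := fun i j => edgeDensity_mem G _ _
  let d : Fin K → Fin K → Fin (q + 1) := fun i j => ⟨⌊D i j * q⌋₊, by
    have : D i j * q ≤ q := by nlinarith [(hD i j).2]
    have := Nat.floor_le_of_le this
    omega⟩
  have hd : ∀ i j, |D i j - ((d i j : ℕ) : ℝ) / q| ≤ ε' := by
    intro i j
    have h0 : 0 ≤ D i j * q := mul_nonneg (hD i j).1 hqpos.le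
    have h1 := Nat.floor_le h0
    have h2 := Nat.lt_floor_add_one (D i j * q)
    have e1 : D i j - ((d i j : ℕ) : ℝ) / q = (D i j * q - (⌊D i j * q⌋₊ : ℝ)) * (1 / q) := by
      simp only [d]
      field_simp
    rw [e1, abs_of_nonneg (mul_nonneg (by linarith) (by positivity))]
    have : (D i j * q - (⌊D i j * q⌋₊ : ℝ)) * (1 / q) ≤ 1 * (1 / q) := by
      gcongr
      linarith
    linarith
  refine ⟨K, hKpos, hb, p, d, ?_, fun i => by rw [hcount]; exact hsz i⟩
  intro A B
  rw [sum_fiber2 p]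
  let w : Fin K → Fin K → ℝ := fun i j => (V i).card * (V j).card
  have hw0 : ∀ i j, 0 ≤ w i j := fun i j => by positivity
  have hpair : ∀ i j, |∑ a ∈ A.filter (fun a => p a = i), ∑ b ∈ B.filter (fun b => p b = j),
      (adjR G a b - ((d (p a) (p b) : ℕ) : ℝ) / q)| ≤
      2 * ε' * w i j + (if i = j then w i j else 0) +
        (if (V i, V j) ∈ P.nonUniforms G ε' then w i j else 0) := by
    intro i j
    set A' := A.filter (fun a => p a = i) with hA'
    set B' := B.filter (fun b => p b = j) with hB'
    have hAs : A' ⊆ V i := fun a ha => (hp a i).1 (Finset.mem_filter.1 ha).2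
    have hBs : B' ⊆ V j := fun a ha => (hp a j).1 (Finset.mem_filter.1 ha).2
    have hAc : (A'.card : ℝ) ≤ (V i).card := by exact_mod_cast Finset.card_le_card hAs
    have hBc : (B'.card : ℝ) ≤ (V j).card := by exact_mod_cast Finset.card_le_card hBs
    have e1 : ∑ a ∈ A', ∑ b ∈ B', (adjR G a b - ((d (p a) (p b) : ℕ) : ℝ) / q) =
        ∑ a ∈ A', ∑ b ∈ B', (adjR G a b - D i j) +
          (D i j - ((d i j : ℕ) : ℝ) / q) * (A'.card * B'.card) := by
      have : ∑ a ∈ A', ∑ b ∈ B', (D i j - ((d i j : ℕ) : ℝ) / q) =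
          (D i j - ((d i j : ℕ) : ℝ) / q) * (A'.card * B'.card) := by
        simp only [Finset.sum_const, nsmul_eq_mul]
        ring
      rw [← this, ← Finset.sum_add_distrib]
      refine Finset.sum_congr rfl fun a ha => ?_
      rw [← Finset.sum_add_distrib]
      refine Finset.sum_congr rfl fun b hb => ?_
      rw [(Finset.mem_filter.1 ha).2, (Finset.mem_filter.1 hb).2]
      ring
    have h2 : |(D i j - ((d i j : ℕ) : ℝ) / q) * (A'.card * B'.card)| ≤ ε' * w i j := by
      rw [abs_mul, abs_of_nonneg (by positivity : (0 : ℝ) ≤ A'.card * B'.card)]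
      have := hd i j
      simp only [w]
      gcongr
    have h3 : |∑ a ∈ A', ∑ b ∈ B', (adjR G a b - D i j)| ≤ ε' * w i j +
        (if i = j then w i j else 0) +
        (if (V i, V j) ∈ P.nonUniforms G ε' then w i j else 0) := by
      by_cases hij : i = j
      · rw [if_pos hij]
        have h4 := pair_trivial G hAs hBs (hD i j)
        have h5 : (0 : ℝ) ≤ (if (V i, V j) ∈ P.nonUniforms G ε' then w i j else 0) := by
          split_ifs
          · exact hw0 i j
          · exact le_rfl
        have h6 : 0 ≤ ε' * w i j := mul_nonneg hε'0.le (hw0 i j)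
        have h7 : w i j = (V i).card * (V j).card := rfl
        linarith
      · rw [if_neg hij]
        by_cases hnu : (V i, V j) ∈ P.nonUniforms G ε'
        · rw [if_pos hnu]
          have h4 := pair_trivial G hAs hBs (hD i j)
          have h6 : 0 ≤ ε' * w i j := mul_nonneg hε'0.le (hw0 i j)
          have h7 : w i j = (V i).card * (V j).card := rfl
          linarith
        · rw [if_neg hnu]
          have hu : G.IsUniform ε' (V i) (V j) := by
            by_contra hcon
            apply hnu
            rw [Finpartition.mk_mem_nonUniforms]
            refine ⟨hV i, hV j, ?_, hcon⟩
            intro heq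
            apply hij
            have : e.symm i = e.symm j := Subtype.ext heq
            exact e.symm.injective this
          have h4 := pair_uniform G hε'0 hu hAs hBs
          have h7 : w i j = (V i).card * (V j).card := rfl
          rw [h7]
          simp only [D]
          linarith
    rw [e1]
    refine (abs_add_le _ _).trans ?_
    linarith
  have h1 : |∑ i, ∑ j, ∑ a ∈ A.filter (fun a => p a = i), ∑ b ∈ B.filter (fun b => p b = j),
      (adjR G a b - ((d (p a) (p b) : ℕ) : ℝ) / q)| ≤ ∑ i, ∑ j, (2 * ε' * w i j +
        (if i = j then w i j else 0) +
        (if (V i, V j) ∈ P.nonUniforms G ε' then w i j else 0)) := by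
    refine (Finset.abs_sum_le_sum_abs _ _).trans (Finset.sum_le_sum fun i _ => ?_)
    exact (Finset.abs_sum_le_sum_abs _ _).trans (Finset.sum_le_sum fun j _ => hpair i j)
  refine h1.trans ?_
  simp only [Finset.sum_add_distrib]
  have s1 : ∑ i, ∑ j, 2 * ε' * w i j = 2 * ε' * n ^ 2 := by
    have : ∑ i, ∑ j, w i j = n ^ 2 := by
      simp only [w]
      rw [← Finset.sum_mul_sum, hsumV]
      ring
    simp only [← Finset.mul_sum]
    rw [this]
  have s2 : ∑ i, ∑ j, (if i = j then w i j else 0) ≤ 2 * ε' * n ^ 2 := by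
    simp only [Finset.sum_ite_eq, Finset.mem_univ, if_true]
    calc ∑ i, w i i ≤ ∑ i, (2 * n / K) * ((V i).card : ℝ) := by
          refine Finset.sum_le_sum fun i _ => ?_
          simp only [w]
          gcongr
          exact hVle i
      _ = 2 * n ^ 2 * (1 / K) := by rw [← Finset.mul_sum, hsumV]; ring
      _ ≤ 2 * n ^ 2 * ε' := by
          have h5 : (q : ℝ) ≤ K := by exact_mod_cast hl
          have : 1 / (K : ℝ) ≤ 1 / q := one_div_le_one_div_of_le hqpos h5
          gcongr
          linarith
      _ = _ := by ring
  have s3 : ∑ i, ∑ j, (if (V i, V j) ∈ P.nonUniforms G ε' then w i j else 0) ≤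
      4 * ε' * n ^ 2 := by
    have hA : (Finset.univ : Finset (Fin n)).Nonempty := ⟨⟨0, hnpos⟩, Finset.mem_univ _⟩
    have h5 := heq.sum_nonUniforms_lt' hA hε'0 hunif
    rw [Finset.card_univ, Fintype.card_fin] at h5
    have e2 : ∑ i, ∑ j, (if (V i, V j) ∈ P.nonUniforms G ε' then w i j else 0) =
        ∑ x ∈ P.nonUniforms G ε', ((x.1.card : ℝ) * x.2.card) := by
      rw [hsumP (fun u => ∑ j, (if (u, V j) ∈ P.nonUniforms G ε' then
        ((u.card : ℝ) * (V j).card) else 0))]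
      have : ∀ u, ∑ j, (if (u, V j) ∈ P.nonUniforms G ε' then
        ((u.card : ℝ) * (V j).card) else 0) = ∑ v ∈ P.parts, (if (u, v) ∈ P.nonUniforms G ε' then
        ((u.card : ℝ) * v.card) else 0) := fun u => hsumP (fun v =>
          (if (u, v) ∈ P.nonUniforms G ε' then ((u.card : ℝ) * v.card) else 0))
      simp only [this]
      rw [← Finset.sum_product' P.parts P.parts (fun u v =>
        (if (u, v) ∈ P.nonUniforms G ε' then ((u.card : ℝ) * v.card) else 0)), ← Finset.sum_filter]
      refine Finset.sum_congr ?_ fun _ _ => rfl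
      ext ⟨u, v⟩
      simp only [Finset.mem_filter, Finset.mem_product, Finpartition.mk_mem_nonUniforms]
      tauto
    rw [e2]
    refine h5.le.trans ?_
    have : ((n : ℝ) + K) ^ 2 ≤ (2 * n) ^ 2 := by
      gcongr
      linarith
    nlinarith
  have : 0 ≤ ε' * (n : ℝ) ^ 2 := by positivity
  have : ε = 20 * ε' := by rw [hε']; ring
  rw [s1, this]
  nlinarith


/-! ## Averaging over permutations -/

theorem grp_avg {Γ α : Type*} [Group Γ] [Fintype Γ] (X : Finset α) (act : Γ → α → α)
    (hone : ∀ x, act 1 x = x) (hmul : ∀ g h x, act (g * h) x = act g (act h x))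
    (hinv : ∀ g, ∀ x ∈ X, act g x ∈ X) (htr : ∀ x ∈ X, ∀ y ∈ X, ∃ g, act g x = y)
    (h : α → ℝ) {x0 : α} (hx0 : x0 ∈ X) :
    (X.card : ℝ) * ∑ g, h (act g x0) = Fintype.card Γ * ∑ x ∈ X, h x := by
  have h1 : ∀ x ∈ X, ∑ g, h (act g x) = ∑ g, h (act g x0) := by
    intro x hx
    obtain ⟨t, rfl⟩ := htr x0 hx0 x hx
    simp only [← hmul]
    exact Equiv.sum_comp (Equiv.mulRight t) (fun g => h (act g x0))
  have h2 : ∀ g, ∑ x ∈ X, h (act g x) = ∑ x ∈ X, h x := by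
    intro g
    refine Finset.sum_bij' (fun x _ => act g x) (fun x _ => act g⁻¹ x) (fun x hx => hinv g x hx)
      (fun x hx => hinv g⁻¹ x hx) ?_ ?_ ?_
    · intro x _
      rw [← hmul, inv_mul_cancel, hone]
    · intro x _
      rw [← hmul, mul_inv_cancel, hone]
    · intro x _
      rfl
  calc (X.card : ℝ) * ∑ g, h (act g x0) = ∑ x ∈ X, ∑ g, h (act g x) := by
        rw [Finset.sum_congr rfl h1, Finset.sum_const, nsmul_eq_mul]
    _ = ∑ g, ∑ x ∈ X, h (act g x) := Finset.sum_comm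
    _ = _ := by
        simp only [h2]
        rw [Finset.sum_const, nsmul_eq_mul, Finset.card_univ]

theorem perm_extend_finset {n : ℕ} (S T : Finset (Fin n)) (h : S.card = T.card) :
    ∃ σ : Equiv.Perm (Fin n), S.map σ.toEmbedding = T := by
  classical
  let e : {x // x ∈ S} ≃ {x // x ∈ T} := Finset.equivOfCardEq h
  refine ⟨e.extendSubtype, ?_⟩
  apply Finset.eq_of_subset_of_card_le
  · intro y hy
    rw [Finset.mem_map] at hy
    obtain ⟨x, hx, rfl⟩ := hy
    exact e.extendSubtype_mem x hx
  · rw [Finset.card_map, h]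

theorem perm_extend_fun {n r : ℕ} (u v : Fin r → Fin n) (hu : Function.Injective u)
    (hv : Function.Injective v) : ∃ σ : Equiv.Perm (Fin n), (fun i => σ (u i)) = v := by
  classical
  let e : {x // x ∈ Set.range u} ≃ {x // x ∈ Set.range v} :=
    (Equiv.ofInjective u hu).symm.trans (Equiv.ofInjective v hv)
  refine ⟨e.extendSubtype, ?_⟩
  funext i
  rw [e.extendSubtype_apply_of_mem (u i) ⟨i, rfl⟩]
  have : (⟨u i, ⟨i, rfl⟩⟩ : {x // x ∈ Set.range u}) = Equiv.ofInjective u hu i := rfl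
  simp only [e, Equiv.trans_apply]
  rw [this, Equiv.symm_apply_apply]
  rfl

theorem avg_subsets {n k : ℕ} (h : Finset (Fin n) → ℝ) {S0 : Finset (Fin n)} (hS0 : S0.card = k) :
    (n.choose k : ℝ) * ∑ σ : Equiv.Perm (Fin n), h (S0.map σ.toEmbedding) =
      n.factorial * ∑ S ∈ Finset.powersetCard k (Finset.univ : Finset (Fin n)), h S := by
  have := grp_avg (Γ := Equiv.Perm (Fin n)) (Finset.powersetCard k (Finset.univ : Finset (Fin n)))
    (fun σ S => S.map σ.toEmbedding)
    (by intro S; exact Finset.map_refl)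
    (by
      intro g h S
      rw [Finset.map_map]
      rfl)
    (by
      intro g S hS
      rw [Finset.mem_powersetCard] at hS ⊢
      rw [Finset.card_map]
      exact ⟨Finset.subset_univ _, hS.2⟩)
    (by
      intro S hS T hT
      rw [Finset.mem_powersetCard] at hS hT
      exact perm_extend_finset S T (hS.2.trans hT.2.symm)) h (x0 := S0)
    (by rw [Finset.mem_powersetCard]; exact ⟨Finset.subset_univ _, hS0⟩)
  rw [Finset.card_powersetCard, Finset.card_univ, Fintype.card_fin, Fintype.card_perm,
    Fintype.card_fin] at this
  exact this

open Classical in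
def injs (r n : ℕ) : Finset (Fin r → Fin n) := Finset.univ.filter Function.Injective

theorem mem_injs {r n : ℕ} {u : Fin r → Fin n} : u ∈ injs r n ↔ Function.Injective u := by
  simp [injs]

theorem card_injs (r n : ℕ) : (injs r n).card = n.descFactorial r := by
  classical
  have h1 := Fintype.card_embedding_eq (α := Fin r) (β := Fin n)
  rw [Fintype.card_fin, Fintype.card_fin] at h1
  rw [← h1, ← Fintype.card_congr (Equiv.subtypeInjectiveEquivEmbedding (Fin r) (Fin n)),
    Fintype.card_subtype]
  rfl

theorem avg_injs {n r : ℕ} (h : (Fin r → Fin n) → ℝ) {u0 : Fin r → Fin n}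
    (hu0 : Function.Injective u0) :
    ((injs r n).card : ℝ) * ∑ σ : Equiv.Perm (Fin n), h (fun i => σ (u0 i)) =
      n.factorial * ∑ u ∈ injs r n, h u := by
  have := grp_avg (Γ := Equiv.Perm (Fin n)) (injs r n)
    (fun σ u => fun i => σ (u i))
    (by intro u; rfl)
    (by intro g h u; rfl)
    (by
      intro g u hu
      rw [mem_injs] at hu ⊢
      exact g.injective.comp hu)
    (by
      intro u hu v hv
      rw [mem_injs] at hu hv
      exact perm_extend_fun u v hu hv) h (x0 := u0)
    (mem_injs.2 hu0)
  rwa [Fintype.card_perm, Fintype.card_fin] at this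

theorem descFactorial_lower (n r : ℕ) :
    (n : ℝ) ^ r * (n - r ^ 2) ≤ n * n.descFactorial r := by
  induction r with
  | zero => simp
  | succ r ih =>
    rw [Nat.descFactorial_succ]
    rcases le_or_gt r n with h | h
    · push_cast [Nat.cast_sub h]
      have h1 : (0 : ℝ) ≤ n - r := by
        have : (r : ℝ) ≤ n := by exact_mod_cast h
        linarith
      have h2 := mul_le_mul_of_nonneg_left ih h1
      have h3 : (n : ℝ) ^ (r + 1) * (n - (r + 1) ^ 2) ≤ (n - r) * ((n : ℝ) ^ r * (n - r ^ 2)) := by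
        have h4 : (0 : ℝ) ≤ (n : ℝ) ^ r := by positivity
        have h5 : (n - r) * ((n : ℝ) ^ r * (n - r ^ 2)) - (n : ℝ) ^ (r + 1) * (n - (r + 1) ^ 2) =
            (n : ℝ) ^ r * (n * (r + 1) + r ^ 3) := by ring
        have : 0 ≤ (n : ℝ) ^ r * (n * (r + 1) + r ^ 3) := by positivity
        linarith
      linarith
    · have h1 : (n : ℝ) - ((r + 1 : ℕ) : ℝ) ^ 2 ≤ 0 := by
        have : (n : ℝ) < r := by exact_mod_cast h
        push_cast
        nlinarith
      have h2 : (0 : ℝ) ≤ (n : ℝ) ^ (r + 1) := by positivity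
      have h3 : (n : ℝ) ^ (r + 1) * (n - ((r + 1 : ℕ) : ℝ) ^ 2) ≤ 0 :=
        mul_nonpos_of_nonneg_of_nonpos h2 h1
      refine h3.trans (by positivity)

theorem noninj_le (n r : ℕ) :
    (n : ℝ) * ((n : ℝ) ^ r - (injs r n).card) ≤ r ^ 2 * (n : ℝ) ^ r := by
  have := descFactorial_lower n r
  rw [card_injs]
  nlinarith

theorem sum_split_injs {n r : ℕ} (h : (Fin r → Fin n) → ℝ) (hb : ∀ u, |h u| ≤ 1) :
    |∑ u, h u - ∑ u ∈ injs r n, h u| ≤ (n : ℝ) ^ r - (injs r n).card := by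
  classical
  have h1 : ∑ u, h u - ∑ u ∈ injs r n, h u = ∑ u ∈ (injs r n)ᶜ, h u := by
    rw [← Finset.sum_add_sum_compl (injs r n) h]
    ring
  rw [h1]
  refine (Finset.abs_sum_le_sum_abs _ _).trans ?_
  refine (Finset.sum_le_sum fun u _ => hb u).trans ?_
  rw [Finset.sum_const, nsmul_eq_mul, mul_one]
  have h2 := Finset.card_compl_add_card (injs r n)
  rw [Fintype.card_fun, Fintype.card_fin, Fintype.card_fin] at h2
  have h3 : (((injs r n)ᶜ.card : ℕ) : ℝ) + (injs r n).card = (n : ℝ) ^ r := by exact_mod_cast h2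
  linarith

/-- expected value of sums over tuples of a random `k`-subset -/
theorem sample_mean {n k r : ℕ} (hk : 0 < k) (hkn : k ≤ n) (h : (Fin r → Fin n) → ℝ)
    (hb : ∀ u, |h u| ≤ 1) (h0 : 0 ≤ ∑ u, h u) :
    ∑ σ : Equiv.Perm (Fin n), ∑ p : Fin r → Fin k, h (fun i => σ (Fin.castLE hkn (p i))) ≤
      n.factorial * ((k : ℝ) ^ r * ((∑ u, h u) / (n : ℝ) ^ r + 3 * r ^ 2 / k)) := by
  have hk' : (0 : ℝ) < k := by exact_mod_cast hk
  have hn' : (0 : ℝ) < n := by exact_mod_cast lt_of_lt_of_le hk hkn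
  have hkn' : (k : ℝ) ≤ n := by exact_mod_cast hkn
  set A := ∑ u, h u with hA
  set F : ℝ := ((n.factorial : ℕ) : ℝ) with hF
  have hF0 : 0 < F := by rw [hF]; exact_mod_cast n.factorial_pos
  -- each injective tuple
  have hterm : ∀ p ∈ injs r k, ∑ σ : Equiv.Perm (Fin n), h (fun i => σ (Fin.castLE hkn (p i))) ≤
      F * (A / (n : ℝ) ^ r + 2 * r ^ 2 / k) := by
    intro p hp
    rw [mem_injs] at hp
    have hu0 : Function.Injective (fun i => Fin.castLE hkn (p i)) :=
      (Fin.castLE_injective hkn).comp hp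
    have h1 := avg_injs h hu0
    have h2 := sum_split_injs h hb
    have h3 := noninj_le n r
    set q : ℝ := (((injs r n).card : ℕ) : ℝ) with hq
    set E := ∑ σ : Equiv.Perm (Fin n), h (fun i => σ (Fin.castLE hkn (p i))) with hE
    have hEle : E ≤ F := by
      have : E ≤ ∑ σ : Equiv.Perm (Fin n), (1 : ℝ) :=
        Finset.sum_le_sum fun σ _ => (abs_le.1 (hb _)).2
      rw [Finset.sum_const, nsmul_eq_mul, mul_one, Finset.card_univ, Fintype.card_perm,
        Fintype.card_fin] at this
      exact this
    have h4 : ∑ u ∈ injs r n, h u ≤ A + ((n : ℝ) ^ r - q) := by linarith [(abs_le.1 h2).1]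
    have h5 : (n : ℝ) ^ r - q ≤ (n : ℝ) ^ r * (r ^ 2 / k) := by
      have h6 : (n : ℝ) ^ r - q ≤ (n : ℝ) ^ r * (r ^ 2 / n) := by
        rw [mul_div_assoc', le_div_iff₀ hn']
        linarith
      refine h6.trans ?_
      gcongr
    have hq0 : 0 ≤ (n : ℝ) ^ r - q := (abs_nonneg _).trans h2
    have hN : 0 < (n : ℝ) ^ r := by positivity
    have h7 : (n : ℝ) ^ r * E ≤ F * (A + 2 * ((n : ℝ) ^ r * (r ^ 2 / k))) := by
      have e : (n : ℝ) ^ r * E = q * E + ((n : ℝ) ^ r - q) * E := by ring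
      rw [e, h1]
      nlinarith [mul_le_mul_of_nonneg_left hEle hq0, mul_le_mul_of_nonneg_left h4 hF0.le,
        mul_le_mul_of_nonneg_left h5 hF0.le]
    have h8 : F * (A / (n : ℝ) ^ r + 2 * r ^ 2 / k) =
        (F * (A + 2 * ((n : ℝ) ^ r * (r ^ 2 / k)))) / (n : ℝ) ^ r := by
      field_simp
    rw [h8, le_div_iff₀ hN]
    linarith
  have hterm' : ∀ p : Fin r → Fin k,
      ∑ σ : Equiv.Perm (Fin n), h (fun i => σ (Fin.castLE hkn (p i))) ≤ F := by
    intro p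
    have : ∑ σ : Equiv.Perm (Fin n), h (fun i => σ (Fin.castLE hkn (p i))) ≤
        ∑ σ : Equiv.Perm (Fin n), (1 : ℝ) :=
      Finset.sum_le_sum fun σ _ => (abs_le.1 (hb _)).2
    rw [Finset.sum_const, nsmul_eq_mul, mul_one, Finset.card_univ, Fintype.card_perm,
      Fintype.card_fin] at this
    exact this
  rw [Finset.sum_comm]
  classical
  rw [← Finset.sum_add_sum_compl (injs r k)]
  have b1 := Finset.sum_le_sum hterm
  have b2 : ∑ p ∈ (injs r k)ᶜ, ∑ σ : Equiv.Perm (Fin n), h (fun i => σ (Fin.castLE hkn (p i))) ≤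
      ∑ p ∈ (injs r k)ᶜ, F := Finset.sum_le_sum fun p _ => hterm' p
  rw [Finset.sum_const, nsmul_eq_mul] at b1 b2
  have h2 := Finset.card_compl_add_card (injs r k)
  rw [Fintype.card_fun, Fintype.card_fin, Fintype.card_fin] at h2
  have h3 : (((injs r k)ᶜ.card : ℕ) : ℝ) + (injs r k).card = (k : ℝ) ^ r := by exact_mod_cast h2
  have h4 := noninj_le k r
  have h5 : (((injs r k)ᶜ.card : ℕ) : ℝ) ≤ (k : ℝ) ^ r * (r ^ 2 / k) := by
    rw [mul_div_assoc', le_div_iff₀ hk']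
    nlinarith
  have h6 : ((injs r k).card : ℝ) ≤ (k : ℝ) ^ r := by
    have : (0 : ℝ) ≤ (((injs r k)ᶜ.card : ℕ) : ℝ) := Nat.cast_nonneg _
    linarith
  have hpos : 0 ≤ F * (A / (n : ℝ) ^ r + 2 * r ^ 2 / k) := by positivity
  have h7 := mul_le_mul_of_nonneg_right h6 hpos
  have h8 := mul_le_mul_of_nonneg_right h5 hF0.le
  have e : F * ((k : ℝ) ^ r * (A / (n : ℝ) ^ r + 3 * r ^ 2 / k)) =
      (k : ℝ) ^ r * (F * (A / (n : ℝ) ^ r + 2 * r ^ 2 / k)) + (k : ℝ) ^ r * (r ^ 2 / k) * F := by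
    ring
  rw [e]
  linarith


/-! ## Sampling -/

def C4 {k : ℕ} (M : Fin k → Fin k → ℝ) : ℝ := ∑ a, ∑ a', (∑ b, M a b * M a' b) ^ 2

theorem sum_pi_succ {α : Type*} [Fintype α] [DecidableEq α] {r : ℕ} (f : (Fin (r + 1) → α) → ℝ) :
    ∑ u, f u = ∑ a, ∑ v : Fin r → α, f (Fin.cons a v) := by
  rw [← Equiv.sum_comp (Fin.consEquiv (fun _ : Fin (r + 1) => α)), Fintype.sum_prod_type]
  rfl

theorem sum_pi2 {α : Type*} [Fintype α] [DecidableEq α] (f : α → α → ℝ) :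
    ∑ u : Fin 2 → α, f (u 0) (u 1) = ∑ a, ∑ b, f a b := by
  simp only [sum_pi_succ, Fintype.sum_unique]
  rfl

theorem sum_pi4 {α : Type*} [Fintype α] [DecidableEq α] (f : α → α → α → α → ℝ) :
    ∑ u : Fin 4 → α, f (u 0) (u 1) (u 2) (u 3) = ∑ a, ∑ b, ∑ c, ∑ d, f a b c d := by
  simp only [sum_pi_succ, Fintype.sum_unique]
  rfl

def c4fun {k : ℕ} (M : Fin k → Fin k → ℝ) (u : Fin 4 → Fin k) : ℝ :=
  M (u 0) (u 2) * M (u 1) (u 2) * (M (u 0) (u 3) * M (u 1) (u 3))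

theorem C4_eq {k : ℕ} (M : Fin k → Fin k → ℝ) : C4 M = ∑ u, c4fun M u := by
  unfold c4fun C4
  rw [sum_pi4 (fun a a' b b' => M a b * M a' b * (M a b' * M a' b'))]
  refine Finset.sum_congr rfl fun a _ => Finset.sum_congr rfl fun a' _ => ?_
  rw [sq, Finset.sum_mul_sum]

theorem C4_nonneg {k : ℕ} (M : Fin k → Fin k → ℝ) : 0 ≤ C4 M :=
  Finset.sum_nonneg fun _ _ => Finset.sum_nonneg fun _ _ => sq_nonneg _

theorem abs_mul_le_one' {x y : ℝ} (hx : |x| ≤ 1) (hy : |y| ≤ 1) : |x * y| ≤ 1 := by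
  rw [abs_mul]
  exact mul_le_one₀ hx (abs_nonneg _) hy

theorem C4_le {n : ℕ} {U : Fin n → Fin n → ℝ} (hU : ∀ a b, |U a b| ≤ 1) {c : ℝ} (h : DCut U c) :
    C4 U ≤ 4 * c * n ^ 2 := by
  have e : C4 U = ∑ a', ∑ b', ∑ a, ∑ b, U a b * ((U a b' * U a' b') * U a' b) := by
    have h1 : C4 U = ∑ a', ∑ a, ∑ b', ∑ b, U a b * ((U a b' * U a' b') * U a' b) := by
      unfold C4
      rw [Finset.sum_comm]
      refine Finset.sum_congr rfl fun a' _ => Finset.sum_congr rfl fun a _ => ?_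
      rw [sq, Finset.sum_mul_sum]
      refine Finset.sum_congr rfl fun b' _ => Finset.sum_congr rfl fun b _ => ?_
      ring
    rw [h1]
    exact Finset.sum_congr rfl fun a' _ => Finset.sum_comm
  rw [e]
  have h2 : ∀ a' b', ∑ a, ∑ b, U a b * ((U a b' * U a' b') * U a' b) ≤ 4 * c := fun a' b' =>
    (le_abs_self _).trans (h.frac4 (fun a => U a b' * U a' b') (fun b => U a' b)
      (fun a => abs_mul_le_one' (hU _ _) (hU _ _)) (fun b => hU _ _))
  calc _ ≤ ∑ a' : Fin n, ∑ b' : Fin n, 4 * c :=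
        Finset.sum_le_sum fun a' _ => Finset.sum_le_sum fun b' _ => h2 a' b'
    _ = _ := by simp; ring

theorem dcut_of_C4 {k : ℕ} {M : Fin k → Fin k → ℝ} {δ : ℝ} (hδ : 0 ≤ δ)
    (h : C4 M ≤ δ ^ 4 * k ^ 4) : DCut M (δ * k ^ 2) := by
  intro A B
  set X := ∑ a ∈ A, ∑ b ∈ B, M a b with hX
  have hA : (A.card : ℝ) ≤ k := by
    have := Finset.card_le_univ A
    rw [Fintype.card_fin] at this
    exact_mod_cast this
  have hB : (B.card : ℝ) ≤ k := by
    have := Finset.card_le_univ B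
    rw [Fintype.card_fin] at this
    exact_mod_cast this
  set Z := ∑ b, (∑ a ∈ A, M a b) ^ 2 with hZ
  have hZ0 : 0 ≤ Z := Finset.sum_nonneg fun _ _ => sq_nonneg _
  have h1 : X ^ 2 ≤ k * Z := by
    have e : X = ∑ b ∈ B, ∑ a ∈ A, M a b := Finset.sum_comm
    rw [e]
    refine (sq_sum_le_card_mul_sum_sq).trans ?_
    have : ∑ b ∈ B, (∑ a ∈ A, M a b) ^ 2 ≤ Z :=
      Finset.sum_le_sum_of_subset_of_nonneg (Finset.subset_univ _) fun _ _ _ => sq_nonneg _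
    gcongr
  have h2 : Z ^ 2 ≤ k ^ 2 * C4 M := by
    have e : Z = ∑ x ∈ A ×ˢ A, ∑ b, M x.1 b * M x.2 b := by
      rw [Finset.sum_comm, hZ]
      refine Finset.sum_congr rfl fun b _ => ?_
      rw [sq, Finset.sum_mul_sum, Finset.sum_product]
    rw [e]
    refine (sq_sum_le_card_mul_sum_sq).trans ?_
    have h3 : ∑ x ∈ A ×ˢ A, (∑ b, M x.1 b * M x.2 b) ^ 2 ≤ C4 M := by
      unfold C4
      rw [← Fintype.sum_prod_type']
      exact Finset.sum_le_sum_of_subset_of_nonneg (Finset.subset_univ _) fun _ _ _ => sq_nonneg _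
    have h4 : (((A ×ˢ A).card : ℕ) : ℝ) ≤ k ^ 2 := by
      rw [Finset.card_product, sq]
      push_cast
      gcongr
    gcongr
  have h3 : |X| ^ 4 ≤ (δ * k ^ 2) ^ 4 := by
    have e : |X| ^ 4 = (X ^ 2) ^ 2 := by rw [← sq_abs X]; ring
    rw [e]
    calc (X ^ 2) ^ 2 ≤ (k * Z) ^ 2 := by gcongr
      _ = k ^ 2 * Z ^ 2 := by ring
      _ ≤ k ^ 2 * (k ^ 2 * (δ ^ 4 * k ^ 4)) := by gcongr; exact h2.trans (by gcongr)
      _ = _ := by ring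
  exact (pow_le_pow_iff_left₀ (abs_nonneg _) (by positivity) (by norm_num)).1 h3

theorem markov_count {ι : Type*} [Fintype ι] (f : ι → ℝ) (hf : ∀ i, 0 ≤ f i) (θ : ℝ) (s : Finset ι)
    (hs : ∀ i ∈ s, θ ≤ f i) : θ * s.card ≤ ∑ i, f i := by
  calc θ * s.card = ∑ i ∈ s, θ := by rw [Finset.sum_const, nsmul_eq_mul]; ring
    _ ≤ ∑ i ∈ s, f i := Finset.sum_le_sum hs
    _ ≤ _ := Finset.sum_le_sum_of_subset_of_nonneg (Finset.subset_univ _) fun i _ _ => hf i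

open Classical in
theorem bad_cut_count {n k : ℕ} (hk : 0 < k) (hkn : k ≤ n) {U : Fin n → Fin n → ℝ}
    (hU : ∀ a b, |U a b| ≤ 1) {ε δ : ℝ} (hδ : 0 < δ) (h : DCut U (ε * n ^ 2)) :
    δ ^ 4 * ((Finset.univ.filter fun σ : Equiv.Perm (Fin n) =>
      ¬ DCut (fun a b => U (σ (Fin.castLE hkn a)) (σ (Fin.castLE hkn b))) (δ * k ^ 2)).card : ℝ) ≤
      n.factorial * (4 * ε + 48 / k) := by
  have hk' : (0 : ℝ) < k := by exact_mod_cast hk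
  have hn' : (0 : ℝ) < n := by exact_mod_cast lt_of_lt_of_le hk hkn
  have h1 := sample_mean hk hkn (c4fun U) (fun u =>
    abs_mul_le_one' (abs_mul_le_one' (hU _ _) (hU _ _)) (abs_mul_le_one' (hU _ _) (hU _ _)))
    (by rw [← C4_eq]; exact C4_nonneg U)
  rw [← C4_eq] at h1
  have h2 := markov_count (fun σ : Equiv.Perm (Fin n) =>
    C4 (fun a b => U (σ (Fin.castLE hkn a)) (σ (Fin.castLE hkn b)))) (fun σ => C4_nonneg _)
    (δ ^ 4 * k ^ 4) (Finset.univ.filter fun σ : Equiv.Perm (Fin n) =>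
      ¬ DCut (fun a b => U (σ (Fin.castLE hkn a)) (σ (Fin.castLE hkn b))) (δ * k ^ 2)) (by
      intro σ hσ
      rw [Finset.mem_filter] at hσ
      by_contra hcon
      push Not at hcon
      exact hσ.2 (dcut_of_C4 hδ.le hcon.le))
  have e : ∀ σ : Equiv.Perm (Fin n), C4 (fun a b => U (σ (Fin.castLE hkn a)) (σ (Fin.castLE hkn b))) =
      ∑ p : Fin 4 → Fin k, c4fun U (fun i => σ (Fin.castLE hkn (p i))) := fun σ => C4_eq _
  simp only [e] at h2
  have h3 := h2.trans h1
  have h4 : C4 U / (n : ℝ) ^ 4 ≤ 4 * ε := by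
    rw [div_le_iff₀ (by positivity)]
    refine (C4_le hU h).trans (le_of_eq ?_)
    ring
  set c : ℝ := ((Finset.univ.filter fun σ : Equiv.Perm (Fin n) =>
      ¬ DCut (fun a b => U (σ (Fin.castLE hkn a)) (σ (Fin.castLE hkn b))) (δ * k ^ 2)).card : ℝ)
  have h5 : (n.factorial : ℝ) * ((k : ℝ) ^ 4 * (C4 U / (n : ℝ) ^ 4 + 3 * ((4 : ℕ) : ℝ) ^ 2 / k)) ≤
      n.factorial * ((k : ℝ) ^ 4 * (4 * ε + 48 / k)) := by
    have : 3 * ((4 : ℕ) : ℝ) ^ 2 / k = 48 / k := by norm_num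
    rw [this]
    gcongr
  have h6 : (δ ^ 4 * c) * (k : ℝ) ^ 4 ≤ (n.factorial * (4 * ε + 48 / k)) * (k : ℝ) ^ 4 := by
    calc (δ ^ 4 * c) * (k : ℝ) ^ 4 = δ ^ 4 * (k : ℝ) ^ 4 * c := by ring
      _ ≤ _ := h3.trans h5
      _ = _ := by ring
  exact le_of_mul_le_mul_right h6 (by positivity)

open Classical in
theorem bad_size_count {n k : ℕ} (hk : 0 < k) (hkn : k ≤ n) {g : Fin n → ℝ}
    (hg : ∀ a, |g a| ≤ 1) (hg0 : ∑ a, g a = 0) {η : ℝ} (hη : 0 < η) :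
    η ^ 2 * k * ((Finset.univ.filter fun σ : Equiv.Perm (Fin n) =>
      ¬ |∑ a, g (σ (Fin.castLE hkn a))| ≤ η * k).card : ℝ) ≤ n.factorial * 12 := by
  have hk' : (0 : ℝ) < k := by exact_mod_cast hk
  have hz : ∑ u : Fin 2 → Fin n, g (u 0) * g (u 1) = 0 := by
    rw [sum_pi2 (fun a b => g a * g b), ← Finset.sum_mul_sum, hg0, zero_mul]
  have h1 := sample_mean hk hkn (fun u : Fin 2 → Fin n => g (u 0) * g (u 1)) (fun u =>
    abs_mul_le_one' (hg _) (hg _)) hz.ge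
  rw [hz] at h1
  have e : ∀ σ : Equiv.Perm (Fin n), (∑ a, g (σ (Fin.castLE hkn a))) ^ 2 =
      ∑ p : Fin 2 → Fin k, g (σ (Fin.castLE hkn (p 0))) * g (σ (Fin.castLE hkn (p 1))) := by
    intro σ
    rw [sum_pi2 (fun a b => g (σ (Fin.castLE hkn a)) * g (σ (Fin.castLE hkn b))),
      ← Finset.sum_mul_sum, sq]
  have h2 := markov_count (fun σ : Equiv.Perm (Fin n) => (∑ a, g (σ (Fin.castLE hkn a))) ^ 2)
    (fun σ => sq_nonneg _) ((η * k) ^ 2) (Finset.univ.filter fun σ : Equiv.Perm (Fin n) =>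
      ¬ |∑ a, g (σ (Fin.castLE hkn a))| ≤ η * k) (by
      intro σ hσ
      rw [Finset.mem_filter] at hσ
      have := hσ.2
      push Not at this
      rw [← sq_abs (∑ a, g (σ (Fin.castLE hkn a)))]
      gcongr)
  simp only [e] at h2
  have h3 := h2.trans h1
  set c : ℝ := ((Finset.univ.filter fun σ : Equiv.Perm (Fin n) =>
      ¬ |∑ a, g (σ (Fin.castLE hkn a))| ≤ η * k).card : ℝ)
  have h6 : (η ^ 2 * k * c) * (k : ℝ) ≤ (n.factorial * 12) * (k : ℝ) := by
    calc (η ^ 2 * k * c) * (k : ℝ) = (η * k) ^ 2 * c := by ring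
      _ ≤ _ := h3
      _ = _ := by
        push_cast
        field_simp
        ring
  exact le_of_mul_le_mul_right h6 hk'


/-! ## Sampling theorem -/

/-- the graphon kernel of a graph, uncurried -/
abbrev gk {n : ℕ} (G : SimpleGraph (Fin n)) : ℝ × ℝ → ℝ := Function.uncurry (graphonOf G)

theorem gk_pker {n : ℕ} (G : SimpleGraph (Fin n)) : PKer (gk G) := graphonOf_pker G

theorem sample_close {n k K q : ℕ} (hk : 0 < k) (hkn : k ≤ n) (hK : 0 < K) (hq : 0 < q)
    (G : SimpleGraph (Fin n)) (p : Fin n → Fin K) (d : Fin K → Fin K → Fin (q + 1))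
    {ε δ η : ℝ} (hε : 0 ≤ ε) (hδ : 0 ≤ δ) (hη : 0 ≤ η)
    (h1 : DCut (fun a b => adjR G a b - ((d (p a) (p b) : ℕ) : ℝ) / q) (ε * n ^ 2))
    (h2 : ∀ i, |(∑ a, if p a = i then (1 : ℝ) else 0) - n / K| ≤ 1)
    (s : Fin k → Fin n)
    (h3 : DCut (fun a b => adjR G (s a) (s b) - ((d (p (s a)) (p (s b)) : ℕ) : ℝ) / q) (δ * k ^ 2))
    (h4 : ∀ i, |∑ a, ((if p (s a) = i then (1 : ℝ) else 0) -
      (∑ a, if p a = i then (1 : ℝ) else 0) / n)| ≤ η * k) :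
    Cl ((ε + 4 * K ^ 2 * (1 / k)) + (δ + 4 * K ^ 2 * (η + 1 / k))) (gk G) (gk (G.comap s)) := by
  have hn : 0 < n := lt_of_lt_of_le hk hkn
  have hk' : (0 : ℝ) < k := by exact_mod_cast hk
  have hn' : (0 : ℝ) < n := by exact_mod_cast hn
  have hkn' : (k : ℝ) ≤ n := by exact_mod_cast hkn
  have hq' : (0 : ℝ) < q := by exact_mod_cast hq
  set D : Fin K → Fin K → ℝ := fun i j => ((d i j : ℕ) : ℝ) / q with hD
  have hd : ∀ i j, D i j ∈ Set.Icc (0 : ℝ) 1 := by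
    intro i j
    refine ⟨by positivity, ?_⟩
    rw [hD]
    simp only
    rw [div_le_one hq']
    have := (d i j).2
    exact_mod_cast (by omega : ((d i j : Fin (q + 1)) : ℕ) ≤ q)
  have a1 : Cl (ε + 4 * K ^ 2 * (1 / n)) (stepK n (adjR G)) (stepK K D) := by
    refine close_to_step hn hK (adjR_mem G) p D hd hε (by positivity) h1 ?_
    intro i
    rw [one_div, inv_mul_cancel₀ hn'.ne']
    exact h2 i
  have a2 : Cl (δ + 4 * K ^ 2 * (η + 1 / k)) (stepK k (adjR (G.comap s))) (stepK K D) := by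
    refine close_to_step hk hK (adjR_mem _) (fun a => p (s a)) D hd hδ (by positivity) h3 ?_
    intro i
    have e1 := h4 i
    have e2 := h2 i
    rw [Finset.sum_sub_distrib, Finset.sum_const, Finset.card_univ, Fintype.card_fin, nsmul_eq_mul] at e1
    set A := ∑ a, (if p (s a) = i then (1 : ℝ) else 0)
    set B := ∑ a, (if p a = i then (1 : ℝ) else 0)
    have e3 : |(k : ℝ) * (B / n) - k / K| ≤ 1 := by
      have : (k : ℝ) * (B / n) - k / K = (k / n) * (B - n / K) := by
        field_simp
      rw [this, abs_mul, abs_of_nonneg (by positivity)]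
      calc (k : ℝ) / n * |B - n / K| ≤ 1 * 1 :=
            mul_le_mul ((div_le_one hn').2 hkn') e2 (abs_nonneg _) zero_le_one
        _ = 1 := one_mul 1
    calc |A - k / K| ≤ |A - k * (B / n)| + |k * (B / n) - k / K| := abs_sub_le _ _ _
      _ ≤ η * k + 1 := add_le_add e1 e3
      _ = (η + 1 / k) * k := by field_simp
  have hP : PKer (stepK K D) := stepK_pker hd
  have b1 := gk_pker G
  have b2 := gk_pker (G.comap s)
  simp only [gk, graphonOf_eq] at b1 b2 ⊢
  refine (Cl.trans b1 hP b2 a1 (Cl.symm b2 hP a2)).mono ?_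
  have : 1 / (n : ℝ) ≤ 1 / k := one_div_le_one_div_of_le hk' hkn'
  have h5 : (0:ℝ) ≤ 4 * K ^ 2 := by positivity
  nlinarith

open Classical in
theorem sampling_sigma (δ0 : ℝ) (hδ0 : 0 < δ0) : ∃ k0 : ℕ, 0 < k0 ∧ ∀ k, k0 ≤ k → ∀ n (hkn : k ≤ n)
    (G : SimpleGraph (Fin n)), 3 * ((Finset.univ.filter fun σ : Equiv.Perm (Fin n) =>
      ¬ Cl δ0 (gk G) (gk (G.comap fun a => σ (Fin.castLE hkn a)))).card : ℝ) ≤ n.factorial := by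
  set δ : ℝ := δ0 / 4 with hδ
  have hδp : 0 < δ := by positivity
  set ε : ℝ := min (δ0 / 4) (δ ^ 4 / 48) with hε
  have hεp : 0 < ε := by positivity
  have hε1 : ε ≤ δ0 / 4 := min_le_left _ _
  have hε2 : ε ≤ δ ^ 4 / 48 := min_le_right _ _
  obtain ⟨K0, q, N, hq, hN, hreg⟩ := weak_reg ε hεp
  set η : ℝ := δ0 / (32 * (K0 ^ 2 + 1)) with hη
  have hηp : 0 < η := by positivity
  obtain ⟨m, hm⟩ := exists_nat_gt (576 / δ ^ 4 + 72 * K0 / η ^ 2 + 32 * K0 ^ 2 / δ0)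
  refine ⟨N + m + 1, by omega, ?_⟩
  intro k hk n hkn G
  have hk0 : 0 < k := by omega
  have hk' : (0 : ℝ) < k := by exact_mod_cast hk0
  have hmk : (m : ℝ) ≤ k := by exact_mod_cast (by omega : m ≤ k)
  have t1 : (0:ℝ) ≤ 576 / δ ^ 4 := by positivity
  have t2 : (0:ℝ) ≤ 72 * K0 / η ^ 2 := by positivity
  have t3 : (0:ℝ) ≤ 32 * K0 ^ 2 / δ0 := by positivity
  have c1 : 48 / (k : ℝ) ≤ δ ^ 4 / 12 := by
    have : 576 / δ ^ 4 ≤ k := by linarith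
    rw [div_le_iff₀ (by positivity)] at this
    rw [div_le_iff₀ hk']
    linarith
  have c2 : 72 * (K0 : ℝ) ≤ η ^ 2 * k := by
    have : 72 * K0 / η ^ 2 ≤ k := by linarith
    rw [div_le_iff₀ (by positivity)] at this
    linarith
  have c3 : 4 * (K0 : ℝ) ^ 2 * (1 / k) ≤ δ0 / 8 := by
    have : 32 * K0 ^ 2 / δ0 ≤ k := by linarith
    rw [div_le_iff₀ (by positivity)] at this
    rw [mul_one_div, div_le_iff₀ hk']
    linarith
  have c4 : 4 * (K0 : ℝ) ^ 2 * η ≤ δ0 / 8 := by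
    rw [hη, mul_div_assoc', div_le_iff₀ (by positivity)]
    nlinarith [sq_nonneg (K0 : ℝ)]
  obtain ⟨K, hK, hKK, p, d, h1, h2⟩ := hreg n (by omega) G
  have hKK' : (K : ℝ) ≤ K0 := by exact_mod_cast hKK
  have hn' : (0 : ℝ) < n := by exact_mod_cast lt_of_lt_of_le hk0 hkn
  have hq' : (0 : ℝ) < q := by exact_mod_cast hq
  set Ni : Fin K → ℝ := fun i => ∑ a, if p a = i then (1 : ℝ) else 0 with hNi
  have hNi0 : ∀ i, 0 ≤ Ni i := fun i => Finset.sum_nonneg fun a _ => by split_ifs <;> norm_num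
  have hNin : ∀ i, Ni i ≤ n := fun i => by
    calc Ni i ≤ ∑ a : Fin n, (1:ℝ) := Finset.sum_le_sum fun a _ => by split_ifs <;> norm_num
      _ = n := by simp
  set B1 := Finset.univ.filter fun σ : Equiv.Perm (Fin n) =>
      ¬ DCut (fun a b => (fun a b => adjR G a b - ((d (p a) (p b) : ℕ) : ℝ) / q)
        (σ (Fin.castLE hkn a)) (σ (Fin.castLE hkn b))) (δ * k ^ 2) with hB1
  set B2 := fun i => Finset.univ.filter fun σ : Equiv.Perm (Fin n) =>
      ¬ |∑ a, (fun a => (if p a = i then (1 : ℝ) else 0) - Ni i / n) (σ (Fin.castLE hkn a))| ≤ η * k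
    with hB2
  have hb1 := bad_cut_count hk0 hkn (U := fun a b => adjR G a b - ((d (p a) (p b) : ℕ) : ℝ) / q)
    (by
      intro a b
      have u1 := adjR_mem G a b
      have u2 : ((d (p a) (p b) : ℕ) : ℝ) / q ≤ 1 := by
        rw [div_le_one hq']
        have := (d (p a) (p b)).2
        exact_mod_cast (by omega : ((d (p a) (p b) : Fin (q + 1)) : ℕ) ≤ q)
      have u3 : 0 ≤ ((d (p a) (p b) : ℕ) : ℝ) / q := by positivity
      rw [abs_le]
      constructor <;> linarith [u1.1, u1.2]) hδp h1
  have hb2 : ∀ i, _ := fun i => bad_size_count hk0 hkn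
    (g := fun a => (if p a = i then (1 : ℝ) else 0) - Ni i / n)
    (by
      intro a
      have u1 : 0 ≤ Ni i / n := div_nonneg (hNi0 i) hn'.le
      have u2 : Ni i / n ≤ 1 := (div_le_one hn').2 (hNin i)
      rw [abs_le]
      split_ifs <;> constructor <;> linarith)
    (by
      rw [Finset.sum_sub_distrib, Finset.sum_const, Finset.card_univ, Fintype.card_fin, nsmul_eq_mul,
        mul_div_cancel₀ _ hn'.ne']
      exact sub_self _) hηp
  have hsub : (Finset.univ.filter fun σ : Equiv.Perm (Fin n) =>
      ¬ Cl δ0 (gk G) (gk (G.comap fun a => σ (Fin.castLE hkn a)))) ⊆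
      B1 ∪ Finset.univ.biUnion B2 := by
    intro σ hσ
    by_contra hc
    rw [Finset.mem_union, not_or] at hc
    obtain ⟨hc1, hc2⟩ := hc
    rw [Finset.mem_filter] at hσ
    apply hσ.2
    have hc1' : DCut (fun a b => (fun a b => adjR G a b - ((d (p a) (p b) : ℕ) : ℝ) / q)
        (σ (Fin.castLE hkn a)) (σ (Fin.castLE hkn b))) (δ * k ^ 2) := by
      by_contra hh
      exact hc1 (Finset.mem_filter.2 ⟨Finset.mem_univ _, hh⟩)
    have hc2' : ∀ i, |∑ a, (fun a => (if p a = i then (1 : ℝ) else 0) - Ni i / n) (σ (Fin.castLE hkn a))|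
        ≤ η * k := by
      intro i
      by_contra hh
      exact hc2 (Finset.mem_biUnion.2 ⟨i, Finset.mem_univ _,
        Finset.mem_filter.2 ⟨Finset.mem_univ _, hh⟩⟩)
    refine (sample_close hk0 hkn hK hq G p d hεp.le hδp.le hηp.le h1 h2
      (fun a => σ (Fin.castLE hkn a)) hc1' hc2').mono ?_
    have v1 : 4 * (K:ℝ) ^ 2 * (1 / k) ≤ 4 * (K0 : ℝ) ^ 2 * (1 / k) := by gcongr
    have v2 : 4 * (K:ℝ) ^ 2 * η ≤ 4 * (K0 : ℝ) ^ 2 * η := by gcongr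
    have : 4 * (K:ℝ) ^ 2 * (η + 1 / k) = 4 * (K:ℝ) ^ 2 * η + 4 * (K:ℝ) ^ 2 * (1 / k) := by ring
    rw [this]
    linarith
  have hcard := (Finset.card_le_card hsub).trans ((Finset.card_union_le _ _).trans
    (Nat.add_le_add_left (Finset.card_biUnion_le) _))
  have hcard' : ((Finset.univ.filter fun σ : Equiv.Perm (Fin n) =>
      ¬ Cl δ0 (gk G) (gk (G.comap fun a => σ (Fin.castLE hkn a)))).card : ℝ) ≤
      B1.card + ∑ i, ((B2 i).card : ℝ) := by exact_mod_cast hcard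
  have hf : (0 : ℝ) < n.factorial := by exact_mod_cast n.factorial_pos
  have f1 : (B1.card : ℝ) ≤ n.factorial / 6 := by
    have : δ ^ 4 * (B1.card : ℝ) ≤ δ ^ 4 * (n.factorial / 6) := by
      refine hb1.trans ?_
      have : (n.factorial : ℝ) * (4 * ε + 48 / k) ≤ n.factorial * (δ ^ 4 / 6) := by
        refine mul_le_mul_of_nonneg_left ?_ hf.le
        linarith
      linarith
    exact le_of_mul_le_mul_left this (by positivity)
  have f2 : ∑ i, ((B2 i).card : ℝ) ≤ n.factorial / 6 := by
    have hp : 0 < η ^ 2 * k := by positivity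
    have : η ^ 2 * k * ∑ i, ((B2 i).card : ℝ) ≤ η ^ 2 * k * (n.factorial / 6) := by
      rw [Finset.mul_sum]
      calc ∑ i, η ^ 2 * k * ((B2 i).card : ℝ) ≤ ∑ i : Fin K, (n.factorial * 12 : ℝ) :=
            Finset.sum_le_sum fun i _ => hb2 i
        _ = K * (n.factorial * 12) := by simp
        _ ≤ K0 * (n.factorial * 12) := by gcongr
        _ = (72 * K0) * (n.factorial / 6) := by ring
        _ ≤ _ := by gcongr
    exact le_of_mul_le_mul_left this hp
  linarith

/-- a subset whose induced subgraph is close to `G` -/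
def GoodS {n : ℕ} (G : SimpleGraph (Fin n)) (δ0 : ℝ) (k : ℕ) (S : Finset (Fin n)) : Prop :=
  ∀ f : Fin k ↪ Fin n, (∀ i, f i ∈ S) → Cl δ0 (gk G) (gk (G.comap f))

theorem emb_same_range {n k : ℕ} {S : Finset (Fin n)} (hS : S.card = k) (f g : Fin k ↪ Fin n)
    (hf : ∀ i, f i ∈ S) (hg : ∀ i, g i ∈ S) : ∃ σ : Equiv.Perm (Fin k), ∀ i, g (σ i) = f i := by
  have hsur : ∀ x ∈ S, ∃ i, g i = x := by
    intro x hx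
    have : Finset.univ.map g = S := by
      apply Finset.eq_of_subset_of_card_le
      · intro y hy
        obtain ⟨i, _, rfl⟩ := Finset.mem_map.1 hy
        exact hg i
      · simp [hS]
    rw [← this] at hx
    obtain ⟨i, _, h⟩ := Finset.mem_map.1 hx
    exact ⟨i, h⟩
  choose t ht using fun i => hsur (f i) (hf i)
  have hinj : Function.Injective t := by
    intro i j hij
    apply f.injective
    rw [← ht i, ← ht j, hij]
  exact ⟨Equiv.ofBijective t (Finite.injective_iff_bijective.1 hinj), ht⟩

theorem comap_iso {n k : ℕ} (G : SimpleGraph (Fin n)) {f g : Fin k → Fin n} (σ : Equiv.Perm (Fin k))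
    (h : ∀ i, g (σ i) = f i) : Nonempty (G.comap f ≃g G.comap g) := by
  refine ⟨⟨σ, ?_⟩⟩
  intro a b
  simp only [SimpleGraph.comap_adj, h]

theorem sampling (δ0 : ℝ) (hδ0 : 0 < δ0) : ∃ k0 : ℕ, 0 < k0 ∧ ∀ k, k0 ≤ k → ∀ n, k ≤ n → ∀
    (G : SimpleGraph (Fin n)),
    3 * {S : Finset (Fin n) | S.card = k ∧ ¬ GoodS G δ0 k S}.ncard ≤ n.choose k := by
  classical
  obtain ⟨k0, hk0, h⟩ := sampling_sigma δ0 hδ0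
  refine ⟨k0, hk0, ?_⟩
  intro k hk n hkn G
  have h1 := h k hk n hkn G
  set S0 : Finset (Fin n) := Finset.univ.map (Fin.castLEEmb hkn) with hS0
  have hS0c : S0.card = k := by simp [hS0]
  have h2 := avg_subsets (fun S => if GoodS G δ0 k S then (0 : ℝ) else 1) hS0c
  have e1 : ∑ S ∈ Finset.powersetCard k (Finset.univ : Finset (Fin n)),
      (if GoodS G δ0 k S then (0 : ℝ) else 1) =
      ({S : Finset (Fin n) | S.card = k ∧ ¬ GoodS G δ0 k S}.ncard : ℝ) := by
    have : {S : Finset (Fin n) | S.card = k ∧ ¬ GoodS G δ0 k S} =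
      ((Finset.powersetCard k (Finset.univ : Finset (Fin n))).filter fun S => ¬ GoodS G δ0 k S : Set _) := by
      ext S
      simp [Finset.mem_powersetCard]
    rw [this, Set.ncard_coe_finset, Finset.card_filter]
    push_cast
    exact Finset.sum_congr rfl fun S _ => by split_ifs <;> simp_all
  have e2 : ∑ σ : Equiv.Perm (Fin n), (if GoodS G δ0 k (S0.map σ.toEmbedding) then (0 : ℝ) else 1) ≤
      ((Finset.univ.filter fun σ : Equiv.Perm (Fin n) =>
      ¬ Cl δ0 (gk G) (gk (G.comap fun a => σ (Fin.castLE hkn a)))).card : ℝ) := by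
    rw [Finset.card_filter]
    push_cast
    refine Finset.sum_le_sum fun σ _ => ?_
    by_cases hc : Cl δ0 (gk G) (gk (G.comap fun a => σ (Fin.castLE hkn a)))
    · have : GoodS G δ0 k (S0.map σ.toEmbedding) := by
        intro f hf
        obtain ⟨τ, hτ⟩ := emb_same_range (by simp [hS0c]) f
          ((Fin.castLEEmb hkn).trans σ.toEmbedding) hf (by
            intro i
            rw [hS0, Finset.map_map]
            exact Finset.mem_map_of_mem _ (Finset.mem_univ _))
        obtain ⟨e⟩ := comap_iso G (f := f) (g := fun a => σ (Fin.castLE hkn a)) τ hτ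
        have := Cl.trans (gk_pker _) (gk_pker _) (gk_pker _) hc
          (Cl.symm (gk_pker _) (gk_pker _) (Cl_iso e))
        exact this.mono (by linarith)
      simp [hc, this]
    · simp only [hc, not_false_iff, if_true]
      split_ifs <;> norm_num
  rw [e1] at h2
  have hf : (0 : ℝ) < n.factorial := by exact_mod_cast n.factorial_pos
  have : 3 * ({S : Finset (Fin n) | S.card = k ∧ ¬ GoodS G δ0 k S}.ncard : ℝ) ≤ n.choose k := by
    have : (n.factorial : ℝ) * (3 * ({S : Finset (Fin n) | S.card = k ∧ ¬ GoodS G δ0 k S}.ncard : ℝ)) ≤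
        n.factorial * n.choose k := by
      have h3 := mul_le_mul_of_nonneg_left e2 (show (0:ℝ) ≤ n.choose k by positivity)
      have h4 := mul_le_mul_of_nonneg_left h1 (show (0:ℝ) ≤ n.choose k by positivity)
      nlinarith
    exact le_of_mul_le_mul_left this hf
  exact_mod_cast this


/-! ## (b) implies (a) -/

def CondB (P : GraphProp) : Prop :=
  ∀ ε : ℝ, 0 < ε → ∃ (ε' : ℝ) (n' : ℕ), 0 < ε' ∧ 0 < n' ∧
        ∀ (n m : ℕ) (G : SimpleGraph (Fin n)) (G' : SimpleGraph (Fin m)),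
          G ∈ P n → deltaCut (graphonOf G) (graphonOf G') < ε' →
          n' ≤ n → n' ≤ m → graphD1P G' P < ENNReal.ofReal ε

def CondC (P : GraphProp) : Prop :=
  ∀ ε : ℝ, 0 < ε → ∃ (ε₀ : ℝ) (n₀ : ℕ), 0 < ε₀ ∧ 0 < n₀ ∧
        ∀ (n m : ℕ) (G : SimpleGraph (Fin n)) (G' : SimpleGraph (Fin m)),
          G ∈ P n → IsInducedSubgraph G G' →
          deltaCut (graphonOf G) (graphonOf G') < ε₀ →
          n₀ ≤ m → graphD1P G' P < ENNReal.ofReal ε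

def Samp (δ : ℝ) (k : ℕ) : Prop := ∀ n, k ≤ n → ∀ (G : SimpleGraph (Fin n)),
    3 * {S : Finset (Fin n) | S.card = k ∧ ¬ GoodS G δ k S}.ncard ≤ n.choose k

theorem Samp_one (k : ℕ) : Samp 1 k := by
  intro n _ G
  have : {S : Finset (Fin n) | S.card = k ∧ ¬ GoodS G 1 k S} = ∅ := by
    ext S
    simp only [Set.mem_ofPred_eq, Set.mem_empty_iff_false, iff_false, not_and, not_not]
    intro _ f _
    exact ⟨InvMP.id, CutBd.one ((gk_pker G).sub ((gk_pker (G.comap f)).twist InvMP.id))⟩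
  rw [this, Set.ncard_empty]
  exact Nat.zero_le _

open Classical in
def jk (k : ℕ) : ℕ := Nat.findGreatest (fun j => Samp (1 / ((j : ℝ) + 1)) k) k

def alphak (k : ℕ) : ℝ := 1 / ((jk k : ℝ) + 1)

theorem Samp_alpha (k : ℕ) : Samp (alphak k) k := by
  classical
  have := Nat.findGreatest_spec (P := fun j : ℕ => Samp (1 / ((j : ℝ) + 1)) k) (Nat.zero_le k)
    (by simpa using Samp_one k)
  exact this

theorem alpha_small (j : ℕ) : ∃ k0 : ℕ, 0 < k0 ∧ ∀ k, k0 ≤ k → alphak k ≤ 1 / ((j : ℝ) + 1) := by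
  classical
  obtain ⟨k0, hk0, h⟩ := sampling (1 / ((j : ℝ) + 1)) (by positivity)
  refine ⟨k0 + j, by omega, ?_⟩
  intro k hk
  have : j ≤ jk k := Nat.le_findGreatest (P := fun j : ℕ => Samp (1 / ((j : ℝ) + 1)) k) (by omega)
    (h k (by omega))
  unfold alphak
  apply one_div_le_one_div_of_le (by positivity)
  have : (j : ℝ) ≤ jk k := by exact_mod_cast this
  linarith

theorem card_split {n : ℕ} (k : ℕ) (A B : Finset (Fin n) → Prop) (h : ∀ S, S.card = k → ¬ B S → A S) :
    n.choose k ≤ {S : Finset (Fin n) | S.card = k ∧ B S}.ncard +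
      {S : Finset (Fin n) | S.card = k ∧ A S}.ncard := by
  classical
  have e : n.choose k = {S : Finset (Fin n) | S.card = k}.ncard := by
    have : {S : Finset (Fin n) | S.card = k} = (Finset.powersetCard k (Finset.univ : Finset (Fin n)) : Set _) := by
      ext S
      simp [Finset.mem_powersetCard]
    rw [this, Set.ncard_coe_finset, Finset.card_powersetCard, Finset.card_univ, Fintype.card_fin]
  rw [e]
  refine (Set.ncard_le_ncard ?_ (Set.toFinite _)).trans (Set.ncard_union_le _ _)
  intro S hS
  by_cases hb : B S
  · exact Or.inl ⟨hS, hb⟩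
  · exact Or.inr ⟨hS, h S hS hb⟩

theorem b_to_a (P : GraphProp) (hb : CondB P) : GraphTestable P := by
  classical
  refine ⟨fun k => {H | ∃ n, k ≤ n ∧ ∃ G : SimpleGraph (Fin n), G ∈ P n ∧ Cl (alphak k) (gk G) (gk H)},
    ?_, ?_, ?_⟩
  · intro n G H ⟨e⟩
    have key : ∀ G H : SimpleGraph (Fin n), G ≃g H →
        (∃ m, n ≤ m ∧ ∃ G0 : SimpleGraph (Fin m), G0 ∈ P m ∧ Cl (alphak n) (gk G0) (gk G)) →
        (∃ m, n ≤ m ∧ ∃ G0 : SimpleGraph (Fin m), G0 ∈ P m ∧ Cl (alphak n) (gk G0) (gk H)) := by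
      rintro G H e ⟨m, hm, G0, hG0, hc⟩
      exact ⟨m, hm, G0, hG0, (Cl.trans (gk_pker _) (gk_pker _) (gk_pker _) hc (Cl_iso e)).mono (by linarith)⟩
    exact ⟨key G H e, key H G e.symm⟩
  · intro n G hG k hk hkn
    have h1 := Samp_alpha k n hkn G
    have h2 := card_split k (fun S => inducedMem G S k (fun k => {H | ∃ n, k ≤ n ∧
      ∃ G : SimpleGraph (Fin n), G ∈ P n ∧ Cl (alphak k) (gk G) (gk H)}))
      (fun S => ¬ GoodS G (alphak k) k S) (by
        intro S hS hgood
        rw [not_not] at hgood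
        refine ⟨G.comap (S.orderEmbOfFin hS).toEmbedding, ⟨n, hkn, G, hG, hgood _ ?_⟩,
          (S.orderEmbOfFin hS).toEmbedding, ?_, ?_⟩
        · intro i
          exact Finset.orderEmbOfFin_mem S hS i
        · intro i
          exact Finset.orderEmbOfFin_mem S hS i
        · intro i j
          rfl)
    unfold goodCount
    omega
  · intro ε hε
    obtain ⟨ε', n', hε', hn', h⟩ := hb ε hε
    obtain ⟨j, hj⟩ := exists_nat_gt (2 / ε')
    obtain ⟨k0, hk0, hk⟩ := alpha_small j
    refine ⟨k0 + n', by omega, ?_⟩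
    intro n G k hkk hkn hfar
    have ha : 2 * alphak k < ε' := by
      have := hk k (by omega)
      have h2 : 2 * (1 / ((j : ℝ) + 1)) < ε' := by
        rw [mul_one_div, div_lt_iff₀ (by positivity)]
        rw [div_lt_iff₀ hε'] at hj
        nlinarith
      linarith
    refine le_trans (Nat.mul_le_mul_left 3 ?_) (Samp_alpha k n hkn G)
    unfold goodCount
    apply Set.ncard_le_ncard _ (Set.toFinite _)
    rintro S ⟨hS, H, ⟨m, hm, G0, hG0, hc⟩, f, hf, hfH⟩
    refine ⟨hS, ?_⟩
    intro hgood
    have hH : H = G.comap f := by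
      ext a b
      exact hfH a b
    subst hH
    have h3 := Cl.trans (gk_pker _) (gk_pker _) (gk_pker _) hc
      (Cl.symm (gk_pker _) (gk_pker _) (hgood f hf))
    have h4 := deltaCut_le_of_Cl (graphonOf_pker _) (graphonOf_pker _) h3
    have h5 := h m n G0 G hG0 (lt_of_le_of_lt h4 (by linarith)) (by omega) (by omega)
    exact absurd hfar (not_le.2 h5)

theorem b_to_c (P : GraphProp) (hb : CondB P) : CondC P := by
  intro ε hε
  obtain ⟨ε', n', hε', hn', h⟩ := hb ε hε
  refine ⟨ε', n', hε', hn', ?_⟩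
  rintro n m G G' hG ⟨f, _⟩ hd hm
  have : m ≤ n := by simpa using Fintype.card_le_of_embedding f
  exact h n m G G' hG hd (by omega) hm


/-! ## Induced densities -/

def pairs (k : ℕ) : Finset (Fin k × Fin k) := Finset.univ.filter fun e => e.1 < e.2

theorem mem_pairs {k : ℕ} {e : Fin k × Fin k} : e ∈ pairs k ↔ e.1 < e.2 := by simp [pairs]

open Classical in
def indK {k : ℕ} (F : SimpleGraph (Fin k)) (W : ℝ × ℝ → ℝ) (e : Fin k × Fin k) (z : ℝ × ℝ) : ℝ :=
  if F.Adj e.1 e.2 then W z else 1 - W z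

theorem indK_pker {k : ℕ} (F : SimpleGraph (Fin k)) {W : ℝ × ℝ → ℝ} (hW : PKer W) (e : Fin k × Fin k) :
    PKer (indK F W e) := by
  unfold indK
  by_cases h : F.Adj e.1 e.2
  · simpa [h] using hW
  · simp only [h, if_false]
    refine ⟨measurable_const.sub hW.1, fun z => ?_⟩
    have := hW.2 z
    exact ⟨by linarith [this.2], by linarith [this.1]⟩

theorem indK_cut {k : ℕ} (F : SimpleGraph (Fin k)) {W U : ℝ × ℝ → ℝ} (e : Fin k × Fin k)
    {α β : Measure ℝ} {r : ℝ} (h : CutBd α β (fun z => W z - U z) r) :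
    CutBd α β (fun z => indK F W e z - indK F U e z) r := by
  unfold indK
  by_cases hF : F.Adj e.1 e.2
  · simpa [hF] using h
  · simp only [hF, if_false]
    have := CutBd.neg h
    convert this using 2
    ring

/-- product over pairs is the indicator of an induced copy -/
theorem prod_indK {n k : ℕ} (G : SimpleGraph (Fin n)) (F : SimpleGraph (Fin k)) (y : Fin k → ℝ)
    (f : Fin k → Fin n) (hf : ∀ i, y i ∈ cell n (f i)) :
    (∏ e ∈ pairs k, indK F (gk G) e (y e.1, y e.2) ≠ 0 → G.comap f = F) ∧
    (G.comap f = F → ∏ e ∈ pairs k, indK F (gk G) e (y e.1, y e.2) = 1) := by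
  classical
  have hval : ∀ a b, gk G (y a, y b) = if G.Adj (f a) (f b) then 1 else 0 := by
    intro a b
    rw [gk, graphonOf_eq, stepK_mem (hf a) (hf b)]
    unfold adjR
    split_ifs <;> rfl
  constructor
  · intro h
    rw [Finset.prod_ne_zero_iff] at h
    have key : ∀ a b, a < b → (G.Adj (f a) (f b) ↔ F.Adj a b) := by
      intro a b hab
      have := h (a, b) (mem_pairs.2 hab)
      simp only [indK, hval] at this
      by_cases h1 : G.Adj (f a) (f b) <;> by_cases h2 : F.Adj a b <;> simp_all
    ext a b
    rw [SimpleGraph.comap_adj]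
    rcases lt_trichotomy a b with hab | hab | hab
    · exact key a b hab
    · subst hab
      simp
    · rw [SimpleGraph.adj_comm, F.adj_comm]
      exact key b a hab
  · rintro rfl
    apply Finset.prod_eq_one
    intro e _
    simp only [indK, hval, SimpleGraph.comap_adj]
    split_ifs <;> simp

theorem ae_pos_mu : ∀ᵐ x ∂mu, 0 < x ∧ x ≤ 1 := by
  have h1 : ∀ᵐ x ∂mu, x ≠ 0 := by
    have : ∀ᵐ x : ℝ ∂volume, x ≠ 0 := by
      simp [ae_iff]
    exact ae_restrict_of_ae this
  filter_upwards [h1, ae_mem_I01] with x hx hI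
  exact ⟨lt_of_le_of_ne hI.1 (Ne.symm hx), hI.2⟩

open Classical in
theorem dens_formula {n k : ℕ} (hn : 0 < n) (G : SimpleGraph (Fin n)) (F : SimpleGraph (Fin k)) (φ : InvMP) :
    ∫ x, ∏ e ∈ pairs k, indK F (twist φ (gk G)) e (x e.1, x e.2) ∂(Measure.pi fun _ : Fin k => mu) =
      ((Finset.univ.filter fun f : Fin k → Fin n => G.comap f = F).card : ℝ) / n ^ k := by
  have hae : ∀ᵐ x ∂(Measure.pi fun _ : Fin k => mu), ∀ i, 0 < φ.toFun (x i) ∧ φ.toFun (x i) ≤ 1 := by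
    rw [ae_all_iff]
    intro i
    have h1 : ∀ᵐ x ∂mu, 0 < φ.toFun x ∧ φ.toFun x ≤ 1 :=
      φ.measurePreserving.quasiMeasurePreserving.ae ae_pos_mu
    exact (Measure.quasiMeasurePreserving_eval (fun _ : Fin k => mu) i).ae h1
  have hIntg1 : ∀ a : Fin n, ∫ x, cind n a (φ.toFun x) ∂mu = 1 / n := by
    intro a
    have hmp : MeasurePreserving φ.toFun mu mu := φ.measurePreserving
    have h2 : ∫ x, cind n a (φ.toFun x) ∂mu = ∫ x, cind n a x ∂mu := by
      conv_rhs => rw [← hmp.map_eq]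
      rw [integral_map hmp.measurable.aemeasurable (cind_measurable n a).aestronglyMeasurable]
    rw [h2]
    unfold cind
    rw [integral_indicator_one (cell_measurable n a), mu_cell]
  have hIntg : ∀ f : Fin k → Fin n, Integrable (fun x : Fin k → ℝ => ∏ i, cind n (f i) (φ.toFun (x i)))
      (Measure.pi fun _ : Fin k => mu) := by
    intro f
    refine Integrable.of_bound (C := 1) ?_ (Eventually.of_forall fun x => ?_)
    · apply Measurable.aestronglyMeasurable
      apply Finset.measurable_fun_prod
      intro i _
      exact (cind_measurable n (f i)).comp (φ.measurePreserving.measurable.comp (measurable_pi_apply i))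
    · rw [norm_prod]
      apply Finset.prod_le_one
      · intro i _
        exact norm_nonneg _
      · intro i _
        unfold cind
        by_cases h : φ.toFun (x i) ∈ cell n (f i) <;> simp [h]
  have h1 : (fun x : Fin k → ℝ => ∏ e ∈ pairs k, indK F (twist φ (gk G)) e (x e.1, x e.2))
      =ᵐ[Measure.pi fun _ : Fin k => mu]
      fun x => ∑ f ∈ Finset.univ.filter (fun f : Fin k → Fin n => G.comap f = F),
        ∏ i, cind n (f i) (φ.toFun (x i)) := by
    filter_upwards [hae] with x hx
    choose f0 hf0 using fun i => exists_cell hn (hx i).1 (hx i).2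
    obtain ⟨p1, p2⟩ := prod_indK G F (fun i => φ.toFun (x i)) f0 hf0
    have e1 : ∏ e ∈ pairs k, indK F (twist φ (gk G)) e (x e.1, x e.2) =
      ∏ e ∈ pairs k, indK F (gk G) e (φ.toFun (x e.1), φ.toFun (x e.2)) := rfl
    rw [e1]
    have z : ∀ f : Fin k → Fin n, f ≠ f0 → ∏ i, cind n (f i) (φ.toFun (x i)) = 0 := by
      intro f hne
      obtain ⟨i, hi⟩ := Function.ne_iff.1 hne
      apply Finset.prod_eq_zero (Finset.mem_univ i)
      exact cind_not_mem fun hc => hi (cell_unique hc (hf0 i))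
    have o : ∏ i, cind n (f0 i) (φ.toFun (x i)) = 1 := Finset.prod_eq_one fun i _ => cind_mem (hf0 i)
    by_cases hc : G.comap f0 = F
    · rw [p2 hc, Finset.sum_eq_single f0 (fun f _ h => z f h)
        (fun h => absurd (by simpa using hc) h), o]
    · rw [not_ne_iff.1 (mt p1 hc), eq_comm]
      apply Finset.sum_eq_zero
      intro f hf
      apply z
      rintro rfl
      exact hc (Finset.mem_filter.1 hf).2
  rw [integral_congr_ae h1, integral_finsetSum _ (fun f _ => hIntg f)]
  have h2 : ∀ f : Fin k → Fin n, ∫ x, ∏ i, cind n (f i) (φ.toFun (x i)) ∂(Measure.pi fun _ : Fin k => mu) =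
      1 / n ^ k := by
    intro f
    rw [integral_fintype_prod_eq_prod (fun i x => cind n (f i) (φ.toFun x))]
    simp [hIntg1]
  simp only [h2, Finset.sum_const, nsmul_eq_mul]
  ring


/-! ## (a) implies (b) -/

theorem inducedMem_iff {n k : ℕ} (G : SimpleGraph (Fin n)) (S : Finset (Fin n)) (hS : S.card = k)
    {P : GraphProp} (hP : IsGraphProperty P) (f : Fin k ↪ Fin n) (hf : ∀ i, f i ∈ S) :
    inducedMem G S k P ↔ G.comap f ∈ P k := by
  constructor
  · rintro ⟨H, hH, g, hg, hgH⟩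
    have e : H = G.comap g := by
      ext a b
      exact hgH a b
    subst e
    obtain ⟨σ, hσ⟩ := emb_same_range hS f g hf hg
    exact (hP k _ _ (comap_iso G σ hσ)).2 hH
  · intro h
    exact ⟨_, h, f, hf, fun i j => Iff.rfl⟩

open Classical in
theorem goodCount_injs {n k : ℕ} (hkn : k ≤ n) (G : SimpleGraph (Fin n)) {P : GraphProp}
    (hP : IsGraphProperty P) :
    ((injs k n).card : ℝ) * goodCount G k P =
      n.choose k * ∑ u ∈ injs k n, if G.comap u ∈ P k then (1 : ℝ) else 0 := by
  set S0 : Finset (Fin n) := Finset.univ.map (Fin.castLEEmb hkn) with hS0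
  have hS0c : S0.card = k := by simp [hS0]
  have h1 := avg_subsets (fun S => if inducedMem G S k P then (1 : ℝ) else 0) hS0c
  have h2 := avg_injs (fun u => if G.comap u ∈ P k then (1 : ℝ) else 0)
    (Fin.castLEEmb hkn).injective
  have e1 : ∑ S ∈ Finset.powersetCard k (Finset.univ : Finset (Fin n)),
      (if inducedMem G S k P then (1 : ℝ) else 0) = goodCount G k P := by
    unfold goodCount
    have : {S : Finset (Fin n) | S.card = k ∧ inducedMem G S k P} =
      ((Finset.powersetCard k (Finset.univ : Finset (Fin n))).filter fun S => inducedMem G S k P : Set _) := by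
      ext S
      simp [Finset.mem_powersetCard]
    rw [this, Set.ncard_coe_finset, Finset.card_filter]
    push_cast
    rfl
  have e2 : ∀ σ : Equiv.Perm (Fin n), (if inducedMem G (S0.map σ.toEmbedding) k P then (1 : ℝ) else 0) =
      if G.comap (fun i => σ (Fin.castLEEmb hkn i)) ∈ P k then (1 : ℝ) else 0 := by
    intro σ
    have := inducedMem_iff G (S0.map σ.toEmbedding) (by simp [hS0c]) hP
      ((Fin.castLEEmb hkn).trans σ.toEmbedding) (by
            intro i
            rw [hS0, Finset.map_map]
            exact Finset.mem_map_of_mem _ (Finset.mem_univ _))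
    exact if_congr this rfl rfl
  simp only [e2] at h1
  rw [e1] at h1
  have hf : (n.factorial : ℝ) ≠ 0 := by exact_mod_cast n.factorial_pos.ne'
  apply mul_left_cancel₀ hf
  linear_combination -((injs k n).card : ℝ) * h1 + (n.choose k : ℝ) * h2

open Classical in
/-- the fraction of maps inducing a graph in `P` -/
def hfrac {n : ℕ} (k : ℕ) (G : SimpleGraph (Fin n)) (P : GraphProp) : ℝ :=
  (∑ u : Fin k → Fin n, if G.comap u ∈ P k then (1 : ℝ) else 0) / n ^ k

open Classical in
theorem hfrac_eq {n k : ℕ} (hn : 0 < n) (G : SimpleGraph (Fin n)) (P : GraphProp) (φ : InvMP) :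
    hfrac k G P = ∑ F ∈ Finset.univ.filter (fun F : SimpleGraph (Fin k) => F ∈ P k),
      ∫ x, ∏ e ∈ pairs k, indK F (twist φ (gk G)) e (x e.1, x e.2) ∂(Measure.pi fun _ : Fin k => mu) := by
  simp only [dens_formula hn]
  unfold hfrac
  rw [← Finset.sum_div]
  congr 1
  simp only [Finset.card_filter]
  push_cast
  rw [Finset.sum_comm]
  refine Finset.sum_congr rfl fun u _ => ?_
  rw [Finset.sum_ite_eq]
  simp

theorem hfrac_diff {n m k : ℕ} (hn : 0 < n) (hm : 0 < m) (G : SimpleGraph (Fin n)) (G' : SimpleGraph (Fin m))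
    (P : GraphProp) {r : ℝ} (h : Cl r (gk G) (gk G')) :
    |hfrac k G P - hfrac k G' P| ≤ Fintype.card (SimpleGraph (Fin k)) * ((pairs k).card * r) := by
  classical
  obtain ⟨φ, h⟩ := h
  have hr := h.nonneg
  rw [hfrac_eq hn G P InvMP.id, hfrac_eq hm G' P φ, ← Finset.sum_sub_distrib]
  refine (Finset.abs_sum_le_sum_abs _ _).trans ?_
  calc _ ≤ ∑ F ∈ Finset.univ.filter (fun F : SimpleGraph (Fin k) => F ∈ P k), ((pairs k).card * r : ℝ) := by
        refine Finset.sum_le_sum fun F _ => ?_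
        refine counting (fun _ : Fin k => mu) (pairs k) (fun e he => mem_pairs.1 he) _ _
          (fun e => indK_pker F (gk_pker G) e) (fun e => indK_pker F ((gk_pker G').twist φ) e) ?_
        intro e _
        exact indK_cut F e h
    _ ≤ _ := by
        rw [Finset.sum_const, nsmul_eq_mul]
        refine mul_le_mul_of_nonneg_right ?_ (by positivity)
        exact_mod_cast Finset.card_le_univ _

theorem hfrac_bounds {n k : ℕ} (hk : 1 ≤ k) (hkn : 12 * k ^ 2 < n) (G : SimpleGraph (Fin n)) {P : GraphProp}
    (hP : IsGraphProperty P) :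
    (2 * n.choose k ≤ 3 * goodCount G k P → 11 / 18 ≤ hfrac k G P) ∧
    (3 * goodCount G k P ≤ n.choose k → hfrac k G P ≤ 5 / 12) := by
  classical
  have hkn' : k ≤ n := by nlinarith
  have h0 := goodCount_injs hkn' G hP
  have hn : (0 : ℝ) < n := by exact_mod_cast (by omega : 0 < n)
  have hC : (0 : ℝ) < n.choose k := by exact_mod_cast Nat.choose_pos hkn'
  have hnk : (0 : ℝ) < (n : ℝ) ^ k := by positivity
  have h12 : 12 * (k : ℝ) ^ 2 ≤ n := by exact_mod_cast hkn.le
  have hni := noninj_le n k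
  have hni' : (n : ℝ) ^ k - (injs k n).card ≤ n ^ k / 12 := by
    have : (n : ℝ) * ((n : ℝ) ^ k - (injs k n).card) ≤ n * (n ^ k / 12) := by nlinarith
    exact le_of_mul_le_mul_left this hn
  have hs := sum_split_injs (fun u : Fin k → Fin n => if G.comap u ∈ P k then (1 : ℝ) else 0)
    (by intro u; split_ifs <;> norm_num)
  have hsub : ∑ u ∈ injs k n, (if G.comap u ∈ P k then (1 : ℝ) else 0) ≤
      ∑ u : Fin k → Fin n, if G.comap u ∈ P k then (1 : ℝ) else 0 :=
    Finset.sum_le_sum_of_subset_of_nonneg (Finset.subset_univ _) fun u _ _ => by split_ifs <;> norm_num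
  have hIle : ((injs k n).card : ℝ) ≤ n ^ k := by
    rw [card_injs]
    exact_mod_cast Nat.descFactorial_le_pow n k
  unfold hfrac
  set I := ∑ u ∈ injs k n, (if G.comap u ∈ P k then (1 : ℝ) else 0)
  set J := ∑ u : Fin k → Fin n, if G.comap u ∈ P k then (1 : ℝ) else 0
  set D : ℝ := ((injs k n).card : ℝ)
  have hD : 0 ≤ D := by positivity
  constructor
  · intro h
    have h' : 2 * (n.choose k : ℝ) ≤ 3 * goodCount G k P := by exact_mod_cast h
    have : (n.choose k : ℝ) * (2 * D) ≤ n.choose k * (3 * I) := by nlinarith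
    have := le_of_mul_le_mul_left this hC
    rw [le_div_iff₀ hnk]
    linarith
  · intro h
    have h' : 3 * (goodCount G k P : ℝ) ≤ n.choose k := by exact_mod_cast h
    have : (n.choose k : ℝ) * (3 * I) ≤ n.choose k * D := by nlinarith
    have := le_of_mul_le_mul_left this hC
    rw [div_le_iff₀ hnk]
    have := (abs_le.1 hs).2
    linarith

theorem a_to_b (P : GraphProp) (ha : GraphTestable P) : CondB P := by
  obtain ⟨P', hP', h1, h2⟩ := ha
  intro ε hε
  obtain ⟨k, hk, h2⟩ := h2 ε hε
  set A : ℝ := (Fintype.card (SimpleGraph (Fin k)) : ℝ) * (pairs k).card with hA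
  have hA0 : 0 ≤ A := by positivity
  refine ⟨1 / (6 * (A + 1)), 12 * k ^ 2 + 1, by positivity, by positivity, ?_⟩
  intro n m G G' hG hd hn hm
  by_contra hc
  rw [not_lt] at hc
  have hkk : k ≤ k ^ 2 := by nlinarith
  have b1 := (hfrac_bounds hk (by omega) G hP').1 (h1 n G hG k hk (by omega))
  have b2 := (hfrac_bounds hk (by omega) G' hP').2 (h2 m G' k le_rfl (by omega) hc)
  have b3 := hfrac_diff (k := k) (by omega) (by omega) G G' P'
    (Cl.of_deltaCut (graphonOf_pker _) (graphonOf_pker _) hd)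
  have b4 := (abs_le.1 b3).2
  rw [← mul_assoc, ← hA] at b4
  have : A * (1 / (6 * (A + 1))) ≤ 1 / 6 := by
    rw [mul_one_div, div_le_iff₀ (by positivity)]
    linarith
  linarith


/-! ## Compactness for graph sequences -/

theorem finite_net (ε : ℝ) (hε : 0 < ε) : ∃ (Ω : Type) (_ : Finite Ω) (R : Ω → ℝ × ℝ → ℝ) (N : ℕ),
    (∀ ω, PKer (R ω)) ∧ ∀ n, N ≤ n → ∀ G : SimpleGraph (Fin n), ∃ ω, Cl ε (gk G) (R ω) := by
  obtain ⟨K0, q, N, hq, hN, hreg⟩ := weak_reg (ε / 2) (by positivity)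
  obtain ⟨M, hM⟩ := exists_nat_gt (8 * (K0 : ℝ) ^ 2 / ε)
  have hq' : (0 : ℝ) < q := by exact_mod_cast hq
  have hd : ∀ (K : ℕ) (d : Fin K → Fin K → Fin (q + 1)) i j,
      ((d i j : ℕ) : ℝ) / q ∈ Set.Icc (0 : ℝ) 1 := by
    intro K d i j
    refine ⟨by positivity, ?_⟩
    rw [div_le_one hq']
    have := (d i j).2
    exact_mod_cast (by omega : ((d i j : Fin (q + 1)) : ℕ) ≤ q)
  refine ⟨Σ K : Fin (K0 + 1), (Fin K → Fin K → Fin (q + 1)), inferInstance,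
    fun ω => stepK ω.1 (fun i j => ((ω.2 i j : ℕ) : ℝ) / q), N + M + 1, ?_, ?_⟩
  · intro ω
    exact stepK_pker (hd _ ω.2)
  · intro n hn G
    obtain ⟨K, hK, hKK, p, d, h1, h2⟩ := hreg n (by omega) G
    refine ⟨⟨⟨K, by omega⟩, d⟩, ?_⟩
    have hn' : (0 : ℝ) < n := by exact_mod_cast (by omega : 0 < n)
    have hMn : (M : ℝ) ≤ n := by exact_mod_cast (by omega : M ≤ n)
    have hKK' : (K : ℝ) ≤ K0 := by exact_mod_cast hKK
    rw [gk, graphonOf_eq]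
    have := close_to_step (by omega) hK (adjR_mem G) p (fun i j => ((d i j : ℕ) : ℝ) / q) (hd K d)
      (ε := ε / 2) (η := 1 / n) (by positivity) (by positivity) h1 (by
        intro i
        rw [one_div, inv_mul_cancel₀ hn'.ne']
        exact h2 i)
    refine this.mono ?_
    have v1 : 4 * (K:ℝ) ^ 2 * (1 / n) ≤ 4 * (K0 : ℝ) ^ 2 * (1 / n) := by gcongr
    have v2 : 4 * (K0 : ℝ) ^ 2 * (1 / n) ≤ ε / 2 := by
      rw [mul_one_div, div_le_iff₀ hn']
      rw [div_lt_iff₀ hε] at hM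
      nlinarith
    linarith

theorem compactness (m : ℕ → ℕ) (hm : ∀ i, i + 1 ≤ m i) (G : ∀ i, SimpleGraph (Fin (m i))) :
    ∃ (s : ℕ → ℕ) (Φ : ℕ → InvMP) (W : ℝ × ℝ → ℝ), (∀ j, j ≤ s j) ∧ PKer W ∧
      (∀ j, CutBd mu mu (fun z => twist (Φ j) (gk (G (s j))) z - W z) (4 * (1 / 2) ^ j)) ∧
      ∀ E : Set (ℝ × ℝ), MeasurableSet E →
        Tendsto (fun j => ∫ z in E, twist (Φ j) (gk (G (s j))) z ∂(mu.prod mu))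
          (hyperfilter ℕ : Filter ℕ) (𝓝 (∫ z in E, W z ∂(mu.prod mu))) := by
  have hR : ∀ j : ℕ, ∃ R : ℝ × ℝ → ℝ, PKer R ∧
      ∀ᶠ i in (hyperfilter ℕ : Filter ℕ), Cl ((1 / 2) ^ j) (gk (G i)) R := by
    intro j
    obtain ⟨Ω, hΩ, R, N, hR, hnet⟩ := finite_net ((1 / 2 : ℝ) ^ j) (by positivity)
    have h1 : (⋃ ω ∈ (Set.univ : Set Ω), {i | Cl ((1 / 2) ^ j) (gk (G i)) (R ω)}) ∈ hyperfilter ℕ := by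
      have : ∀ᶠ i in (hyperfilter ℕ : Filter ℕ), N ≤ i :=
        (Nat.hyperfilter_le_atTop) (eventually_ge_atTop N)
      refine Filter.mem_of_superset this ?_
      intro i hi
      obtain ⟨ω, hω⟩ := hnet (m i) (le_trans hi (by have := hm i; omega)) (G i)
      simp only [Set.mem_iUnion]
      exact ⟨ω, Set.mem_univ _, hω⟩
    rw [Ultrafilter.finite_biUnion_mem_iff Set.finite_univ] at h1
    obtain ⟨ω, _, hω⟩ := h1
    exact ⟨R ω, hR ω, hω⟩
  choose R hRp hRe using hR
  have hs : ∀ j : ℕ, ∃ i, j ≤ i ∧ ∀ l ∈ Finset.range (j + 1), Cl ((1 / 2) ^ l) (gk (G i)) (R l) := by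
    intro j
    have h1 : ∀ᶠ i in (hyperfilter ℕ : Filter ℕ), j ≤ i :=
      (Nat.hyperfilter_le_atTop) (eventually_ge_atTop j)
    have h2 : ∀ᶠ i in (hyperfilter ℕ : Filter ℕ), ∀ l ∈ Finset.range (j + 1),
        Cl ((1 / 2) ^ l) (gk (G i)) (R l) := by
      rw [Filter.eventually_all_finset]
      intro l _
      exact hRe l
    exact (h1.and h2).exists
  choose s hs1 hs2 using hs
  have hcons : ∀ j, Cl (2 * (1 / 2) ^ j) (gk (G (s j))) (gk (G (s (j + 1)))) := by
    intro j
    have a := hs2 j j (by simp)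
    have b := hs2 (j + 1) j (by simp)
    exact (Cl.trans (gk_pker _) (hRp j) (gk_pker _) a (Cl.symm (gk_pker _) (hRp j) b)).mono (by linarith)
  choose φ hφ using hcons
  let Φ : ℕ → InvMP := fun j => Nat.rec InvMP.id (fun j ψ => (φ j).comp ψ) j
  have hΦ : ∀ j, Φ (j + 1) = (φ j).comp (Φ j) := fun j => rfl
  set V : ℕ → ℝ × ℝ → ℝ := fun j => twist (Φ j) (gk (G (s j))) with hV
  have hVp : ∀ j, PKer (V j) := fun j => (gk_pker _).twist _
  have hstep : ∀ j, CutBd mu mu (fun z => V j z - V (j + 1) z) (2 * (1 / 2) ^ j) := by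
    intro j
    have := CutBd.twist ((gk_pker (G (s j))).sub ((gk_pker (G (s (j + 1)))).twist (φ j))) (hφ j) (Φ j)
    simp only [hV, hΦ, twist_comp]
    exact this
  have hadd : ∀ i d, CutBd mu mu (fun z => V i z - V (i + d) z) (4 * (1 / 2) ^ i - 4 * (1 / 2) ^ (i + d)) := by
    intro i d
    induction d with
    | zero =>
      intro S T _ _
      simp
    | succ d ih =>
      have := CutBd.trans (hVp i) (hVp (i + d)) (hVp (i + d + 1)) ih (hstep (i + d))
      refine this.mono (le_of_eq ?_)
      rw [← add_assoc, pow_succ (1 / 2 : ℝ) (i + d)]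
      ring
  have hc : ∀ i j, i ≤ j → CutBd mu mu (fun z => V i z - V j z) (4 * (1 / 2) ^ i) := by
    intro i j hij
    obtain ⟨d, rfl⟩ := Nat.exists_eq_add_of_le hij
    refine (hadd i d).mono ?_
    have : (0 : ℝ) ≤ 4 * (1 / 2) ^ (i + d) := by positivity
    linarith
  obtain ⟨W, hW, h1, h2⟩ := cauchy_limit V hVp _ hc
  exact ⟨s, Φ, W, hs1, hW, h1, h2⟩


/-! ## Editing a graph so that it is compatible with the limit -/

/-- uniform measure on the part of vertex `a` -/
def nu (n : ℕ) (Φ : InvMP) (a : Fin n) : Measure ℝ :=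
  (n : ℝ≥0∞) • mu.restrict (Φ.toFun ⁻¹' cell n a)

theorem part_measurable (n : ℕ) (Φ : InvMP) (a : Fin n) : MeasurableSet (Φ.toFun ⁻¹' cell n a) :=
  Φ.measurePreserving.measurable (cell_measurable n a)

theorem mu_part {n : ℕ} (Φ : InvMP) (a : Fin n) : mu (Φ.toFun ⁻¹' cell n a) = ENNReal.ofReal (1 / n) := by
  have h : MeasurePreserving Φ.toFun mu mu := Φ.measurePreserving
  rw [h.measure_preimage (cell_measurable n a).nullMeasurableSet]
  have h2 := mu_cell a
  rw [← h2, Measure.real, ENNReal.ofReal_toReal (measure_ne_top _ _)]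

instance nu_prob (n : ℕ) (Φ : InvMP) (a : Fin n) : IsProbabilityMeasure (nu n Φ a) := by
  constructor
  have hn := cell_npos a
  rw [nu, Measure.smul_apply, Measure.restrict_apply_univ, mu_part, smul_eq_mul]
  rw [← ENNReal.ofReal_natCast, ← ENNReal.ofReal_mul hn.le]
  rw [mul_one_div, div_self hn.ne']
  simp

theorem nu_prod {n : ℕ} (Φ : InvMP) (a b : Fin n) : (nu n Φ a).prod (nu n Φ b) =
    ((n : ℝ≥0∞) * n) • (mu.prod mu).restrict ((Φ.toFun ⁻¹' cell n a) ×ˢ (Φ.toFun ⁻¹' cell n b)) := by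
  unfold nu
  rw [Measure.prod_smul_left, Measure.prod_smul_right, Measure.prod_restrict, smul_smul]

theorem integral_nu_prod {n : ℕ} (Φ : InvMP) (a b : Fin n) (Q : ℝ × ℝ → ℝ) :
    ∫ z, Q z ∂((nu n Φ a).prod (nu n Φ b)) =
      n ^ 2 * ∫ z in (Φ.toFun ⁻¹' cell n a) ×ˢ (Φ.toFun ⁻¹' cell n b), Q z ∂(mu.prod mu) := by
  rw [nu_prod, integral_smul_measure]
  simp [sq]

theorem CutBd.nu {n : ℕ} (Φ : InvMP) (a b : Fin n) {D : ℝ × ℝ → ℝ} {r : ℝ} (h : CutBd mu mu D r) :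
    CutBd (nu n Φ a) (nu n Φ b) D (n ^ 2 * r) := by
  intro S T hS hT
  rw [nu_prod, Measure.restrict_smul, integral_smul_measure, Measure.restrict_restrict (hS.prod hT),
    Set.prod_inter_prod]
  have := h _ _ (hS.inter (part_measurable n Φ a)) (hT.inter (part_measurable n Φ b))
  rw [smul_eq_mul, abs_mul]
  have e : |((n : ℝ≥0∞) * n).toReal| = (n : ℝ) ^ 2 := by
    simp [sq]
  rw [e]
  exact mul_le_mul_of_nonneg_left this (by positivity)

theorem integral_marginal {ι : Type} [Fintype ι] [DecidableEq ι] (ν : ι → Measure ℝ)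
    [∀ i, IsProbabilityMeasure (ν i)] {a b : ι} (hab : a ≠ b) {Q : ℝ × ℝ → ℝ} (hQ : BKer Q) :
    ∫ x, Q (x a, x b) ∂(Measure.pi ν) = ∫ z, Q z ∂((ν a).prod (ν b)) := by
  rw [integral_resample ν a b (Q := fun x => Q (x a, x b))
    (hQ.1.comp ((measurable_pi_apply _).prodMk (measurable_pi_apply _))) (fun x => hQ.2 _)]
  have : ∀ (x : ι → ℝ) (z : ℝ × ℝ), Q (Function.update (Function.update x a z.1) b z.2 a,
      Function.update (Function.update x a z.1) b z.2 b) = Q z := by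
    intro x z
    rw [Function.update_self, Function.update_of_ne hab, Function.update_self]
  simp only [this]
  simp

/-- the density of forced edits -/
def edg {n : ℕ} (Φ : InvMP) (H : SimpleGraph (Fin n)) (W : ℝ × ℝ → ℝ) (z : ℝ × ℝ) : ℝ :=
  {z | W z = 0}.indicator (twist Φ (gk H)) z + {z | W z = 1}.indicator (fun z => 1 - twist Φ (gk H) z) z

theorem edg_pker {n : ℕ} (Φ : InvMP) (H : SimpleGraph (Fin n)) {W : ℝ × ℝ → ℝ} (hW : PKer W) :
    PKer (edg Φ H W) := by
  have hV := (gk_pker H).twist Φ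
  have m0 : MeasurableSet {z | W z = 0} := hW.1 (measurableSet_singleton 0)
  have m1 : MeasurableSet {z | W z = 1} := hW.1 (measurableSet_singleton 1)
  refine ⟨(hV.1.indicator m0).add ((measurable_const.sub hV.1).indicator m1), fun z => ?_⟩
  have := hV.2 z
  unfold edg
  by_cases h0 : W z = 0
  · have h1 : W z ≠ 1 := by rw [h0]; norm_num
    rw [Set.indicator_of_mem (show z ∈ {z | W z = 0} from h0),
      Set.indicator_of_notMem (show z ∉ {z | W z = 1} from h1), add_zero]
    exact this
  · rw [Set.indicator_of_notMem (show z ∉ {z | W z = 0} from h0), zero_add]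
    by_cases h1 : W z = 1
    · rw [Set.indicator_of_mem (show z ∈ {z | W z = 1} from h1)]
      exact ⟨by linarith [this.2], by linarith [this.1]⟩
    · rw [Set.indicator_of_notMem (show z ∉ {z | W z = 1} from h1)]
      exact ⟨le_rfl, zero_le_one⟩

/-- symmetrization of a relation on pairs -/
def mkG {n : ℕ} (R : Fin n → Fin n → Prop) : SimpleGraph (Fin n) where
  Adj a b := (a < b ∧ R a b) ∨ (b < a ∧ R b a)
  symm := ⟨fun a b h => h.symm⟩
  loopless := ⟨fun a h => by simp at h⟩

theorem mkG_adj {n : ℕ} (R : Fin n → Fin n → Prop) {a b : Fin n} (h : a < b) :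
    (mkG R).Adj a b ↔ R a b := by
  unfold mkG
  simp [h, not_lt.2 h.le]

open Classical in
theorem edit_graph {n : ℕ} (H : SimpleGraph (Fin n)) (Φ : InvMP) {W : ℝ × ℝ → ℝ} (hW : PKer W)
    {η : ℝ} (hη : ∫ z, edg Φ H W z ∂(mu.prod mu) ≤ η) :
    ∃ F : SimpleGraph (Fin n),
      (((pairs n).filter fun e => ¬ (F.Adj e.1 e.2 ↔ H.Adj e.1 e.2)).card : ℝ) ≤ η * n ^ 2 ∧
      0 < ∫ x, ∏ e ∈ pairs n, indK F W e (x e.1, x e.2) ∂(Measure.pi (nu n Φ)) := by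
  have hg := edg_pker Φ H hW
  set Ch : Fin n × Fin n → Set (ℝ × ℝ) := fun e =>
    {z | (W z = 0 ∧ H.Adj e.1 e.2) ∨ (W z = 1 ∧ ¬ H.Adj e.1 e.2)} with hCh
  have mCh : ∀ e, MeasurableSet (Ch e) := by
    intro e
    have m0 : MeasurableSet {z | W z = 0} := hW.1 (measurableSet_singleton 0)
    have m1 : MeasurableSet {z | W z = 1} := hW.1 (measurableSet_singleton 1)
    exact (m0.inter (MeasurableSet.const _)).union (m1.inter (MeasurableSet.const _))
  have kCh : ∀ e, BKer ((Ch e).indicator (fun _ => (1 : ℝ))) := by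
    intro e
    refine ⟨measurable_const.indicator (mCh e), fun z => ?_⟩
    by_cases h : z ∈ Ch e <;> simp [h]
  let Fx : (Fin n → ℝ) → SimpleGraph (Fin n) := fun x =>
    mkG fun a b => if W (x a, x b) = 0 then False else if W (x a, x b) = 1 then True else H.Adj a b
  have hFx : ∀ x, ∀ e ∈ pairs n, 0 < indK (Fx x) W e (x e.1, x e.2) := by
    intro x e he
    have hw := hW.2 (x e.1, x e.2)
    simp only [indK, Fx]
    rw [mkG_adj _ (mem_pairs.1 he)]
    by_cases h0 : W (x e.1, x e.2) = 0
    · simp [h0]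
    · by_cases h1 : W (x e.1, x e.2) = 1
      · simp [h1]
      · simp only [h0, h1, if_false]
        have p0 : 0 < W (x e.1, x e.2) := lt_of_le_of_ne hw.1 (Ne.symm h0)
        have p1 : W (x e.1, x e.2) < 1 := lt_of_le_of_ne hw.2 h1
        split_ifs <;> linarith
  let N : (Fin n → ℝ) → ℝ := fun x => ∑ e ∈ pairs n, (Ch e).indicator (fun _ => (1 : ℝ)) (x e.1, x e.2)
  have hN : ∀ x, (((pairs n).filter fun e => ¬ ((Fx x).Adj e.1 e.2 ↔ H.Adj e.1 e.2)).card : ℝ) ≤ N x := by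
    intro x
    rw [Finset.card_filter]
    push_cast
    refine Finset.sum_le_sum fun e he => ?_
    by_cases hc : (x e.1, x e.2) ∈ Ch e
    · rw [Set.indicator_of_mem hc]
      split_ifs <;> norm_num
    · rw [Set.indicator_of_notMem hc]
      have : (Fx x).Adj e.1 e.2 ↔ H.Adj e.1 e.2 := by
        simp only [Fx]
        rw [mkG_adj _ (mem_pairs.1 he)]
        simp only [hCh, Set.mem_ofPred_eq, not_or, not_and, not_not] at hc
        by_cases h0 : W (x e.1, x e.2) = 0
        · simp [h0, hc.1 h0]
        · by_cases h1 : W (x e.1, x e.2) = 1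
          · simp [h1, hc.2 h1]
          · simp [h0, h1]
      simp [this]
  have hNi : ∀ e, Integrable (fun x : Fin n → ℝ => (Ch e).indicator (fun _ => (1 : ℝ)) (x e.1, x e.2))
      (Measure.pi (nu n Φ)) := by
    intro e
    refine Integrable.of_bound (C := 1) ?_ (Eventually.of_forall fun x => (kCh e).2 _)
    exact ((kCh e).1.comp ((measurable_pi_apply _).prodMk (measurable_pi_apply _))).aestronglyMeasurable
  have hNint : Integrable N (Measure.pi (nu n Φ)) := integrable_finsetSum _ fun e _ => hNi e
  have hNb : ∫ x, N x ∂(Measure.pi (nu n Φ)) ≤ η * n ^ 2 := by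
    rw [integral_finsetSum _ fun e _ => hNi e]
    set A : Fin n × Fin n → Set (ℝ × ℝ) := fun e => (Φ.toFun ⁻¹' cell n e.1) ×ˢ (Φ.toFun ⁻¹' cell n e.2)
      with hA
    have mA : ∀ e, MeasurableSet (A e) := fun e => (part_measurable n Φ e.1).prod (part_measurable n Φ e.2)
    have h1 : ∀ e ∈ pairs n, ∫ x : Fin n → ℝ, (Ch e).indicator (fun _ => (1 : ℝ)) (x e.1, x e.2)
        ∂(Measure.pi (nu n Φ)) = n ^ 2 * ∫ z in A e, edg Φ H W z ∂(mu.prod mu) := by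
      intro e he
      rw [integral_marginal (nu n Φ) (mem_pairs.1 he).ne (kCh e), integral_nu_prod]
      congr 1
      refine setIntegral_congr_fun (mA e) ?_
      intro z hz
      have hv : twist Φ (gk H) z = if H.Adj e.1 e.2 then 1 else 0 := by
        unfold twist
        rw [gk, graphonOf_eq, stepK_mem hz.1 hz.2]
        rfl
      simp only [edg]
      by_cases h0 : W z = 0
      · have h1 : W z ≠ 1 := by rw [h0]; norm_num
        rw [Set.indicator_of_mem (show z ∈ {z | W z = 0} from h0),
          Set.indicator_of_notMem (show z ∉ {z | W z = 1} from h1), add_zero, hv]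
        by_cases hh : H.Adj e.1 e.2
        · rw [Set.indicator_of_mem (show z ∈ Ch e from Or.inl ⟨h0, hh⟩), if_pos hh]
        · rw [Set.indicator_of_notMem (show z ∉ Ch e from ?_), if_neg hh]
          rintro (h | h)
          · exact hh h.2
          · exact h1 h.1
      · rw [Set.indicator_of_notMem (show z ∉ {z | W z = 0} from h0), zero_add]
        by_cases h1 : W z = 1
        · rw [Set.indicator_of_mem (show z ∈ {z | W z = 1} from h1), hv]
          by_cases hh : H.Adj e.1 e.2
          · rw [Set.indicator_of_notMem (show z ∉ Ch e from ?_), if_pos hh, sub_self]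
            rintro (h | h)
            · exact h0 h.1
            · exact h.2 hh
          · rw [Set.indicator_of_mem (show z ∈ Ch e from Or.inr ⟨h1, hh⟩), if_neg hh, sub_zero]
        · rw [Set.indicator_of_notMem (show z ∉ {z | W z = 1} from h1),
            Set.indicator_of_notMem (show z ∉ Ch e from ?_)]
          rintro (h | h)
          · exact h0 h.1
          · exact h1 h.1
    rw [Finset.sum_congr rfl h1, ← Finset.mul_sum, ← integral_biUnion_finset (pairs n) (fun e _ => mA e)]
    · have : ∫ z in ⋃ e ∈ pairs n, A e, edg Φ H W z ∂(mu.prod mu) ≤ ∫ z, edg Φ H W z ∂(mu.prod mu) :=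
        setIntegral_le_integral (hg.bker.integrable _) (Eventually.of_forall fun z => (hg.2 z).1)
      nlinarith [sq_nonneg (n : ℝ)]
    · intro e _ e' _ hne
      rw [Function.onFun, Set.disjoint_left]
      rintro z ⟨hz1, hz2⟩ ⟨hz1', hz2'⟩
      exact hne (Prod.ext (cell_unique hz1 hz1') (cell_unique hz2 hz2'))
    · intro e _
      exact (hg.bker.integrable _).integrableOn
  have hpos := measure_le_integral_pos hNint
  have hun : (⋃ F : SimpleGraph (Fin n), {x | N x ≤ ∫ x, N x ∂(Measure.pi (nu n Φ)) ∧ Fx x = F}) =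
      {x | N x ≤ ∫ x, N x ∂(Measure.pi (nu n Φ))} := by
    ext x
    simp
  rw [← hun] at hpos
  obtain ⟨F, hF⟩ := exists_measure_pos_of_not_measure_iUnion_null hpos.ne'
  refine ⟨F, ?_, ?_⟩
  · obtain ⟨x, hx1, hx2⟩ := nonempty_of_measure_ne_zero hF.ne'
    have := hN x
    rw [hx2] at this
    linarith
  · rw [integral_pos_iff_support_of_nonneg]
    · refine lt_of_lt_of_le hF (measure_mono ?_)
      rintro x ⟨_, rfl⟩
      exact (Finset.prod_pos fun e he => hFx x e he).ne'
    · intro x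
      exact (prod_kernel_mem (pairs n) _ (fun e => indK_pker F hW e) x).1
    · refine Integrable.of_bound (C := 1)
        (prod_kernel_measurable (pairs n) _ (fun e => indK_pker F hW e)).aestronglyMeasurable
        (Eventually.of_forall fun x => ?_)
      have := prod_kernel_mem (pairs n) _ (fun e => indK_pker F hW e) x
      rw [Real.norm_eq_abs, abs_of_nonneg this.1]
      exact this.2


/-! ## Finding an induced copy -/

theorem same_integral {N : ℕ} (hN : 0 < N) :
    ∫ z, stepK N (fun i j => if i = j then (1 : ℝ) else 0) z ∂(mu.prod mu) = 1 / N := by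
  have h := integral_stepK (n := N) (fun i j => if i = j then (1 : ℝ) else 0) Set.univ Set.univ
  rw [Set.univ_prod_univ, Measure.restrict_univ] at h
  rw [h]
  have hN' : (N : ℝ) ≠ 0 := by positivity
  simp only [Set.univ_inter, mu_cell, ite_mul, one_mul, zero_mul, Finset.sum_ite_eq, Finset.mem_univ, if_true]
  simp
  field_simp

theorem nu_ac (n : ℕ) (Φ : InvMP) (a : Fin n) : nu n Φ a ≪ mu := by
  unfold nu
  exact (Measure.smul_absolutelyContinuous).trans Measure.absolutelyContinuous_restrict

theorem pair_le_sum {n : ℕ} {Q : ℝ × ℝ → ℝ} (hQ : PKer Q) (x : Fin n → ℝ) {a b : Fin n} (hab : a < b) :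
    Q (x a, x b) ≤ ∑ e ∈ pairs n, Q (x e.1, x e.2) := by
  have h : (a, b) ∈ pairs n := mem_pairs.2 hab
  have h2 : ∀ e ∈ pairs n, 0 ≤ Q (x e.1, x e.2) := fun e _ => (hQ.2 _).1
  exact Finset.single_le_sum h2 h

theorem find_copy {n N : ℕ} (hN : 0 < N) (F : SimpleGraph (Fin n)) (Φ ψ : InvMP) {W : ℝ × ℝ → ℝ} (hW : PKer W)
    (G : SimpleGraph (Fin N)) {r : ℝ} (hr : CutBd mu mu (fun z => twist ψ (gk G) z - W z) r)
    (hc : ((pairs n).card : ℝ) * (n ^ 2 * r) + (pairs n).card * (n ^ 2 / N) <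
      ∫ x, ∏ e ∈ pairs n, indK F W e (x e.1, x e.2) ∂(Measure.pi (nu n Φ))) :
    IsInducedSubgraph G F := by
  classical
  have hV := (gk_pker G).twist ψ
  have hcount := counting (nu n Φ) (pairs n) (fun e he => mem_pairs.1 he)
    (fun e => indK F (twist ψ (gk G)) e) (fun e => indK F W e)
    (fun e => indK_pker F hV e) (fun e => indK_pker F hW e)
    (fun e _ => indK_cut F e (hr.nu Φ e.1 e.2))
  have hS : PKer (stepK N (fun i j => if i = j then (1 : ℝ) else 0)) := by
    apply stepK_pker
    intro a b
    split_ifs <;> simp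
  have hS2 := hS.twist ψ
  set Sm : ℝ × ℝ → ℝ := twist ψ (stepK N (fun i j => if i = j then (1 : ℝ) else 0)) with hSm
  have hSi : ∀ e : Fin n × Fin n, Integrable (fun x : Fin n → ℝ => Sm (x e.1, x e.2)) (Measure.pi (nu n Φ)) := by
    intro e
    refine Integrable.of_bound (C := 1) ?_ (Eventually.of_forall fun x => hS2.bker.2 _)
    exact (hS2.1.comp ((measurable_pi_apply _).prodMk (measurable_pi_apply _))).aestronglyMeasurable
  have hSb : ∀ e ∈ pairs n, ∫ x : Fin n → ℝ, Sm (x e.1, x e.2) ∂(Measure.pi (nu n Φ)) ≤ n ^ 2 / N := by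
    intro e he
    rw [integral_marginal (nu n Φ) (mem_pairs.1 he).ne hS2.bker, integral_nu_prod, div_eq_mul_one_div]
    refine mul_le_mul_of_nonneg_left ?_ (by positivity)
    rw [← same_integral hN, ← integral_twist ψ hS.1]
    exact setIntegral_le_integral (hS2.bker.integrable _) (Eventually.of_forall fun z => (hS2.2 z).1)
  have hPi : Integrable (fun x : Fin n → ℝ => ∏ e ∈ pairs n, indK F (twist ψ (gk G)) e (x e.1, x e.2))
      (Measure.pi (nu n Φ)) := by
    refine Integrable.of_bound (C := 1)
        (prod_kernel_measurable (pairs n) _ (fun e => indK_pker F hV e)).aestronglyMeasurable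
        (Eventually.of_forall fun x => ?_)
    have := prod_kernel_mem (pairs n) _ (fun e => indK_pker F hV e) x
    rw [Real.norm_eq_abs, abs_of_nonneg this.1]
    exact this.2
  have hSumi : Integrable (fun x : Fin n → ℝ => ∑ e ∈ pairs n, Sm (x e.1, x e.2)) (Measure.pi (nu n Φ)) :=
    integrable_finsetSum _ fun e _ => hSi e
  have hpos : 0 < ∫ x, (∏ e ∈ pairs n, indK F (twist ψ (gk G)) e (x e.1, x e.2) -
      ∑ e ∈ pairs n, Sm (x e.1, x e.2)) ∂(Measure.pi (nu n Φ)) := by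
    rw [integral_sub hPi hSumi, integral_finsetSum _ fun e _ => hSi e]
    have h1 : ∑ e ∈ pairs n, ∫ x : Fin n → ℝ, Sm (x e.1, x e.2) ∂(Measure.pi (nu n Φ)) ≤
        (pairs n).card * (n ^ 2 / N) := by
      refine (Finset.sum_le_sum hSb).trans ?_
      rw [Finset.sum_const, nsmul_eq_mul]
    have h2 := (abs_le.1 hcount).1
    linarith
  have hae : ∀ᵐ x ∂(Measure.pi (nu n Φ)), ∀ i, 0 < ψ.toFun (x i) ∧ ψ.toFun (x i) ≤ 1 := by
    rw [ae_all_iff]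
    intro i
    have h1 : ∀ᵐ x ∂mu, 0 < ψ.toFun x ∧ ψ.toFun x ≤ 1 :=
      ψ.measurePreserving.quasiMeasurePreserving.ae ae_pos_mu
    exact (Measure.quasiMeasurePreserving_eval (nu n Φ) i).ae ((nu_ac n Φ i).ae_le h1)
  have : ∃ x : Fin n → ℝ, (∀ i, 0 < ψ.toFun (x i) ∧ ψ.toFun (x i) ≤ 1) ∧
      0 < ∏ e ∈ pairs n, indK F (twist ψ (gk G)) e (x e.1, x e.2) - ∑ e ∈ pairs n, Sm (x e.1, x e.2) := by
    by_contra hcon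
    push Not at hcon
    refine absurd hpos (not_lt.2 ?_)
    apply integral_nonpos_of_ae
    filter_upwards [hae] with x hx using hcon x hx
  obtain ⟨x, hx, hlt⟩ := this
  choose f hf using fun i => exists_cell hN (hx i).1 (hx i).2
  obtain ⟨p1, _⟩ := prod_indK G F (fun i => ψ.toFun (x i)) f hf
  have hle := (prod_kernel_mem (pairs n) _ (fun e => indK_pker F hV e) x).2
  have hs0 : 0 ≤ ∑ e ∈ pairs n, Sm (x e.1, x e.2) := Finset.sum_nonneg fun e _ => (hS2.2 _).1
  have hcomap : G.comap f = F := p1 (by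
    have e1 : ∏ e ∈ pairs n, indK F (twist ψ (gk G)) e (x e.1, x e.2) =
      ∏ e ∈ pairs n, indK F (gk G) e (ψ.toFun (x e.1), ψ.toFun (x e.2)) := rfl
    rw [← e1]
    exact (by linarith : (0 : ℝ) < _).ne')
  have hne : ∀ a b, a < b → f a ≠ f b := by
    intro a b hab heq
    have h1 : Sm (x a, x b) ≤ ∑ e ∈ pairs n, Sm (x e.1, x e.2) :=
      pair_le_sum hS2 x hab
    have h2 : Sm (x a, x b) = 1 := by
      rw [hSm]
      exact (stepK_mem (hf a) (hf b)).trans (if_pos heq)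
    linarith
  refine ⟨⟨f, fun a b hab => ?_⟩, fun i j => ?_⟩
  · rcases lt_trichotomy a b with h | h | h
    · exact absurd hab (hne a b h)
    · exact h
    · exact absurd hab.symm (hne b a h)
  · rw [← hcomap]
    rfl


/-! ## Effect of editing -/

open Classical in
theorem edit_sum {n : ℕ} (F H : SimpleGraph (Fin n)) :
    ∑ a : Fin n, ∑ b : Fin n, |adjR F a b - adjR H a b| ≤
      2 * (((pairs n).filter fun e => ¬ (F.Adj e.1 e.2 ↔ H.Adj e.1 e.2)).card : ℝ) := by
  set d : Fin n → Fin n → ℝ := fun a b => |adjR F a b - adjR H a b| with hd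
  have hdv : ∀ a b, d a b = if ¬ (F.Adj a b ↔ H.Adj a b) then 1 else 0 := by
    intro a b
    simp only [hd, adjR]
    by_cases h1 : F.Adj a b <;> by_cases h2 : H.Adj a b <;> simp [h1, h2]
  have hsym : ∀ a b, d a b = d b a := by
    intro a b
    rw [hdv, hdv, F.adj_comm, H.adj_comm]
  have hdiag : ∀ a, d a a = 0 := by
    intro a
    rw [hdv]
    simp
  have hs : ∀ a b, d a b = (if a < b then d a b else 0) + (if b < a then d b a else 0) := by
    intro a b
    rcases lt_trichotomy a b with h | h | h
    · simp [h, h.not_gt]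
    · subst h
      simp [hdiag]
    · simp [h, h.not_gt, hsym a b]
  have hp : ∑ a : Fin n, ∑ b : Fin n, (if a < b then d a b else 0) =
      (((pairs n).filter fun e => ¬ (F.Adj e.1 e.2 ↔ H.Adj e.1 e.2)).card : ℝ) := by
    rw [← Finset.sum_product' , Finset.univ_product_univ, Finset.card_filter]
    push_cast
    rw [pairs, Finset.sum_filter]
    refine Finset.sum_congr rfl fun e _ => ?_
    simp only [hdv]
  have hp2 : ∑ a : Fin n, ∑ b : Fin n, (if b < a then d b a else 0) =
      ∑ a : Fin n, ∑ b : Fin n, (if a < b then d a b else 0) := Finset.sum_comm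
  have : ∑ a : Fin n, ∑ b : Fin n, d a b = ∑ a : Fin n, ∑ b : Fin n, (if a < b then d a b else 0) +
      ∑ a : Fin n, ∑ b : Fin n, (if b < a then d b a else 0) := by
    rw [← Finset.sum_add_distrib]
    refine Finset.sum_congr rfl fun a _ => ?_
    rw [← Finset.sum_add_distrib]
    exact Finset.sum_congr rfl fun b _ => hs a b
  rw [this, hp2, hp]
  linarith

open Classical in
theorem edit_close {n : ℕ} (F H : SimpleGraph (Fin n)) {η : ℝ} (hη : 0 ≤ η)
    (h : (((pairs n).filter fun e => ¬ (F.Adj e.1 e.2 ↔ H.Adj e.1 e.2)).card : ℝ) ≤ η * n ^ 2) :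
    CutBd mu mu (fun z => gk F z - gk H z) (2 * η) := by
  have h1 : DCut (fun a b => adjR F a b - adjR H a b) (2 * η * n ^ 2) := by
    intro A B
    calc |∑ a ∈ A, ∑ b ∈ B, (adjR F a b - adjR H a b)|
        ≤ ∑ a ∈ A, |∑ b ∈ B, (adjR F a b - adjR H a b)| := Finset.abs_sum_le_sum_abs _ _
      _ ≤ ∑ a ∈ A, ∑ b ∈ B, |adjR F a b - adjR H a b| :=
          Finset.sum_le_sum fun a _ => Finset.abs_sum_le_sum_abs _ _
      _ ≤ ∑ a ∈ A, ∑ b : Fin n, |adjR F a b - adjR H a b| :=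
          Finset.sum_le_sum fun a _ => Finset.sum_le_sum_of_subset_of_nonneg (Finset.subset_univ _)
            fun _ _ _ => abs_nonneg _
      _ ≤ ∑ a : Fin n, ∑ b : Fin n, |adjR F a b - adjR H a b| :=
          Finset.sum_le_sum_of_subset_of_nonneg (Finset.subset_univ _)
            fun _ _ _ => Finset.sum_nonneg fun _ _ => abs_nonneg _
      _ ≤ _ := edit_sum F H
      _ ≤ _ := by linarith
  have h2 := CutBd.of_dcut (by linarith) h1
  convert h2 using 2 with z
  rw [gk, gk, graphonOf_eq, graphonOf_eq, stepK_sub]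

open Classical in
theorem edit_d1 {n : ℕ} (F H : SimpleGraph (Fin n)) :
    (symmDiff H.edgeSet F.edgeSet).ncard ≤
      ((pairs n).filter fun e => ¬ (F.Adj e.1 e.2 ↔ H.Adj e.1 e.2)).card := by
  have hsub : symmDiff H.edgeSet F.edgeSet ⊆
      (((pairs n).filter fun e => ¬ (F.Adj e.1 e.2 ↔ H.Adj e.1 e.2)).image
        (fun e : Fin n × Fin n => s(e.1, e.2)) : Finset (Sym2 (Fin n))) := by
    intro s
    induction s using Sym2.ind with
    | _ a b =>
      intro hs
      rw [Set.mem_symmDiff, SimpleGraph.mem_edgeSet, SimpleGraph.mem_edgeSet] at hs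
      rw [Finset.coe_image]
      have hd : ¬ (F.Adj a b ↔ H.Adj a b) := by tauto
      rcases lt_trichotomy a b with h | h | h
      · refine ⟨(a, b), ?_, rfl⟩
        simp only [Finset.coe_filter, Set.mem_ofPred_eq, mem_pairs]
        exact ⟨h, hd⟩
      · subst h
        simp at hd
      · refine ⟨(b, a), ?_, Sym2.eq_swap⟩
        simp only [Finset.coe_filter, Set.mem_ofPred_eq, mem_pairs]
        refine ⟨h, ?_⟩
        rw [F.adj_comm, H.adj_comm]
        exact hd
  refine (Set.ncard_le_ncard hsub (Finset.finite_toSet _)).trans ?_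
  rw [Set.ncard_coe_finset]
  exact Finset.card_image_le

open Classical in
theorem edit_d1P {n : ℕ} (hn : 0 < n) (F H : SimpleGraph (Fin n)) (P : GraphProp) {η δ ε : ℝ} 
    (h : (((pairs n).filter fun e => ¬ (F.Adj e.1 e.2 ↔ H.Adj e.1 e.2)).card : ℝ) ≤ η * n ^ 2)
    (hP : graphD1P F P < ENNReal.ofReal δ) (hε : η + δ ≤ ε) : graphD1P H P < ENNReal.ofReal ε := by
  unfold graphD1P at hP
  simp only [iInf_lt_iff] at hP
  obtain ⟨K, hK, hlt⟩ := hP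
  have hn2 : (0 : ℝ) < (n : ℝ) ^ 2 := by positivity
  have h0 : 0 ≤ graphD1 F K := by unfold graphD1; positivity
  have hd : graphD1 F K < δ := (ENNReal.ofReal_lt_ofReal_iff_of_nonneg h0).1 hlt
  have key : graphD1 H K < ε := by
    unfold graphD1 at hd ⊢
    rw [div_lt_iff₀ hn2] at hd ⊢
    have h1 : (symmDiff H.edgeSet K.edgeSet).ncard ≤
        (symmDiff H.edgeSet F.edgeSet).ncard + (symmDiff F.edgeSet K.edgeSet).ncard :=
      (Set.ncard_le_ncard (symmDiff_triangle _ F.edgeSet _) (Set.toFinite _)).trans (Set.ncard_union_le _ _)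
    have h2 := edit_d1 F H
    have h1' : ((symmDiff H.edgeSet K.edgeSet).ncard : ℝ) ≤
        (symmDiff H.edgeSet F.edgeSet).ncard + (symmDiff F.edgeSet K.edgeSet).ncard := by exact_mod_cast h1
    have h2' : ((symmDiff H.edgeSet F.edgeSet).ncard : ℝ) ≤
      (((pairs n).filter fun e => ¬ (F.Adj e.1 e.2 ↔ H.Adj e.1 e.2)).card : ℝ) := by exact_mod_cast h2
    nlinarith
  refine lt_of_le_of_lt (iInf₂_le K hK) ?_
  refine (ENNReal.ofReal_lt_ofReal_iff_of_nonneg ?_).2 key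
  unfold graphD1
  positivity


/-! ## (c) implies (b) -/

theorem Cl.of_common {U V W : ℝ × ℝ → ℝ} (hU : PKer U) (hV : PKer V) (hW : PKer W) {r s : ℝ} {ψ Φ : InvMP}
    (h : CutBd mu mu (fun z => twist ψ U z - W z) r) (h' : CutBd mu mu (fun z => twist Φ V z - W z) s) :
    Cl (r + s) U V :=
  Cl.trans hU hW hV (Cl.symm hW hU ⟨ψ, h.symm⟩) ⟨Φ, h'.symm⟩

theorem edg_integral {n : ℕ} (Φ : InvMP) (H : SimpleGraph (Fin n)) {W : ℝ × ℝ → ℝ} (hW : PKer W) :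
    ∫ z, edg Φ H W z ∂(mu.prod mu) = ∫ z in {z | W z = 0}, twist Φ (gk H) z ∂(mu.prod mu) +
      ((mu.prod mu).real {z | W z = 1} - ∫ z in {z | W z = 1}, twist Φ (gk H) z ∂(mu.prod mu)) := by
  have hV := (gk_pker H).twist Φ
  have m0 : MeasurableSet {z | W z = 0} := hW.1 (measurableSet_singleton 0)
  have m1 : MeasurableSet {z | W z = 1} := hW.1 (measurableSet_singleton 1)
  have i0 : Integrable (twist Φ (gk H)) (mu.prod mu) := hV.bker.integrable _
  have i1 : Integrable (fun z => 1 - twist Φ (gk H) z) (mu.prod mu) := (integrable_const _).sub i0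
  unfold edg
  rw [integral_add (i0.indicator m0) (i1.indicator m1), integral_indicator m0, integral_indicator m1,
    integral_sub (integrable_const _) i0.integrableOn]
  simp

theorem edg_limit {W : ℝ × ℝ → ℝ} (hW : PKer W) {V : ℕ → ℝ × ℝ → ℝ}
    (h : ∀ E, MeasurableSet E → Tendsto (fun j => ∫ z in E, V j z ∂(mu.prod mu))
      (hyperfilter ℕ : Filter ℕ) (𝓝 (∫ z in E, W z ∂(mu.prod mu)))) :
    Tendsto (fun j => ∫ z in {z | W z = 0}, V j z ∂(mu.prod mu) +
      ((mu.prod mu).real {z | W z = 1} - ∫ z in {z | W z = 1}, V j z ∂(mu.prod mu)))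
      (hyperfilter ℕ : Filter ℕ) (𝓝 0) := by
  have m0 : MeasurableSet {z | W z = 0} := hW.1 (measurableSet_singleton 0)
  have m1 : MeasurableSet {z | W z = 1} := hW.1 (measurableSet_singleton 1)
  have h1 := (h _ m0).add (tendsto_const_nhds.sub (h _ m1) :
    Tendsto (fun j => (mu.prod mu).real {z | W z = 1} - ∫ z in {z | W z = 1}, V j z ∂(mu.prod mu)) _ _)
  have e0 : ∫ z in {z | W z = 0}, W z ∂(mu.prod mu) = 0 := by
    rw [setIntegral_congr_fun m0 (g := fun _ => (0 : ℝ)) (fun z hz => hz)]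
    simp
  have e1 : ∫ z in {z | W z = 1}, W z ∂(mu.prod mu) = (mu.prod mu).real {z | W z = 1} := by
    rw [setIntegral_congr_fun m1 (g := fun _ => (1 : ℝ)) (fun z hz => hz)]
    simp
  rw [e0, e1, sub_self, add_zero] at h1
  exact h1

theorem rate_tendsto : Tendsto (fun j : ℕ => 1 / ((j : ℝ) + 1) + 4 * (1 / 2 : ℝ) ^ j) atTop (𝓝 0) := by
  have h1 := tendsto_one_div_add_atTop_nhds_zero_nat (𝕜 := ℝ)
  have h2 := (tendsto_pow_atTop_nhds_zero_of_lt_one (r := (1 / 2 : ℝ)) (by norm_num) (by norm_num)).const_mul 4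
  simpa using h1.add h2

theorem c_to_b (P : GraphProp) (hc : CondC P) : CondB P := by
  intro ε hε
  by_contra hcon
  push Not at hcon
  choose n m G G' hG hd hn hm hfar using fun i : ℕ => hcon (1 / ((i : ℝ) + 1)) (i + 1) (by positivity) (by omega)
  obtain ⟨ε₀, n₀, hε₀, hn₀, hC⟩ := hc (ε / 2) (by linarith)
  obtain ⟨s, Φ, W, hs, hW, hcut, hlim⟩ := compactness m hm G'
  set η : ℝ := min (ε / 2) (ε₀ / 8) with hη
  have hηpos : 0 < η := lt_min (by linarith) (by linarith)
  have ev1 : ∀ᶠ j in (hyperfilter ℕ : Filter ℕ), ∫ z, edg (Φ j) (G' (s j)) W z ∂(mu.prod mu) < η := by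
    have := (edg_limit hW (V := fun j => twist (Φ j) (gk (G' (s j)))) hlim).eventually (gt_mem_nhds hηpos)
    filter_upwards [this] with j hj
    rw [edg_integral (Φ j) (G' (s j)) hW]
    exact hj
  have ev2 : ∀ᶠ j : ℕ in (hyperfilter ℕ : Filter ℕ), 1 / ((j : ℝ) + 1) + 4 * (1 / 2 : ℝ) ^ j < ε₀ / 8 :=
    Nat.hyperfilter_le_atTop (rate_tendsto.eventually (gt_mem_nhds (by linarith)))
  have ev3 : ∀ᶠ j in (hyperfilter ℕ : Filter ℕ), n₀ ≤ j := Nat.hyperfilter_le_atTop (eventually_ge_atTop n₀)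
  obtain ⟨j, ⟨hj1, hj2⟩, hj3⟩ := ((ev1.and ev2).and ev3).exists
  obtain ⟨F, hF1, hF2⟩ := edit_graph (G' (s j)) (Φ j) hW hj1.le
  set c : ℝ := ∫ x, ∏ e ∈ pairs (m (s j)), indK F W e (x e.1, x e.2) ∂(Measure.pi (nu (m (s j)) (Φ j))) with hcdef
  have hMbig : n₀ ≤ (m (s j)) := by
    have := hm (s j)
    have := hs j
    omega
  -- the rate of convergence for the graphs in the property
  have hrate : ∀ i : ℕ, ∃ ψ : InvMP, CutBd mu mu (fun z => twist ψ (gk (G (s i))) z - W z)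
      (1 / ((i : ℝ) + 1) + 4 * (1 / 2 : ℝ) ^ i) := by
    intro i
    have h1 : Cl (1 / ((s i : ℝ) + 1)) (gk (G (s i))) (gk (G' (s i))) :=
      Cl.of_deltaCut (graphonOf_pker _) (graphonOf_pker _) (hd (s i))
    have h2 : 1 / ((s i : ℝ) + 1) ≤ 1 / ((i : ℝ) + 1) := by
      apply one_div_le_one_div_of_le (by positivity)
      have : (i : ℝ) ≤ s i := by exact_mod_cast hs i
      linarith
    obtain ⟨φ, hφ⟩ := (h1.mono h2).symm (gk_pker _) (gk_pker _)
    refine ⟨φ.comp (Φ i), ?_⟩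
    have h3 := CutBd.twist ((gk_pker (G' (s i))).sub ((gk_pker (G (s i))).twist φ)) hφ (Φ i)
    have h4 : CutBd mu mu (fun z => twist (Φ i) (gk (G' (s i))) z - twist (φ.comp (Φ i)) (gk (G (s i))) z)
      (1 / ((i : ℝ) + 1)) := h3
    exact CutBd.trans ((gk_pker _).twist _) ((gk_pker _).twist _) hW h4.symm (hcut i)
  have ev4 : ∀ᶠ i : ℕ in atTop, ((pairs (m (s j))).card : ℝ) * ((m (s j) : ℝ) ^ 2 * (1 / ((i : ℝ) + 1) + 4 * (1 / 2 : ℝ) ^ i)) +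
      (pairs (m (s j))).card * ((m (s j) : ℝ) ^ 2 * (1 / ((i : ℝ) + 1))) < c := by
    have h1 := (rate_tendsto.const_mul ((m (s j) : ℝ) ^ 2)).const_mul ((pairs (m (s j))).card : ℝ)
    have h2 := ((tendsto_one_div_add_atTop_nhds_zero_nat (𝕜 := ℝ)).const_mul ((m (s j) : ℝ) ^ 2)).const_mul
      ((pairs (m (s j))).card : ℝ)
    have h3 := h1.add h2
    simp only [mul_zero, add_zero] at h3
    exact h3.eventually (gt_mem_nhds hF2)
  have ev5 : ∀ᶠ i : ℕ in atTop, 1 / ((i : ℝ) + 1) + 4 * (1 / 2 : ℝ) ^ i < ε₀ / 8 :=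
    rate_tendsto.eventually (gt_mem_nhds (by linarith))
  obtain ⟨i, hi1, hi2⟩ := (ev4.and ev5).exists
  obtain ⟨ψ, hψ⟩ := hrate i
  have hni : i + 1 ≤ n (s i) := by
    have := hn (s i)
    have := hs i
    omega
  have hind : IsInducedSubgraph (G (s i)) F := by
    refine find_copy (by omega) F (Φ j) ψ hW (G (s i)) hψ (lt_of_le_of_lt ?_ hi1)
    have h1 : 1 / (n (s i) : ℝ) ≤ 1 / ((i : ℝ) + 1) := by
      apply one_div_le_one_div_of_le (by positivity)
      exact_mod_cast hni
    have h2 : (m (s j) : ℝ) ^ 2 / (n (s i) : ℝ) ≤ (m (s j) : ℝ) ^ 2 * (1 / ((i : ℝ) + 1)) := by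
      rw [div_eq_mul_one_div]
      exact mul_le_mul_of_nonneg_left h1 (by positivity)
    have h3 := mul_le_mul_of_nonneg_left h2 (by positivity : (0 : ℝ) ≤ ((pairs (m (s j))).card : ℝ))
    linarith
  have hclose : Cl (ε₀ / 8 + ε₀ / 8 + 2 * η) (gk (G (s i))) (gk F) := by
    have h1 := Cl.of_common (gk_pker (G (s i))) (gk_pker (G' (s j))) hW hψ (hcut j)
    have h2 : Cl (2 * η) (gk (G' (s j))) (gk F) := ⟨InvMP.id, (edit_close F (G' (s j)) hηpos.le hF1).symm⟩
    refine (Cl.trans (gk_pker _) (gk_pker _) (gk_pker _) h1 h2).mono ?_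
    have : (0 : ℝ) ≤ 1 / ((j : ℝ) + 1) := by positivity
    linarith
  have hdc := deltaCut_le_of_Cl (graphonOf_pker _) (graphonOf_pker _) hclose
  have hη8 : η ≤ ε₀ / 8 := min_le_right _ _
  have hη2 : η ≤ ε / 2 := min_le_left _ _
  have hfin := hC _ _ (G (s i)) F (hG (s i)) hind (lt_of_le_of_lt hdc (by linarith)) hMbig
  have := edit_d1P (by omega) F (G' (s j)) P hF1 hfin (by linarith : η + ε / 2 ≤ ε)
  exact absurd this (not_lt.2 (hfar (s j)))

theorem testable_combinatorial_characterization
    (P : GraphProp) (hP : IsGraphProperty P) :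
    (GraphTestable P ↔
      ∀ ε : ℝ, 0 < ε → ∃ (ε' : ℝ) (n' : ℕ), 0 < ε' ∧ 0 < n' ∧
        ∀ (n m : ℕ) (G : SimpleGraph (Fin n)) (G' : SimpleGraph (Fin m)),
          G ∈ P n → deltaCut (graphonOf G) (graphonOf G') < ε' →
          n' ≤ n → n' ≤ m → graphD1P G' P < ENNReal.ofReal ε) ∧
    (GraphTestable P ↔
      ∀ ε : ℝ, 0 < ε → ∃ (ε₀ : ℝ) (n₀ : ℕ), 0 < ε₀ ∧ 0 < n₀ ∧
        ∀ (n m : ℕ) (G : SimpleGraph (Fin n)) (G' : SimpleGraph (Fin m)),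
          G ∈ P n → IsInducedSubgraph G G' →
          deltaCut (graphonOf G) (graphonOf G') < ε₀ →
          n₀ ≤ m → graphD1P G' P < ENNReal.ofReal ε) := by
  exact ⟨⟨a_to_b P, b_to_a P⟩, ⟨fun h => b_to_c P (a_to_b P h), fun h => b_to_a P (c_to_b P h)⟩⟩

end
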